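/- Let d ≥ 3 and let P ⊆ ℝ^d be a full-dimensional convex polytope that is edge-transitive but not vertex-transitive. Then d = 3 and there exist a linear isometry T of ℝ³ and a real λ > 0 such that P = λ • T(Q), where Q is either the rhombic dodecahedron or the rhombic triacontahedron. -/

import Mathlib

open Set Pointwise

noncomputable section

/-- Euclidean space `ℝ^d`. -/
abbrev Euc (d : ℕ) := EuclideanSpace ℝ (Fin d)

/-- A convex polytope: the convex hull of a finite set of points. -/
def IsPolytope {d : ℕ} (P : Set (Euc d)) : Prop :=
  ∃ S : Finset (Euc d), P = convexHull ℝ (S : Set (Euc d))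

/-- `P` is full-dimensional: its affine span is all of `ℝ^d`. -/
def FullDim {d : ℕ} (P : Set (Euc d)) : Prop :=
  affineSpan ℝ P = ⊤

/-- `[v,w]` is an edge of `P`: an exposed face of `P` which is a segment with `v ≠ w`. -/
def IsEdge {d : ℕ} (P : Set (Euc d)) (v w : Euc d) : Prop :=
  v ≠ w ∧ IsExposed ℝ P (segment ℝ v w)

/-- `e` is an edge of `P`, as a set. -/
def IsEdgeSet {d : ℕ} (P e : Set (Euc d)) : Prop :=
  ∃ v w : Euc d, IsEdge P v w ∧ e = segment ℝ v w

/-- `T` is a symmetry of `P`: a linear isometry mapping `P` onto itself. -/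
def IsAut {d : ℕ} (P : Set (Euc d)) (T : Euc d ≃ₗᵢ[ℝ] Euc d) : Prop :=
  T '' P = P

/-- `P` is vertex-transitive: any vertex (extreme point) can be mapped onto any
other by a symmetry of `P`. -/
def VertexTransitive {d : ℕ} (P : Set (Euc d)) : Prop :=
  ∀ v ∈ Set.extremePoints ℝ P, ∀ w ∈ Set.extremePoints ℝ P,
    ∃ T : Euc d ≃ₗᵢ[ℝ] Euc d, IsAut P T ∧ T v = w

/-- `P` is edge-transitive: any edge can be mapped onto any other by a symmetry of `P`. -/
def EdgeTransitive {d : ℕ} (P : Set (Euc d)) : Prop :=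
  ∀ e e' : Set (Euc d), IsEdgeSet P e → IsEdgeSet P e' →
    ∃ T : Euc d ≃ₗᵢ[ℝ] Euc d, IsAut P T ∧ T '' e = e'

/-- `P` is bipartite with vertex partition `V1, V2`, radii `r1 ≤ r2` and edge length `ℓ`:
all edges have length `ℓ`, every edge joins `V1` to `V2`, where `V1 ⊔ V2` is a partition of
the vertex set, and vertices in `Vᵢ` have norm `rᵢ`. -/
def IsBipartiteWith {d : ℕ} (P V1 V2 : Set (Euc d)) (r1 r2 ℓ : ℝ) : Prop :=
  (0 < ℓ) ∧ (∀ v w : Euc d, IsEdge P v w → ‖v - w‖ = ℓ) ∧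
  (V1 ∪ V2 = Set.extremePoints ℝ P) ∧ Disjoint V1 V2 ∧
  (∀ v w : Euc d, IsEdge P v w → (v ∈ V1 ∧ w ∈ V2) ∨ (v ∈ V2 ∧ w ∈ V1)) ∧
  (0 < r1) ∧ (r1 ≤ r2) ∧ (∀ v ∈ V1, ‖v‖ = r1) ∧ (∀ v ∈ V2, ‖v‖ = r2)

/-- `P` is a bipartite polytope. -/
def IsBipartite {d : ℕ} (P : Set (Euc d)) : Prop :=
  ∃ (V1 V2 : Set (Euc d)) (r1 r2 ℓ : ℝ), IsBipartiteWith P V1 V2 r1 r2 ℓ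

/-- `P` is a strictly bipartite polytope (`r1 < r2`). -/
def IsStrictlyBipartite {d : ℕ} (P : Set (Euc d)) : Prop :=
  ∃ (V1 V2 : Set (Euc d)) (r1 r2 ℓ : ℝ), IsBipartiteWith P V1 V2 r1 r2 ℓ ∧ r1 < r2

/-- The point `(a,b,c) ∈ ℝ³`. -/
def pt3 (a b c : ℝ) : Euc 3 := (WithLp.equiv 2 (Fin 3 → ℝ)).symm ![a, b, c]

/-- The rhombic dodecahedron: the convex hull of the 14 points
`(±1,±1,±1)`, `(±2,0,0)`, `(0,±2,0)`, `(0,0,±2)`. -/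
def rhombicDodecahedron : Set (Euc 3) :=
  convexHull ℝ
    ({pt3 1 1 1, pt3 1 1 (-1), pt3 1 (-1) 1, pt3 1 (-1) (-1),
      pt3 (-1) 1 1, pt3 (-1) 1 (-1), pt3 (-1) (-1) 1, pt3 (-1) (-1) (-1),
      pt3 2 0 0, pt3 (-2) 0 0, pt3 0 2 0, pt3 0 (-2) 0, pt3 0 0 2, pt3 0 0 (-2)} :
      Set (Euc 3))

/-- The golden ratio `(1 + √5)/2`. -/
noncomputable def goldenR : ℝ := (1 + Real.sqrt 5) / 2

/-- All cyclic permutations of the coordinates of `(0, ±a, ±b)`. -/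
def cycSigns (a b : ℝ) : Set (Euc 3) :=
  {x | ∃ s t : ℝ, (s = 1 ∨ s = -1) ∧ (t = 1 ∨ t = -1) ∧
    (x = pt3 0 (s * a) (t * b) ∨ x = pt3 (t * b) 0 (s * a) ∨ x = pt3 (s * a) (t * b) 0)}

/-- The 8 points `(±1,±1,±1)`. -/
def cubeVerts : Set (Euc 3) :=
  {x | ∃ s t u : ℝ, (s = 1 ∨ s = -1) ∧ (t = 1 ∨ t = -1) ∧ (u = 1 ∨ u = -1) ∧
    x = pt3 s t u}

/-- The rhombic triacontahedron: the convex hull of the 32 points `(±1,±1,±1)`,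
the cyclic permutations of the coordinates of `(0, ±1/φ, ±φ)`, and
the cyclic permutations of the coordinates of `(0, ±φ, ±1)`, where `φ` is the
golden ratio. -/
noncomputable def rhombicTriacontahedron : Set (Euc 3) :=
  convexHull ℝ (cubeVerts ∪ cycSigns (1 / goldenR) goldenR ∪ cycSigns goldenR 1)

section ConeGenerators

open scoped InnerProductSpace NNReal

variable {E : Type*} [NormedAddCommGroup E] [InnerProductSpace ℝ E]

/-- A point outside the convex hull of a finite set is strictly separated from it. -/
lemma exists_inner_lt_of_notMem_convexHull [FiniteDimensional ℝ E] (S : Finset E) (e : E)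
    (he : e ∉ convexHull ℝ (S : Set E)) : ∃ n : E, ∀ x ∈ S, ⟪n, x⟫_ℝ < ⟪n, e⟫_ℝ := by
  obtain ⟨f, u, hf, hu⟩ := geometric_hahn_banach_closed_point (convex_convexHull ℝ (S : Set E))
    (S.finite_toSet.isClosed_convexHull ℝ) he
  refine ⟨(InnerProductSpace.toDual ℝ E).symm f, fun x hx => ?_⟩
  simp only [InnerProductSpace.toDual_symm_apply]
  exact (hf x (subset_convexHull ℝ _ hx)).trans hu

/-- An extreme point of a convex hull is not in the convex hull of the other points. -/
lemma notMem_convexHull_erase [DecidableEq E] (S : Finset E) (e : E)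
    (he : e ∈ extremePoints ℝ (convexHull ℝ (S : Set E))) :
    e ∉ convexHull ℝ ((S.erase e : Finset E) : Set E) := by
  intro h
  have h1 : e ∈ extremePoints ℝ (convexHull ℝ ((S.erase e : Finset E) : Set E)) :=
    inter_extremePoints_subset_extremePoints_of_subset
      (convexHull_mono (by simp)) ⟨h, he⟩
  simpa using extremePoints_convexHull_subset h1

lemma convexHull_extremePoints_convexHull (S : Finset E) :
    convexHull ℝ (extremePoints ℝ (convexHull ℝ (S : Set E))) = convexHull ℝ (S : Set E) := by
  have h := closure_convexHull_extremePoints (S.finite_toSet.isCompact_convexHull ℝ)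
    (convex_convexHull ℝ (S : Set E))
  rwa [(S.finite_toSet.subset extremePoints_convexHull_subset).isClosed_convexHull
    ℝ |>.closure_eq] at h

lemma convex_span_nnreal (s : Set E) : Convex ℝ (Submodule.span ℝ≥0 s : Set E) := by
  intro x hx y hy a b ha hb _
  exact add_mem (Submodule.smul_mem _ (⟨a, ha⟩ : ℝ≥0) hx) (Submodule.smul_mem _ (⟨b, hb⟩ : ℝ≥0) hy)

lemma smul_mem_span_nnreal {s : Set E} {a : ℝ} (ha : 0 ≤ a) {x : E}
    (hx : x ∈ Submodule.span ℝ≥0 s) : a • x ∈ Submodule.span ℝ≥0 s :=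
  Submodule.smul_mem _ (⟨a, ha⟩ : ℝ≥0) hx

lemma mem_span_nnreal_image {ι : Type*} {A : Finset ι} {g : ι → E} {x : E}
    (hx : x ∈ Submodule.span ℝ≥0 (g '' A)) :
    ∃ c : ι → ℝ, (∀ i, 0 ≤ c i) ∧ x = ∑ i ∈ A, c i • g i := by
  classical
  obtain ⟨c, hc⟩ := (Submodule.mem_span_image_finset_iff_exists_fun ℝ≥0).1 hx
  refine ⟨fun i => if h : i ∈ A then c ⟨i, h⟩ else 0, fun i => ?_, ?_⟩
  · dsimp only; split_ifs <;> simp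
  · rw [← hc, ← Finset.sum_coe_sort A]
    refine Finset.sum_congr rfl fun i _ => ?_
    simp [NNReal.smul_def]

/-- A finite family in an open half-space has a generating subfamily spanning exposed rays of the
cone it generates. -/
lemma exists_exposed_generators [FiniteDimensional ℝ E] {ι : Type*} (S : Finset ι) (g : ι → E) (h : E)
    (hh : ∀ i ∈ S, ⟪h, g i⟫_ℝ < 0) :
    ∃ A ⊆ S, (∀ i ∈ S, g i ∈ Submodule.span ℝ≥0 (g '' A)) ∧
      ∀ a ∈ A, ∃ f : E, ⟪f, g a⟫_ℝ = 0 ∧ ∀ i ∈ S, ⟪f, g i⟫_ℝ ≤ 0 ∧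
        (⟪f, g i⟫_ℝ = 0 → ∃ t : ℝ, 0 < t ∧ g i = t • g a) := by
  classical
  let r : ι → ℝ := fun i => -⟪h, g i⟫_ℝ
  have hr : ∀ i ∈ S, 0 < r i := fun i hi => neg_pos.2 (hh i hi)
  let q : ι → E := fun i => (r i)⁻¹ • g i
  have hq : ∀ i ∈ S, g i = r i • q i := fun i hi => by
    simp only [q, smul_smul, mul_inv_cancel₀ (hr i hi).ne', one_smul]
  let S' := S.image q
  let A := S.filter fun i => q i ∈ extremePoints ℝ (convexHull ℝ (S' : Set E))
  refine ⟨A, Finset.filter_subset _ _, fun i hi => ?_, fun a ha => ?_⟩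
  · have h1 : q i ∈ convexHull ℝ (extremePoints ℝ (convexHull ℝ (S' : Set E))) := by
      rw [convexHull_extremePoints_convexHull]
      exact subset_convexHull ℝ _ (by simpa [S'] using ⟨i, hi, rfl⟩)
    have h2 : convexHull ℝ (extremePoints ℝ (convexHull ℝ (S' : Set E))) ⊆
        (Submodule.span ℝ≥0 (g '' A) : Set E) := by
      refine convexHull_min (fun e he => ?_) (convex_span_nnreal _)
      have : e ∈ (S' : Set E) := extremePoints_convexHull_subset he
      simp only [S', Finset.coe_image, mem_image, Finset.mem_coe] at this
      obtain ⟨j, hj, rfl⟩ := this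
      refine smul_mem_span_nnreal (inv_nonneg.2 (hr j hj).le) (Submodule.subset_span ⟨j, ?_, rfl⟩)
      simpa [A] using ⟨hj, he⟩
    rw [hq i hi]
    exact smul_mem_span_nnreal (hr i hi).le (h2 h1)
  · obtain ⟨haS, hae⟩ := Finset.mem_filter.1 ha
    obtain ⟨n, hn⟩ := exists_inner_lt_of_notMem_convexHull _ _ (notMem_convexHull_erase S' _ hae)
    have key : ∀ i ∈ S, ⟪n + ⟪n, q a⟫_ℝ • h, g i⟫_ℝ = r i * (⟪n, q i⟫_ℝ - ⟪n, q a⟫_ℝ) := by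
      intro i hi
      have : ⟪n, g i⟫_ℝ = r i * ⟪n, q i⟫_ℝ := by
        conv_lhs => rw [hq i hi]
        rw [real_inner_smul_right]
      rw [inner_add_left, real_inner_smul_left, this]
      simp only [r]; ring
    refine ⟨n + ⟪n, q a⟫_ℝ • h, by rw [key a haS]; simp, fun i hi => ?_⟩
    rw [key i hi]
    by_cases hia : q i = q a
    · refine ⟨by rw [hia]; simp, fun _ => ⟨r i * (r a)⁻¹, mul_pos (hr i hi) (inv_pos.2 (hr a haS)), ?_⟩⟩
      rw [hq i hi, hia, mul_smul]
    · have h3 := hn (q i) (Finset.mem_erase.2 ⟨hia, Finset.mem_image_of_mem q hi⟩)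
      have h4 := mul_neg_of_pos_of_neg (hr i hi) (sub_neg.2 h3)
      exact ⟨h4.le, fun h0 => absurd h0 h4.ne⟩

/-- The face of a finitely generated polytope cut out by a supporting functional. -/
lemma mem_convexHull_filter_of_inner_eq [DecidableEq E] (V : Finset E) (f : E) (r : ℝ)
    (hf : ∀ x ∈ V, ⟪f, x⟫_ℝ ≤ r) {y : E} (hy : y ∈ convexHull ℝ (V : Set E))
    (hyr : ⟪f, y⟫_ℝ = r) :
    y ∈ convexHull ℝ ((V.filter fun x => ⟪f, x⟫_ℝ = r : Finset E) : Set E) := by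
  classical
  obtain ⟨w, hw0, hw1, hwy⟩ := Finset.mem_convexHull'.1 hy
  have h0 : ∑ x ∈ V, w x * (r - ⟪f, x⟫_ℝ) = 0 := by
    have : ∑ x ∈ V, w x * ⟪f, x⟫_ℝ = r := by
      rw [← hyr, ← hwy, inner_sum]; simp [real_inner_smul_right]
    simp only [mul_sub, Finset.sum_sub_distrib, ← Finset.sum_mul, hw1, this]; ring
  have h1 := (Finset.sum_eq_zero_iff_of_nonneg
    (fun x hx => mul_nonneg (hw0 x hx) (sub_nonneg.2 (hf x hx)))).1 h0
  have h2 : ∀ x ∈ V, ¬ ⟪f, x⟫_ℝ = r → w x = 0 := fun x hx hne => by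
    rcases mul_eq_zero.1 (h1 x hx) with h | h
    · exact h
    · exact absurd (by linarith) hne
  refine Finset.mem_convexHull'.2 ⟨w, fun x hx => hw0 x (Finset.mem_filter.1 hx).1, ?_, ?_⟩
  · rw [← hw1, Finset.sum_filter]
    exact Finset.sum_congr rfl fun x hx => by split_ifs with h <;> simp [h2 x hx, *]
  · rw [← hwy, Finset.sum_filter]
    exact Finset.sum_congr rfl fun x hx => by split_ifs with h <;> simp [h2 x hx, *]

lemma inner_le_of_mem_convexHull (V : Finset E) (f : E) (r : ℝ)
    (hf : ∀ x ∈ V, ⟪f, x⟫_ℝ ≤ r) {y : E} (hy : y ∈ convexHull ℝ (V : Set E)) :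
    ⟪f, y⟫_ℝ ≤ r := by
  have : convexHull ℝ (V : Set E) ⊆ {y | ⟪f, y⟫_ℝ ≤ r} :=
    convexHull_min (fun x hx => hf x hx) (convex_halfSpace_le
      ⟨fun x y => inner_add_right _ _ _, fun c x => real_inner_smul_right _ _ _⟩ r)
  exact this hy

end ConeGenerators

section Skeleton

open scoped InnerProductSpace NNReal

variable {E : Type*} [NormedAddCommGroup E] [InnerProductSpace ℝ E]

/-- The edges from `v` to `w` and `x` span a face of dimension at most two of the polytope with
vertex set `V`. -/
def SpanTwoFace (V : Finset E) (v w x : E) : Prop :=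
  ∃ f : E, ⟪f, w⟫_ℝ = ⟪f, v⟫_ℝ ∧ ⟪f, x⟫_ℝ = ⟪f, v⟫_ℝ ∧ ∀ y ∈ V, ⟪f, y⟫_ℝ ≤ ⟪f, v⟫_ℝ ∧
    (⟪f, y⟫_ℝ = ⟪f, v⟫_ℝ → y - v ∈ Submodule.span ℝ {w - v, x - v})

/-- The vertex set `V` of a polytope, with the set `N v` of neighbours of each vertex `v` in its
edge graph, and the properties of edges and two-dimensional faces used below. -/
structure Skeleton (V : Finset E) (N : E → Finset E) : Prop where
  sub : ∀ v ∈ V, N v ⊆ V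
  symm : ∀ v ∈ V, ∀ w ∈ N v, v ∈ N w
  irrefl : ∀ v ∈ V, v ∉ N v
  extreme : ∀ v ∈ V, v ∉ convexHull ℝ ((V : Set E) \ {v})
  cone : ∀ v ∈ V, ∀ y ∈ V, ∃ c : E → ℝ, (∀ x, 0 ≤ c x) ∧ y - v = ∑ x ∈ N v, c x • (x - v)
  face : ∀ v ∈ V, ∀ w ∈ N v, ∃ A ⊆ N v, w ∉ A ∧ (∀ x ∈ A, SpanTwoFace V v w x) ∧
    ∀ y ∈ V, ∃ (s : ℝ) (c : E → ℝ), (∀ x, 0 ≤ c x) ∧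
      y - v = s • (w - v) + ∑ x ∈ A, c x • (x - v)

end Skeleton

section PolytopeSkeleton

open scoped InnerProductSpace NNReal

variable {d : ℕ} {P : Set (Euc d)} {V : Finset (Euc d)}

lemma IsPolytope.exists_vertices (hP : IsPolytope P) :
    ∃ V : Finset (Euc d), (V : Set (Euc d)) = extremePoints ℝ P ∧
      convexHull ℝ (V : Set (Euc d)) = P := by
  obtain ⟨S, rfl⟩ := hP
  have hfin := S.finite_toSet.subset (extremePoints_convexHull_subset (𝕜 := ℝ))
  refine ⟨hfin.toFinset, by simp, ?_⟩
  rw [Set.Finite.coe_toFinset]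
  exact convexHull_extremePoints_convexHull S

lemma IsEdge.symm {v w : Euc d} (h : IsEdge P v w) : IsEdge P w v :=
  ⟨h.1.symm, by rw [segment_symm]; exact h.2⟩

lemma IsEdge.exists_inner {v w : Euc d} (h : IsEdge P v w) :
    ∃ f : Euc d, segment ℝ v w = {x ∈ P | ∀ y ∈ P, ⟪f, y⟫_ℝ ≤ ⟪f, x⟫_ℝ} := by
  obtain ⟨l, hl⟩ := h.2 ⟨v, left_mem_segment ℝ v w⟩
  refine ⟨(InnerProductSpace.toDual ℝ _).symm l, ?_⟩
  simpa only [InnerProductSpace.toDual_symm_apply] using hl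

lemma isEdge_of_inner {v w f : Euc d} (hvw : v ≠ w)
    (h : segment ℝ v w = {x ∈ P | ∀ y ∈ P, ⟪f, y⟫_ℝ ≤ ⟪f, x⟫_ℝ}) : IsEdge P v w :=
  ⟨hvw, fun _ => ⟨InnerProductSpace.toDual ℝ _ f, by
    simpa only [InnerProductSpace.toDual_apply_apply] using h⟩⟩

lemma eq_or_eq_of_mem_segment {v w x : Euc d} (hx : x ∈ extremePoints ℝ P)
    (hv : v ∈ P) (hw : w ∈ P) (h : x ∈ segment ℝ v w) : x = v ∨ x = w := by
  rcases (segment_eq_image_lineMap ℝ v w ▸ h) with ⟨t, ht, rfl⟩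
  rcases eq_or_lt_of_le ht.1 with h0 | h0
  · left; simp [← h0]
  rcases eq_or_lt_of_le ht.2 with h1 | h1
  · right; simp [h1]
  left
  have := (mem_extremePoints.1 hx).2 v hv w hw (by
    rw [openSegment_eq_image_lineMap]; exact ⟨t, ⟨h0, h1⟩, rfl⟩)
  exact this.1.symm

lemma exists_inner_lt_vertex (hV : (V : Set (Euc d)) = extremePoints ℝ P)
    (hVP : convexHull ℝ (V : Set (Euc d)) = P) {v : Euc d} (hv : v ∈ V) :
    ∃ n : Euc d, ∀ x ∈ V, x ≠ v → ⟪n, x - v⟫_ℝ < 0 := by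
  classical
  have hve : v ∈ extremePoints ℝ (convexHull ℝ (V : Set (Euc d))) := by
    rw [hVP, ← hV]; exact hv
  obtain ⟨n, hn⟩ := exists_inner_lt_of_notMem_convexHull _ _ (notMem_convexHull_erase V v hve)
  refine ⟨n, fun x hx hxv => ?_⟩
  rw [inner_sub_right, sub_neg]
  exact hn x (Finset.mem_erase.2 ⟨hxv, hx⟩)

/-- The cone of a polytope at a vertex is generated by its edges there. -/
lemma sub_mem_span_edges (hV : (V : Set (Euc d)) = extremePoints ℝ P)
    (hVP : convexHull ℝ (V : Set (Euc d)) = P) {v : Euc d} (hv : v ∈ V) {y : Euc d} (hy : y ∈ V) :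
    y - v ∈ Submodule.span ℝ≥0 ((fun x => x - v) '' {x | x ∈ V ∧ IsEdge P v x}) := by
  classical
  have hPle : ∀ f : Euc d, ∀ r : ℝ, (∀ x ∈ V, ⟪f, x⟫_ℝ ≤ r) → ∀ z ∈ P, ⟪f, z⟫_ℝ ≤ r :=
    fun f r h z hz => inner_le_of_mem_convexHull V f r h (hVP ▸ hz)
  have hVsub : ∀ x ∈ V, x ∈ P := fun x hx => hVP ▸ subset_convexHull ℝ _ hx
  obtain ⟨n, hn⟩ := exists_inner_lt_vertex hV hVP hv
  obtain ⟨A, hAS, hgen, hexp⟩ := exists_exposed_generators (V.erase v) (fun x => x - v) n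
    (fun x hx => hn x (Finset.mem_of_mem_erase hx) (Finset.ne_of_mem_erase hx))
  by_cases hyv : y = v
  · rw [hyv, sub_self]; exact zero_mem _
  refine Submodule.span_le.2 ?_ (hgen y (Finset.mem_erase.2 ⟨hyv, hy⟩))
  rintro _ ⟨a, ha, rfl⟩
  obtain ⟨f, hfa, hf⟩ := hexp a ha
  have hav : a ≠ v := Finset.ne_of_mem_erase (hAS ha)
  have haV : a ∈ V := Finset.mem_of_mem_erase (hAS ha)
  -- the farthest vertex on the ray through `a`
  let R := V.filter fun x => x ≠ v ∧ ⟪f, x - v⟫_ℝ = 0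
  obtain ⟨x, hxR, hxmax⟩ := R.exists_max_image (fun x => -⟪n, x - v⟫_ℝ)
    ⟨a, by simpa [R] using ⟨haV, hav, hfa⟩⟩
  obtain ⟨hxV, hxv, hfx⟩ : x ∈ V ∧ x ≠ v ∧ ⟪f, x - v⟫_ℝ = 0 := by simpa [R] using hxR
  have hray : ∀ z ∈ V, z ≠ v → ⟪f, z - v⟫_ℝ = 0 → ∃ t : ℝ, 0 < t ∧ z - v = t • (a - v) :=
    fun z hz hzv h0 => (hf z (Finset.mem_erase.2 ⟨hzv, hz⟩)).2 h0
  obtain ⟨t, ht, hxt⟩ := hray x hxV hxv hfx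
  have hmax : ∀ z ∈ V, ⟪f, z⟫_ℝ ≤ ⟪f, v⟫_ℝ := fun z hz => by
    by_cases hzv : z = v
    · rw [hzv]
    · have := (hf z (Finset.mem_erase.2 ⟨hzv, hz⟩)).1
      rw [inner_sub_right] at this; linarith
  have hedge : IsEdge P v x := by
    refine isEdge_of_inner (f := f) hxv.symm (Subset.antisymm ?_ ?_)
    · refine fun z hz => ⟨(hVP ▸ convex_convexHull ℝ (V : Set (Euc d))).segment_subset
        (hVsub v hv) (hVsub x hxV) hz, fun z' hz' => ?_⟩
      obtain ⟨α, β, -, -, hαβ, rfl⟩ := hz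
      have h1 : ⟪f, x⟫_ℝ = ⟪f, v⟫_ℝ := by rw [inner_sub_right] at hfx; linarith
      have h2 : ⟪f, α • v + β • x⟫_ℝ = ⟪f, v⟫_ℝ := by
        rw [inner_add_right, real_inner_smul_right, real_inner_smul_right, h1, ← add_mul, hαβ,
          one_mul]
      rw [h2]
      exact hPle f _ hmax z' hz'
    · rintro z ⟨hzP, hz⟩
      have hzv : ⟪f, z⟫_ℝ = ⟪f, v⟫_ℝ := le_antisymm (hPle f _ hmax z hzP) (hz v (hVsub v hv))
      have := mem_convexHull_filter_of_inner_eq V f _ hmax (hVP ▸ hzP) hzv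
      refine convexHull_min ?_ (convex_segment v x) this
      intro u hu
      simp only [Finset.coe_filter, mem_ofPred_eq] at hu
      by_cases huv : u = v
      · rw [huv]; exact left_mem_segment ℝ v x
      obtain ⟨s, hs, hus⟩ := hray u hu.1 huv (by rw [inner_sub_right, hu.2, sub_self])
      have h3 := hxmax u (by
        simpa [R] using ⟨hu.1, huv, by rw [inner_sub_right, hu.2, sub_self]⟩)
      simp only [hus, hxt, real_inner_smul_right] at h3
      have hna := hn a haV hav
      have hst : s ≤ t := by nlinarith
      have hu' : u = v + (s / t) • (x - v) := by
        rw [hxt, smul_smul, div_mul_cancel₀ _ ht.ne', ← hus]; abel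
      rw [segment_eq_image']
      exact ⟨s / t, ⟨by positivity, (div_le_one ht).2 hst⟩, hu'.symm⟩
  have : a - v = t⁻¹ • (x - v) := by rw [hxt, smul_smul, inv_mul_cancel₀ ht.ne', one_smul]
  simp only [SetLike.mem_coe, this]
  exact smul_mem_span_nnreal (inv_nonneg.2 ht.le) (Submodule.subset_span ⟨x, ⟨hxV, hedge⟩, rfl⟩)

end PolytopeSkeleton

section PolytopeSkeleton

open scoped InnerProductSpace NNReal

variable {d : ℕ} {P : Set (Euc d)} {V : Finset (Euc d)}

/-- The orthogonal projection along a vector. -/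
lemma exists_projection_along (u : Euc d) : ∃ π : Euc d →ₗ[ℝ] Euc d,
    (∀ z, ∃ k : ℝ, z = π z + k • u) ∧ π u = 0 ∧ ∀ f z, ⟪π f, z⟫_ℝ = ⟪f, π z⟫_ℝ := by
  refine ⟨((ℝ ∙ u)ᗮ).starProjection, fun z => ?_, ?_, fun f z => ?_⟩
  · have h := Submodule.starProjection_add_starProjection_orthogonal (K := ℝ ∙ u) z
    obtain ⟨k, hk⟩ := Submodule.mem_span_singleton.1
      (Submodule.starProjection_apply_mem (ℝ ∙ u) z)
    exact ⟨k, by rw [hk, add_comm]; exact h.symm⟩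
  · exact Submodule.starProjection_orthogonal_apply_eq_zero (Submodule.mem_span_singleton_self u)
  · exact Submodule.inner_starProjection_left_eq_right _ f z

/-- The neighbours of a vertex in the edge graph of a polytope. -/
noncomputable def edgeNeighbors (P : Set (Euc d)) (V : Finset (Euc d)) (v : Euc d) : Finset (Euc d) :=
  open Classical in V.filter fun x => IsEdge P v x

lemma mem_edgeNeighbors {v x : Euc d} : x ∈ edgeNeighbors P V v ↔ x ∈ V ∧ IsEdge P v x := by
  classical
  simp [edgeNeighbors]

lemma exists_sub_eq_sum (hV : (V : Set (Euc d)) = extremePoints ℝ P)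
    (hVP : convexHull ℝ (V : Set (Euc d)) = P) {v : Euc d} (hv : v ∈ V) {y : Euc d} (hy : y ∈ V) :
    ∃ c : Euc d → ℝ, (∀ x, 0 ≤ c x) ∧ y - v = ∑ x ∈ edgeNeighbors P V v, c x • (x - v) := by
  refine mem_span_nnreal_image (g := fun x => x - v) ?_
  convert sub_mem_span_edges hV hVP hv hy using 3
  ext x
  simp [mem_edgeNeighbors]

/-- The two-dimensional faces at an edge generate the polytope modulo that edge. -/
lemma exists_twoFace_generators (hV : (V : Set (Euc d)) = extremePoints ℝ P)
    (hVP : convexHull ℝ (V : Set (Euc d)) = P) {v w : Euc d} (hv : v ∈ V)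
    (hw : w ∈ edgeNeighbors P V v) :
    ∃ A ⊆ edgeNeighbors P V v, w ∉ A ∧ (∀ x ∈ A, SpanTwoFace V v w x) ∧
    ∀ y ∈ V, ∃ (s : ℝ) (c : Euc d → ℝ), (∀ x, 0 ≤ c x) ∧
      y - v = s • (w - v) + ∑ x ∈ A, c x • (x - v) := by
  classical
  obtain ⟨hwV, hvw⟩ := mem_edgeNeighbors.1 hw
  have hVsub : ∀ x ∈ V, x ∈ P := fun x hx => hVP ▸ subset_convexHull ℝ _ hx
  obtain ⟨h, hh⟩ := hvw.exists_inner
  have hvm : v ∈ {x ∈ P | ∀ y ∈ P, ⟪h, y⟫_ℝ ≤ ⟪h, x⟫_ℝ} := hh ▸ left_mem_segment ℝ v w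
  have hwm : w ∈ {x ∈ P | ∀ y ∈ P, ⟪h, y⟫_ℝ ≤ ⟪h, x⟫_ℝ} := hh ▸ right_mem_segment ℝ v w
  have hhw : ⟪h, w - v⟫_ℝ = 0 := by
    rw [inner_sub_right, sub_eq_zero]
    exact le_antisymm (hvm.2 w hwm.1) (hwm.2 v hvm.1)
  have hneg : ∀ x ∈ V, x ≠ v → x ≠ w → ⟪h, x - v⟫_ℝ < 0 := fun x hx hxv hxw => by
    rw [inner_sub_right, sub_neg]
    refine lt_of_le_of_ne (hvm.2 x (hVsub x hx)) fun heq => ?_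
    have hxs : x ∈ segment ℝ v w := by
      rw [hh]; exact ⟨hVsub x hx, fun y hy => heq ▸ hvm.2 y hy⟩
    rcases eq_or_eq_of_mem_segment (hV ▸ hx) hvm.1 hwm.1 hxs with h | h
    exacts [hxv h, hxw h]
  obtain ⟨π, hπ, hπu, hπs⟩ := exists_projection_along (w - v)
  have hhπ : ∀ z, ⟪h, π z⟫_ℝ = ⟪h, z⟫_ℝ := fun z => by
    obtain ⟨k, hk⟩ := hπ z
    conv_rhs => rw [hk]
    rw [inner_add_right, real_inner_smul_right, hhw, mul_zero, add_zero]
  obtain ⟨A, hAS, hgen, hexp⟩ := exists_exposed_generators ((edgeNeighbors P V v).erase w)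
    (fun x => π (x - v)) h (fun x hx => by
      rw [hhπ]
      obtain ⟨hxw, hx⟩ := Finset.mem_erase.1 hx
      obtain ⟨hxV, hx⟩ := mem_edgeNeighbors.1 hx
      exact hneg x hxV hx.1.symm hxw)
  refine ⟨A, fun x hx => Finset.mem_of_mem_erase (hAS hx),
    fun hwA => (Finset.ne_of_mem_erase (hAS hwA)) rfl, fun x hx => ?_, fun y hy => ?_⟩
  · obtain ⟨f, hfx, hf⟩ := hexp x hx
    have hF : ∀ i ∈ edgeNeighbors P V v, ⟪f, π (i - v)⟫_ℝ ≤ 0 ∧ (⟪f, π (i - v)⟫_ℝ = 0 →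
        i - v ∈ Submodule.span ℝ {w - v, x - v}) := fun i hi => by
      by_cases hiw : i = w
      · subst hiw
        rw [hπu, inner_zero_right]
        exact ⟨le_rfl, fun _ => Submodule.subset_span (by simp)⟩
      · obtain ⟨h1, h2⟩ := hf i (Finset.mem_erase.2 ⟨hiw, hi⟩)
        refine ⟨h1, fun h3 => ?_⟩
        obtain ⟨t, -, ht⟩ := h2 h3
        obtain ⟨k, hk⟩ := hπ (i - v)
        obtain ⟨l, hl⟩ := hπ (x - v)
        have : i - v = (k - t * l) • (w - v) + t • (x - v) := by
          rw [hk, ht]; nth_rewrite 2 [hl]; module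
        rw [this]
        exact add_mem (Submodule.smul_mem _ _ (Submodule.subset_span (by simp)))
          (Submodule.smul_mem _ _ (Submodule.subset_span (by simp)))
    have hsub : ∀ y, ⟪π f, y⟫_ℝ - ⟪π f, v⟫_ℝ = ⟪f, π (y - v)⟫_ℝ := fun y => by
      rw [← inner_sub_right, hπs]
    refine ⟨π f, ?_, ?_, fun y hy => ?_⟩
    · rw [← sub_eq_zero, hsub, hπu, inner_zero_right]
    · rw [← sub_eq_zero, hsub, hfx]
    obtain ⟨c, hc, hyc⟩ := exists_sub_eq_sum hV hVP hv hy
    have hsum : ⟪π f, y⟫_ℝ - ⟪π f, v⟫_ℝ =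
        ∑ i ∈ edgeNeighbors P V v, c i * ⟪f, π (i - v)⟫_ℝ := by
      rw [hsub, hyc, map_sum, inner_sum]
      simp [real_inner_smul_right]
    have hterm : ∀ i ∈ edgeNeighbors P V v, c i * ⟪f, π (i - v)⟫_ℝ ≤ 0 := fun i hi =>
      mul_nonpos_of_nonneg_of_nonpos (hc i) (hF i hi).1
    refine ⟨by linarith [Finset.sum_nonpos hterm], fun h0 => ?_⟩
    rw [h0, sub_self] at hsum
    have hz := (Finset.sum_eq_zero_iff_of_nonpos hterm).1 hsum.symm
    rw [hyc]
    refine Submodule.sum_mem _ fun i hi => ?_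
    rcases mul_eq_zero.1 (hz i hi) with h1 | h1
    · rw [h1, zero_smul]; exact zero_mem _
    · exact Submodule.smul_mem _ _ ((hF i hi).2 h1)
  · obtain ⟨c, hc, hyc⟩ := exists_sub_eq_sum hV hVP hv hy
    have hmem : π (y - v) ∈ Submodule.span ℝ≥0 ((fun x => π (x - v)) '' A) := by
      rw [hyc, map_sum]
      refine Submodule.sum_mem _ fun i hi => ?_
      rw [map_smul]
      refine smul_mem_span_nnreal (hc i) ?_
      by_cases hiw : i = w
      · rw [hiw, hπu]; exact zero_mem _
      · exact hgen i (Finset.mem_erase.2 ⟨hiw, hi⟩)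
    obtain ⟨e, he, hye⟩ := mem_span_nnreal_image hmem
    obtain ⟨k, hk⟩ := hπ (y - v - ∑ x ∈ A, e x • (x - v))
    have h0 : π (y - v - ∑ x ∈ A, e x • (x - v)) = 0 := by
      rw [map_sub, map_sum, hye]; simp
    refine ⟨k, e, he, ?_⟩
    rw [h0, zero_add] at hk
    rw [← hk]; abel

lemma skeleton_edgeNeighbors (hV : (V : Set (Euc d)) = extremePoints ℝ P)
    (hVP : convexHull ℝ (V : Set (Euc d)) = P) : Skeleton V (edgeNeighbors P V) where
  sub _ _ _ hx := (mem_edgeNeighbors.1 hx).1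
  symm _ hv _ hw := mem_edgeNeighbors.2 ⟨hv, (mem_edgeNeighbors.1 hw).2.symm⟩
  irrefl _ _ h := (mem_edgeNeighbors.1 h).2.1 rfl
  extreme v hv := by
    classical
    have := notMem_convexHull_erase V v (by rw [hVP, ← hV]; exact hv)
    rwa [Finset.coe_erase] at this
  cone _ hv _ hy := exists_sub_eq_sum hV hVP hv hy
  face _ hv _ hw := exists_twoFace_generators hV hVP hv hw

end PolytopeSkeleton

section BipartiteSkeleton

open scoped InnerProductSpace

variable {E : Type*} [NormedAddCommGroup E] [InnerProductSpace ℝ E]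

/-- A skeleton with bipartition `V₁ ∪ V₂`, whose classes have squared radii `a` and `b`,
with constant inner product `m` along edges. -/
structure BipartiteSkeleton (V : Finset E) (N : E → Finset E) (V₁ V₂ : Set E) (a b m : ℝ) : Prop
    extends Skeleton V N where
  mem_iff : ∀ v, v ∈ V ↔ v ∈ V₁ ∨ v ∈ V₂
  disj : ∀ v ∈ V₁, v ∉ V₂
  ne₁ : V₁.Nonempty
  ne₂ : V₂.Nonempty
  adj₁ : ∀ v ∈ V₁, ∀ w ∈ N v, w ∈ V₂
  adj₂ : ∀ v ∈ V₂, ∀ w ∈ N v, w ∈ V₁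
  sq₁ : ∀ v ∈ V₁, ⟪v, v⟫_ℝ = a
  sq₂ : ∀ v ∈ V₂, ⟪v, v⟫_ℝ = b
  edge : ∀ v ∈ V, ∀ w ∈ N v, ⟪v, w⟫_ℝ = m
  full : ∀ v ∈ V, ∀ z, (∀ x ∈ N v, ⟪z, x - v⟫_ℝ = 0) → z = 0
  sum_zero : ∑ x ∈ V, x = 0
  row : ∀ v ∈ V, ∃ σ : ℝ, ∀ w ∈ N v, ⟪w - v, ∑ x ∈ N v, (x - v)⟫_ℝ = σ

namespace BipartiteSkeleton

variable {V : Finset E} {N : E → Finset E} {V₁ V₂ : Set E} {a b m : ℝ}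

lemma swap (S : BipartiteSkeleton V N V₁ V₂ a b m) : BipartiteSkeleton V N V₂ V₁ b a m :=
  { S with
    mem_iff := fun v => by rw [S.mem_iff, or_comm]
    disj := fun v h h' => S.disj v h' h
    ne₁ := S.ne₂
    ne₂ := S.ne₁
    adj₁ := S.adj₂
    adj₂ := S.adj₁
    sq₁ := S.sq₂
    sq₂ := S.sq₁ }

lemma mem₁ (S : BipartiteSkeleton V N V₁ V₂ a b m) {v : E} (hv : v ∈ V₁) : v ∈ V :=
  (S.mem_iff v).2 (Or.inl hv)

lemma mem₂ (S : BipartiteSkeleton V N V₁ V₂ a b m) {v : E} (hv : v ∈ V₂) : v ∈ V :=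
  (S.mem_iff v).2 (Or.inr hv)

lemma inner_edge_sub (S : BipartiteSkeleton V N V₁ V₂ a b m) {v w : E} (hv : v ∈ V₁)
    (hw : w ∈ N v) : ⟪v, w - v⟫_ℝ = m - a := by
  rw [inner_sub_right, S.edge v (S.mem₁ hv) w hw, S.sq₁ v hv]

lemma lt₁ (S : BipartiteSkeleton V N V₁ V₂ a b m) : m < a := by
  by_contra! h
  obtain ⟨v, hv⟩ := S.ne₁
  obtain ⟨q, hq⟩ := S.ne₂
  have h1 : ∀ y ∈ V, a ≤ ⟪v, y⟫_ℝ := fun y hy => by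
    obtain ⟨c, hc, hyc⟩ := S.cone v (S.mem₁ hv) y hy
    have h2 : 0 ≤ ⟪v, y - v⟫_ℝ := by
      rw [hyc, inner_sum]
      refine Finset.sum_nonneg fun x hx => ?_
      rw [real_inner_smul_right, S.inner_edge_sub hv hx]
      exact mul_nonneg (hc x) (by linarith)
    rw [inner_sub_right, S.sq₁ v hv] at h2
    linarith
  have h2 : (V.card : ℝ) * a ≤ 0 := by
    have := Finset.card_nsmul_le_sum V _ _ h1
    rwa [← inner_sum, S.sum_zero, inner_zero_right, nsmul_eq_mul] at this
  have hcard : (0 : ℝ) < V.card := by exact_mod_cast Finset.card_pos.2 ⟨v, S.mem₁ hv⟩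
  have ha : a ≤ 0 := by nlinarith
  have hv0 : v = 0 := by
    rw [← S.sq₁ v hv] at ha
    exact inner_self_eq_zero.1 (le_antisymm ha real_inner_self_nonneg)
  classical
  have hsum : ∑ x ∈ V.erase v, x = 0 := by
    rw [← S.sum_zero, ← Finset.add_sum_erase V _ (S.mem₁ hv), hv0, zero_add]
  have hqv : q ≠ v := fun h => S.disj v hv (h ▸ hq)
  have hne : (V.erase v).Nonempty := ⟨q, Finset.mem_erase.2 ⟨hqv, S.mem₂ hq⟩⟩
  refine S.extreme v (S.mem₁ hv) ?_
  rw [← Finset.coe_erase]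
  have := (V.erase v).centroid_mem_convexHull (R := ℝ) hne
  rwa [Finset.centroid_eq_centerMass _ hne, Finset.centerMass_eq_of_sum_1 _ _
    (Finset.sum_centroidWeights_eq_one_of_nonempty ℝ _ hne),
    show ∑ i ∈ V.erase v, (V.erase v).centroidWeights ℝ i • id i = v from by
      simp only [Finset.centroidWeights_apply, id]
      rw [← Finset.smul_sum, hsum, smul_zero, hv0]] at this

lemma lt₂ (S : BipartiteSkeleton V N V₁ V₂ a b m) : m < b := S.swap.lt₁

end BipartiteSkeleton

end BipartiteSkeleton

section Orbits

open scoped InnerProductSpace NNReal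

variable {d : ℕ} {P : Set (Euc d)} {V : Finset (Euc d)}

lemma IsAut.symm {T : Euc d ≃ₗᵢ[ℝ] Euc d} (h : IsAut P T) : IsAut P T.symm := by
  unfold IsAut at *
  conv_lhs => rw [← h]
  ext x; simp

lemma IsAut.trans {S T : Euc d ≃ₗᵢ[ℝ] Euc d} (hS : IsAut P S) (hT : IsAut P T) :
    IsAut P (S.trans T) := by
  unfold IsAut at *
  rw [LinearIsometryEquiv.coe_trans, image_comp, hS, hT]

lemma IsAut.mem_vertices (hV : (V : Set (Euc d)) = extremePoints ℝ P) {T : Euc d ≃ₗᵢ[ℝ] Euc d}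
    (hT : IsAut P T) {v : Euc d} (hv : v ∈ V) : T v ∈ V := by
  have h : T '' extremePoints ℝ P = extremePoints ℝ P := by
    conv_rhs => rw [← show T '' P = P from hT]
    exact image_extremePoints T P
  rw [← Finset.mem_coe, hV, ← h]
  exact mem_image_of_mem T (hV ▸ hv)

lemma image_segment_isometry (T : Euc d ≃ₗᵢ[ℝ] Euc d) (v w : Euc d) :
    T '' segment ℝ v w = segment ℝ (T v) (T w) :=
  image_segment ℝ T.toLinearEquiv.toLinearMap.toAffineMap v w

lemma IsAut.isEdge {T : Euc d ≃ₗᵢ[ℝ] Euc d} (hT : IsAut P T) {v w : Euc d} (h : IsEdge P v w) :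
    IsEdge P (T v) (T w) := by
  obtain ⟨f, hf⟩ := h.exists_inner
  have hT' : ∀ x, x ∈ P ↔ ∃ y ∈ P, T y = x := fun x => by
    conv_lhs => rw [← show T '' P = P from hT]
    rfl
  refine isEdge_of_inner (f := T f) (fun h' => h.1 (T.injective h')) ?_
  rw [← image_segment_isometry, hf]
  ext x
  constructor
  · rintro ⟨y, ⟨hy, hmax⟩, rfl⟩
    refine ⟨(hT' _).2 ⟨y, hy, rfl⟩, fun z hz => ?_⟩
    obtain ⟨z', hz', rfl⟩ := (hT' z).1 hz
    simpa only [LinearIsometryEquiv.inner_map_map] using hmax z' hz'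
  · rintro ⟨hx, hmax⟩
    obtain ⟨y, hy, rfl⟩ := (hT' x).1 hx
    refine ⟨y, ⟨hy, fun z hz => ?_⟩, rfl⟩
    simpa only [LinearIsometryEquiv.inner_map_map] using hmax (T z) ((hT' _).2 ⟨z, hz, rfl⟩)

lemma EdgeTransitive.exists_isAut (hV : (V : Set (Euc d)) = extremePoints ℝ P)
    (hVP : convexHull ℝ (V : Set (Euc d)) = P)
    (hET : EdgeTransitive P) {p q v w : Euc d} (hp : p ∈ V) (hq : q ∈ V) (hv : v ∈ V) (hw : w ∈ V)
    (hpq : IsEdge P p q) (hvw : IsEdge P v w) :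
    ∃ T, IsAut P T ∧ ((T p = v ∧ T q = w) ∨ (T p = w ∧ T q = v)) := by
  obtain ⟨T, hT, h⟩ := hET _ _ ⟨p, q, hpq, rfl⟩ ⟨v, w, hvw, rfl⟩
  rw [image_segment_isometry] at h
  have hVsub : ∀ x ∈ V, x ∈ P := fun x hx => hVP ▸ subset_convexHull ℝ _ hx
  have h1 := eq_or_eq_of_mem_segment (P := P) (hV ▸ hT.mem_vertices hV hp) (hVsub v hv) (hVsub w hw)
    (h ▸ left_mem_segment ℝ (T p) (T q))
  have h2 := eq_or_eq_of_mem_segment (P := P) (hV ▸ hT.mem_vertices hV hq) (hVsub v hv) (hVsub w hw)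
    (h ▸ right_mem_segment ℝ (T p) (T q))
  have h3 : T p ≠ T q := fun h => hpq.1 (T.injective h)
  refine ⟨T, hT, ?_⟩
  rcases h1 with h1 | h1 <;> rcases h2 with h2 | h2
  · exact (h3 (h1.trans h2.symm)).elim
  · exact Or.inl ⟨h1, h2⟩
  · exact Or.inr ⟨h1, h2⟩
  · exact (h3 (h1.trans h2.symm)).elim

lemma FullDim.eq_zero_of_inner_eq (hfull : FullDim P) (hVP : convexHull ℝ (V : Set (Euc d)) = P)
    {z : Euc d} {r : ℝ} (h : ∀ y ∈ V, ⟪z, y⟫_ℝ = r) : z = 0 := by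
  have h1 : ∀ y ∈ P, ⟪z, y⟫_ℝ = r := fun y hy => by
    refine le_antisymm (inner_le_of_mem_convexHull V z r (fun x hx => (h x hx).le) (hVP ▸ hy)) ?_
    have := inner_le_of_mem_convexHull V (-z) (-r) (y := y)
      (fun x hx => by rw [inner_neg_left, h x hx]) (hVP ▸ hy)
    rw [inner_neg_left] at this
    linarith
  have h2 : vectorSpan ℝ P = ⊤ := by
    rw [← direction_affineSpan, show affineSpan ℝ P = ⊤ from hfull, AffineSubspace.direction_top]
  have h3 : vectorSpan ℝ P ≤ (ℝ ∙ z)ᗮ := by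
    rw [vectorSpan_def]
    refine Submodule.span_le.2 ?_
    rintro _ ⟨x, hx, y, hy, rfl⟩
    rw [SetLike.mem_coe, Submodule.mem_orthogonal_singleton_iff_inner_right]
    simp [inner_sub_right, h1 x hx, h1 y hy]
  have h4 : z ∈ (ℝ ∙ z)ᗮ := h3 (h2 ▸ Submodule.mem_top)
  rw [Submodule.mem_orthogonal_singleton_iff_inner_right] at h4
  exact inner_self_eq_zero.1 h4

end Orbits

section Orbits

open scoped InnerProductSpace NNReal

variable {d : ℕ} {P : Set (Euc d)} {V : Finset (Euc d)}

lemma exists_ne_zero_inner_eq_zero (hd : 3 ≤ d) (u : Euc d) : ∃ z : Euc d, z ≠ 0 ∧ ⟪z, u⟫_ℝ = 0 := by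
  have h1 := Submodule.finrank_add_finrank_orthogonal (ℝ ∙ u)
  have h2 : Module.finrank ℝ (ℝ ∙ u) ≤ 1 := by
    simpa using finrank_span_le_card (R := ℝ) ({u} : Set (Euc d))
  rw [finrank_euclideanSpace_fin] at h1
  have h3 : (ℝ ∙ u)ᗮ ≠ ⊥ := fun h => by
    rw [h, finrank_bot] at h1; omega
  obtain ⟨z, hz, hz0⟩ := Submodule.exists_mem_ne_zero_of_ne_bot h3
  exact ⟨z, hz0, (Submodule.mem_orthogonal_singleton_iff_inner_left).1 hz⟩

lemma FullDim.exists_mem_edgeNeighbors (hd : 3 ≤ d) (hfull : FullDim P)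
    (hV : (V : Set (Euc d)) = extremePoints ℝ P)
    (hVP : convexHull ℝ (V : Set (Euc d)) = P) {v : Euc d} (hv : v ∈ V) :
    ∃ w, w ∈ edgeNeighbors P V v := by
  by_contra! h
  have h1 : ∀ y ∈ V, y = v := fun y hy => by
    obtain ⟨c, -, hc⟩ := exists_sub_eq_sum hV hVP hv hy
    rwa [Finset.sum_eq_zero (fun x hx => (h x hx).elim), sub_eq_zero] at hc
  obtain ⟨z, hz, -⟩ := exists_ne_zero_inner_eq_zero hd v
  exact hz (hfull.eq_zero_of_inner_eq hVP (r := ⟪z, v⟫_ℝ) fun y hy => by rw [h1 y hy])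

lemma FullDim.eq_zero_of_edges (hfull : FullDim P)
    (hV : (V : Set (Euc d)) = extremePoints ℝ P)
    (hVP : convexHull ℝ (V : Set (Euc d)) = P) {v : Euc d} (hv : v ∈ V) {z : Euc d}
    (h : ∀ x ∈ edgeNeighbors P V v, ⟪z, x - v⟫_ℝ = 0) : z = 0 := by
  refine hfull.eq_zero_of_inner_eq hVP (r := ⟪z, v⟫_ℝ) fun y hy => ?_
  obtain ⟨c, -, hc⟩ := exists_sub_eq_sum hV hVP hv hy
  rw [← sub_eq_zero, ← inner_sub_right, hc, inner_sum]
  exact Finset.sum_eq_zero fun x hx => by rw [real_inner_smul_right, h x hx, mul_zero]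

/-- If all vertices adjacent to `p` are separated from it by the same amount by `g`, then no other
vertex has the same value of `g` as `p`. -/
lemma eq_of_inner_eq (hV : (V : Set (Euc d)) = extremePoints ℝ P)
    (hVP : convexHull ℝ (V : Set (Euc d)) = P) {p y g : Euc d} {r : ℝ} (hp : p ∈ V) (hy : y ∈ V)
    (hr : r ≠ 0) (h : ∀ x ∈ edgeNeighbors P V p, ⟪g, x - p⟫_ℝ = r)
    (hyp : ⟪g, y⟫_ℝ = ⟪g, p⟫_ℝ) : y = p := by
  obtain ⟨c, hc, hyc⟩ := exists_sub_eq_sum hV hVP hp hy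
  have h1 : ⟪g, y - p⟫_ℝ = (∑ x ∈ edgeNeighbors P V p, c x) * r := by
    rw [hyc, inner_sum, Finset.sum_mul]
    exact Finset.sum_congr rfl fun x hx => by rw [real_inner_smul_right, h x hx]
  rw [inner_sub_right, hyp, sub_self] at h1
  have h2 := (mul_eq_zero.1 h1.symm).resolve_right hr
  rw [Finset.sum_eq_zero_iff_of_nonneg fun x _ => hc x] at h2
  rw [← sub_eq_zero, hyc]
  exact Finset.sum_eq_zero fun x hx => by rw [h2 x hx, zero_smul]

lemma isAut_of_mapsTo (hVP : convexHull ℝ (V : Set (Euc d)) = P) {g : Euc d ≃ₗᵢ[ℝ] Euc d}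
    (hg : ∀ x ∈ V, g x ∈ V) : IsAut P g := by
  classical
  have h : V.image g = V := Finset.eq_of_subset_of_card_le (Finset.image_subset_iff.2 hg)
    (Finset.card_image_of_injective V g.injective).ge
  have h' := LinearMap.image_convexHull (𝕜 := ℝ) g.toLinearEquiv.toLinearMap (V : Set (Euc d))
  change g '' convexHull ℝ (V : Set (Euc d)) = convexHull ℝ (g '' (V : Set (Euc d))) at h'
  rwa [← Finset.coe_image, h, hVP] at h'

/-- An edge-transitive polytope which is not vertex-transitive has a bipartite skeleton. -/
lemma EdgeTransitive.exists_bipartiteSkeleton (hd : 3 ≤ d)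
    (hfull : FullDim P) (hET : EdgeTransitive P) (hVT : ¬ VertexTransitive P)
    (hV : (V : Set (Euc d)) = extremePoints ℝ P) (hVP : convexHull ℝ (V : Set (Euc d)) = P) :
    ∃ (V₁ V₂ : Set (Euc d)) (a b m : ℝ),
      BipartiteSkeleton V (edgeNeighbors P V) V₁ V₂ a b m ∧
      ∀ g : Euc d ≃ₗᵢ[ℝ] Euc d, (∀ x ∈ V, g x ∈ V) → ∀ v ∈ V₁, g v ∉ V₂ := by
  classical
  have hVne : ∃ p, p ∈ V := by
    by_contra! h
    refine hVT fun v hv => ?_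
    rw [← hV] at hv
    exact (h v hv).elim
  obtain ⟨p, hp⟩ := hVne
  obtain ⟨q, hq'⟩ := hfull.exists_mem_edgeNeighbors hd hV hVP hp
  obtain ⟨hq, hpq⟩ := mem_edgeNeighbors.1 hq'
  have htr : ∀ v w, w ∈ edgeNeighbors P V v → v ∈ V →
      ∃ T, IsAut P T ∧ ((T p = v ∧ T q = w) ∨ (T p = w ∧ T q = v)) := fun v w hw hv =>
    hET.exists_isAut hV hVP hp hq hv (mem_edgeNeighbors.1 hw).1 hpq (mem_edgeNeighbors.1 hw).2
  have hcov : ∀ v ∈ V, (∃ T, IsAut P T ∧ T p = v) ∨ ∃ T, IsAut P T ∧ T q = v := fun v hv => by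
    obtain ⟨w, hw⟩ := hfull.exists_mem_edgeNeighbors hd hV hVP hv
    obtain ⟨T, hT, h | h⟩ := htr v w hw hv
    exacts [Or.inl ⟨T, hT, h.1⟩, Or.inr ⟨T, hT, h.2⟩]
  have hdisj : ∀ S T, IsAut P S → IsAut P T → S p ≠ T q := fun S T hS hT h => hVT fun v hv w hw => by
    have key : ∀ v ∈ V, ∃ T, IsAut P T ∧ T p = v := fun v hv => by
      rcases hcov v hv with h' | ⟨R, hR, rfl⟩
      · exact h'
      · exact ⟨(S.trans T.symm).trans R, (hS.trans hT.symm).trans hR, by simp [h]⟩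
    rw [← hV] at hv hw
    obtain ⟨A, hA, rfl⟩ := key v hv
    obtain ⟨B, hB, rfl⟩ := key w hw
    exact ⟨A.symm.trans B, hA.symm.trans hB, by simp⟩
  have hadj₁ : ∀ S, IsAut P S → ∀ w ∈ edgeNeighbors P V (S p),
      ∃ T, IsAut P T ∧ T p = S p ∧ T q = w := fun S hS w hw => by
    obtain ⟨T, hT, h | h⟩ := htr _ w hw (hS.mem_vertices hV hp)
    exacts [⟨T, hT, h⟩, (hdisj S T hS hT h.2.symm).elim]
  have hadj₂ : ∀ S, IsAut P S → ∀ w ∈ edgeNeighbors P V (S q),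
      ∃ T, IsAut P T ∧ T q = S q ∧ T p = w := fun S hS w hw => by
    obtain ⟨T, hT, h | h⟩ := htr _ w hw (hS.mem_vertices hV hq)
    exacts [(hdisj T S hT hS h.1).elim, ⟨T, hT, h.2, h.1⟩]
  have hNT : ∀ T, IsAut P T → ∀ v, ∀ x ∈ edgeNeighbors P V v, T x ∈ edgeNeighbors P V (T v) :=
    fun T hT v x hx => mem_edgeNeighbors.2 ⟨hT.mem_vertices hV (mem_edgeNeighbors.1 hx).1,
      hT.isEdge (mem_edgeNeighbors.1 hx).2⟩
  have hg : ∀ T, IsAut P T → T (∑ x ∈ V, x) = ∑ x ∈ V, x := fun T hT => by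
    rw [map_sum]
    refine Finset.sum_bij' (fun x _ => T x) (fun x _ => T.symm x)
      (fun x hx => hT.mem_vertices hV hx) (fun x hx => hT.symm.mem_vertices hV hx) ?_ ?_ ?_ <;> simp
  have hs : ∀ T, IsAut P T → ∀ v, T v = v →
      T (∑ x ∈ edgeNeighbors P V v, (x - v)) = ∑ x ∈ edgeNeighbors P V v, (x - v) :=
    fun T hT v hTv => by
      have hTv' : T.symm v = v := by rw [← T.injective.eq_iff]; simp [hTv]
      rw [map_sum]
      refine Finset.sum_bij' (fun x _ => T x) (fun x _ => T.symm x)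
        (fun x hx => ?_) (fun x hx => ?_) ?_ ?_ ?_
      · simpa only [hTv] using hNT T hT v x hx
      · simpa only [hTv'] using hNT T.symm hT.symm v x hx
      all_goals simp [hTv]
  have hinv : ∀ T, IsAut P T → ∀ x, ⟪∑ y ∈ V, y, T x⟫_ℝ = ⟪∑ y ∈ V, y, x⟫_ℝ := fun T hT x => by
    conv_lhs => rw [← hg T hT]
    exact T.inner_map_map _ _
  have hrow : ∀ v, (∀ w ∈ edgeNeighbors P V v, ∀ w' ∈ edgeNeighbors P V v,
      ∃ T, IsAut P T ∧ T v = v ∧ T w = w') → ∃ σ : ℝ, ∀ w ∈ edgeNeighbors P V v,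
      ⟪w - v, ∑ x ∈ edgeNeighbors P V v, (x - v)⟫_ℝ = σ := fun v h => by
    by_cases hne : ∃ w, w ∈ edgeNeighbors P V v
    · obtain ⟨w, hw⟩ := hne
      refine ⟨⟪w - v, ∑ x ∈ edgeNeighbors P V v, (x - v)⟫_ℝ, fun w' hw' => ?_⟩
      obtain ⟨T, hT, hTv, hTw⟩ := h w hw w' hw'
      have := T.inner_map_map (w - v) (∑ x ∈ edgeNeighbors P V v, (x - v))
      rwa [map_sub, hTv, hTw, hs T hT v hTv] at this
    · exact ⟨0, fun w hw => (hne ⟨w, hw⟩).elim⟩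
  refine ⟨{v | ∃ T, IsAut P T ∧ T p = v}, {v | ∃ T, IsAut P T ∧ T q = v}, ⟪p, p⟫_ℝ, ⟪q, q⟫_ℝ,
    ⟪p, q⟫_ℝ, { skeleton_edgeNeighbors hV hVP with
      mem_iff := fun v => ⟨fun hv => hcov v hv, ?_⟩
      disj := ?_
      ne₁ := ⟨p, LinearIsometryEquiv.refl ℝ _, by simp [IsAut], by simp⟩
      ne₂ := ⟨q, LinearIsometryEquiv.refl ℝ _, by simp [IsAut], by simp⟩
      adj₁ := ?_
      adj₂ := ?_
      sq₁ := ?_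
      sq₂ := ?_
      edge := ?_
      full := fun v hv z h => hfull.eq_zero_of_edges hV hVP hv h
      sum_zero := ?_
      row := ?_ }, ?_⟩
  · rintro (⟨T, hT, rfl⟩ | ⟨T, hT, rfl⟩)
    exacts [hT.mem_vertices hV hp, hT.mem_vertices hV hq]
  · rintro _ ⟨S, hS, rfl⟩ ⟨T, hT, h⟩
    exact hdisj S T hS hT h.symm
  · rintro _ ⟨S, hS, rfl⟩ w hw
    obtain ⟨T, hT, -, h⟩ := hadj₁ S hS w hw
    exact ⟨T, hT, h⟩
  · rintro _ ⟨S, hS, rfl⟩ w hw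
    obtain ⟨T, hT, -, h⟩ := hadj₂ S hS w hw
    exact ⟨T, hT, h⟩
  · rintro _ ⟨S, hS, rfl⟩
    exact S.inner_map_map _ _
  · rintro _ ⟨S, hS, rfl⟩
    exact S.inner_map_map _ _
  · intro v hv w hw
    obtain ⟨T, hT, ⟨rfl, rfl⟩ | ⟨rfl, rfl⟩⟩ := htr v w hw hv
    · exact T.inner_map_map _ _
    · rw [T.inner_map_map, real_inner_comm]
  · have h₁ : ∀ x ∈ edgeNeighbors P V p,
        ⟪∑ y ∈ V, y, x - p⟫_ℝ = ⟪∑ y ∈ V, y, q⟫_ℝ - ⟪∑ y ∈ V, y, p⟫_ℝ := fun x hx => by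
      obtain ⟨T, hT, -, rfl⟩ := hadj₁ (LinearIsometryEquiv.refl ℝ _) (by simp [IsAut]) x hx
      rw [inner_sub_right, hinv T hT]
    have h₂ : ∀ x ∈ edgeNeighbors P V q,
        ⟪∑ y ∈ V, y, x - q⟫_ℝ = ⟪∑ y ∈ V, y, p⟫_ℝ - ⟪∑ y ∈ V, y, q⟫_ℝ := fun x hx => by
      obtain ⟨T, hT, -, rfl⟩ := hadj₂ (LinearIsometryEquiv.refl ℝ _) (by simp [IsAut]) x hx
      rw [inner_sub_right, hinv T hT]
    by_cases heq : ⟪∑ y ∈ V, y, q⟫_ℝ = ⟪∑ y ∈ V, y, p⟫_ℝ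
    · exact hfull.eq_zero_of_edges hV hVP hp fun x hx => by rw [h₁ x hx, heq, sub_self]
    · exfalso
      have hall : ∀ v ∈ V, v = p ∨ v = q := fun v hv => by
        rcases hcov v hv with ⟨T, hT, rfl⟩ | ⟨T, hT, rfl⟩
        · exact Or.inl (eq_of_inner_eq hV hVP hp hv (sub_ne_zero.2 heq) h₁ (hinv T hT p))
        · exact Or.inr (eq_of_inner_eq hV hVP hq hv (sub_ne_zero.2 (Ne.symm heq)) h₂ (hinv T hT q))
      obtain ⟨z, hz, hzu⟩ := exists_ne_zero_inner_eq_zero hd (q - p)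
      refine hz (hfull.eq_zero_of_inner_eq hVP (r := ⟪z, p⟫_ℝ) fun y hy => ?_)
      rcases hall y hy with rfl | rfl
      · rfl
      · rw [inner_sub_right] at hzu; linarith
  on_goal 2 =>
    rintro g hg _ ⟨S, hS, rfl⟩ ⟨T, hT, h⟩
    exact hdisj (S.trans g) T (hS.trans (isAut_of_mapsTo hVP hg)) hT h.symm
  · intro v hv
    refine hrow v fun w hw w' hw' => ?_
    rcases hcov v hv with ⟨S, hS, rfl⟩ | ⟨S, hS, rfl⟩
    · obtain ⟨T, hT, h1, h2⟩ := hadj₁ S hS w hw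
      obtain ⟨T', hT', h1', h2'⟩ := hadj₁ S hS w' hw'
      exact ⟨T.symm.trans T', hT.symm.trans hT', by simp [← h1, h1'], by simp [← h2, h2']⟩
    · obtain ⟨T, hT, h1, h2⟩ := hadj₂ S hS w hw
      obtain ⟨T', hT', h1', h2'⟩ := hadj₂ S hS w' hw'
      exact ⟨T.symm.trans T', hT.symm.trans hT', by simp [← h1, h1'], by simp [← h2, h2']⟩

end Orbits

section TwoFaces

open scoped InnerProductSpace

variable {E : Type*} [NormedAddCommGroup E] [InnerProductSpace ℝ E]

lemma mem_convexHull_of_sub_eq_sum {s : Set E} {A : Finset E} {c : E → ℝ} {v y : E} (hv : v ∈ s)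
    (hA : ∀ x ∈ A, x ∈ s) (hc : ∀ x, 0 ≤ c x) (hle : ∑ x ∈ A, c x ≤ 1)
    (h : y - v = ∑ x ∈ A, c x • (x - v)) : y ∈ convexHull ℝ s := by
  have hvs := subset_convexHull ℝ s hv
  rcases (Finset.sum_nonneg fun x (_ : x ∈ A) => hc x).eq_or_lt with h0 | hpos
  · have h1 := (Finset.sum_eq_zero_iff_of_nonneg fun x _ => hc x).1 h0.symm
    rw [Finset.sum_eq_zero fun x hx => by rw [h1 x hx, zero_smul], sub_eq_zero] at h
    rwa [h]
  · have hz := A.centerMass_mem_convexHull (R := ℝ) (z := id) (fun x _ => hc x) hpos hA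
    have hy : y = (1 - ∑ x ∈ A, c x) • v + (∑ x ∈ A, c x) • A.centerMass c id := by
      rw [Finset.centerMass, smul_smul, mul_inv_cancel₀ hpos.ne', one_smul]
      simp only [smul_sub, Finset.sum_sub_distrib, ← Finset.sum_smul, sub_eq_iff_eq_add] at h
      rw [h]; simp only [id]; module
    rw [hy]
    exact convex_convexHull ℝ s hvs hz (by linarith) hpos.le (by ring)

/-- Three pairwise orthogonal vectors in a plane are not all nonzero. -/
lemma eq_zero_of_orthogonal_of_finrank_le {W : Submodule ℝ E} [FiniteDimensional ℝ W]
    (hW : Module.finrank ℝ W ≤ 2) {y p z : E} (hy : y ∈ W) (hp : p ∈ W) (hz : z ∈ W)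
    (hy0 : y ≠ 0) (hp0 : p ≠ 0) (hyp : ⟪y, p⟫_ℝ = 0) (hyz : ⟪y, z⟫_ℝ = 0) (hpz : ⟪p, z⟫_ℝ = 0) :
    z = 0 := by
  by_contra hz0
  let e : Fin 3 → W := ![⟨y, hy⟩, ⟨p, hp⟩, ⟨z, hz⟩]
  have hli : LinearIndependent ℝ e := by
    refine linearIndependent_of_ne_zero_of_inner_eq_zero (𝕜 := ℝ) ?_ ?_
    · intro i; fin_cases i <;> simp [e, Subtype.ext_iff, hy0, hp0, hz0]
    · intro i j hij
      fin_cases i <;> fin_cases j <;>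
        simp_all [e, Submodule.coe_inner, real_inner_comm]
  have := hli.fintype_card_le_finrank
  simp at this
  omega

/-- The affine plane through `c` with direction `W` carries a face, on which every vertex has two
neighbours. -/
structure TwoFace (V : Finset E) (N : E → Finset E) (c : E) (W : Submodule ℝ E) : Prop where
  finite : FiniteDimensional ℝ W
  finrank_le : Module.finrank ℝ W ≤ 2
  orth : ∀ z ∈ W, ⟪c, z⟫_ℝ = 0
  exists_ne : ∀ y ∈ V, y - c ∈ W → ∀ p : E, ∃ q ∈ N y, q - c ∈ W ∧ q ≠ p

namespace BipartiteSkeleton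

variable {V : Finset E} {N : E → Finset E} {V₁ V₂ : Set E} {a b m : ℝ}

lemma sq_edge (S : BipartiteSkeleton V N V₁ V₂ a b m) {v w : E} (hv : v ∈ V₁) (hw : w ∈ N v) :
    ⟪w - v, w - v⟫_ℝ = a + b - 2 * m := by
  have h1 := S.edge v (S.mem₁ hv) w hw
  have h2 := S.sq₁ v hv
  have h3 := S.sq₂ w (S.adj₁ v hv w hw)
  rw [real_inner_sub_sub_self, real_inner_comm v w, h1, h2, h3]
  ring

lemma inner_sub_sub_of_mem (S : BipartiteSkeleton V N V₁ V₂ a b m) {v w x : E} (hv : v ∈ V₁)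
    (hw : w ∈ N v) (hx : x ∈ N v) : ⟪w - v, x - v⟫_ℝ = ⟪w, x⟫_ℝ - 2 * m + a := by
  have h1 := S.edge v (S.mem₁ hv) w hw
  have h2 := S.edge v (S.mem₁ hv) x hx
  have h3 := S.sq₁ v hv
  rw [inner_sub_left, inner_sub_right, inner_sub_right, h2, h3, real_inner_comm v w, h1]
  ring

lemma eq_of_inner_of_cone (S : BipartiteSkeleton V N V₁ V₂ a b m) {v y : E} (hv : v ∈ V₁)
    {c : E → ℝ} {A : Finset E} (hA : A ⊆ N v) (h : y - v = ∑ x ∈ A, c x • (x - v)) :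
    ⟪v, y⟫_ℝ - a = (∑ x ∈ A, c x) * (m - a) := by
  rw [← S.sq₁ v hv, ← inner_sub_right, h, inner_sum, Finset.sum_mul]
  refine Finset.sum_congr rfl fun x hx => ?_
  rw [real_inner_smul_right, S.inner_edge_sub hv (hA hx), S.sq₁ v hv]

/-- A vertex is closest to its neighbours. -/
lemma inner_lt (S : BipartiteSkeleton V N V₁ V₂ a b m) {v y : E} (hv : v ∈ V₁) (hy : y ∈ V)
    (hyv : y ≠ v) (hyN : y ∉ N v) : ⟪v, y⟫_ℝ < m := by
  obtain ⟨c, hc, h⟩ := S.cone v (S.mem₁ hv) y hy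
  have h1 := S.eq_of_inner_of_cone hv subset_rfl h
  by_contra! h2
  have h3 := S.lt₁
  refine S.extreme y hy (mem_convexHull_of_sub_eq_sum ⟨S.mem₁ hv, hyv.symm⟩ (fun x hx =>
    ⟨S.sub v (S.mem₁ hv) hx, ?_⟩) hc ?_ h)
  · rintro rfl; exact hyN hx
  · by_contra! h4
    nlinarith

lemma inner_le (S : BipartiteSkeleton V N V₁ V₂ a b m) {v y : E} (hv : v ∈ V₁) (hy : y ∈ V)
    (hyv : y ≠ v) : ⟪v, y⟫_ℝ ≤ m := by
  by_cases h : y ∈ N v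
  · exact (S.edge v (S.mem₁ hv) y h).le
  · exact (S.inner_lt hv hy hyv h).le

lemma inner_lt_of_mem₁ (S : BipartiteSkeleton V N V₁ V₂ a b m) {v y : E} (hv : v ∈ V₁) (hy : y ∈ V₁)
    (hyv : y ≠ v) : ⟪v, y⟫_ℝ < m :=
  S.inner_lt hv (S.mem₁ hy) hyv fun h => S.disj y hy (S.adj₁ v hv y h)

lemma ne_of_mem (S : BipartiteSkeleton V N V₁ V₂ a b m) {v w : E} (hv : v ∈ V₁) (hw : w ∈ V₂) :
    w ≠ v := fun h => S.disj v hv (h ▸ hw)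

/-- The largest inner product between edges at a vertex is attained by edges of a common face. -/
lemma inner_sub_le_of_faces (S : BipartiteSkeleton V N V₁ V₂ a b m) {v w y : E} {r : ℝ}
    (hv : v ∈ V₁) (hw : w ∈ N v) (hy : y ∈ N v) (hyw : y ≠ w) (hr : r ≤ a + b - 2 * m)
    (h : ∀ x ∈ N v, x ≠ w → SpanTwoFace V v w x → ⟪w - v, x - v⟫_ℝ ≤ r) :
    ⟪w - v, y - v⟫_ℝ ≤ r := by
  have hvV := S.mem₁ hv
  obtain ⟨A, hA, hwA, hface, hgen⟩ := S.face v hvV w hw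
  have hr' : ∀ x ∈ A, ⟪w - v, x - v⟫_ℝ ≤ r := fun x hx =>
    h x (hA hx) (fun h => hwA (h ▸ hx)) (hface x hx)
  by_cases hyA : y ∈ A
  · exact hr' y hyA
  obtain ⟨s, c, hc, hyc⟩ := hgen y (S.sub v hvV hy)
  have hs : s + ∑ x ∈ A, c x = 1 := by
    have h1 := congrArg (fun z => ⟪v, z⟫_ℝ) hyc
    simp only [inner_add_right, inner_sum, real_inner_smul_right, S.inner_edge_sub hv hy,
      S.inner_edge_sub hv hw] at h1
    rw [Finset.sum_congr rfl fun x hx => by rw [S.inner_edge_sub hv (hA hx)],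
      ← Finset.sum_mul] at h1
    have h2 := S.lt₁
    have h3 : (s + ∑ x ∈ A, c x - 1) * (m - a) = 0 := by linarith
    rcases mul_eq_zero.1 h3 with h4 | h4 <;> linarith
  rcases le_or_gt 0 s with h0 | h0
  · refine (S.extreme y (S.sub v hvV hy) ?_).elim
    refine mem_convexHull_of_sub_eq_sum (v := w) (A := A) (c := c) ⟨S.sub v hvV hw, hyw.symm⟩
      (fun x hx => ⟨S.sub v hvV (hA hx), ?_⟩) hc (by linarith) ?_
    · rintro rfl; exact hyA hx
    · have h1 : ∑ x ∈ A, c x • (x - w) = ∑ x ∈ A, c x • (x - v) - (∑ x ∈ A, c x) • (w - v) := by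
        rw [Finset.sum_smul, ← Finset.sum_sub_distrib]
        refine Finset.sum_congr rfl fun x _ => ?_
        module
      rw [h1, show ∑ x ∈ A, c x = 1 - s by linarith, ← sub_eq_iff_eq_add'.2 hyc]
      module
  · rw [hyc, inner_add_right, real_inner_smul_right, S.sq_edge hv hw, inner_sum]
    have h1 : ∑ x ∈ A, ⟪w - v, c x • (x - v)⟫_ℝ ≤ (∑ x ∈ A, c x) * r := by
      rw [Finset.sum_mul]
      refine Finset.sum_le_sum fun x hx => ?_
      rw [real_inner_smul_right]
      exact mul_le_mul_of_nonneg_left (hr' x hx) (hc x)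
    rw [show ∑ x ∈ A, c x = 1 - s by linarith] at h1
    nlinarith

lemma exists_twoFace (S : BipartiteSkeleton V N V₁ V₂ a b m) {v w x : E} (hv : v ∈ V₁)
    (hw : w ∈ N v) (hx : x ∈ N v) (hwx : w ≠ x) (h : SpanTwoFace V v w x) :
    ∃ c W, TwoFace V N c W ∧ v - c ∈ W ∧ w - c ∈ W ∧ x - c ∈ W := by
  obtain ⟨f, hfw, hfx, hf⟩ := h
  have hvV := S.mem₁ hv
  set W := Submodule.span ℝ {w - v, x - v} with hW
  have hfin : FiniteDimensional ℝ W := FiniteDimensional.span_of_finite ℝ (by simp)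
  have hwW : w - v ∈ W := Submodule.subset_span (by simp)
  have hxW : x - v ∈ W := Submodule.subset_span (by simp)
  set c := v - W.starProjection v with hc
  have hcW : v - c ∈ W := by
    rw [hc, sub_sub_cancel]; exact Submodule.starProjection_apply_mem W v
  have hsub : ∀ y, y - c ∈ W ↔ y - v ∈ W := fun y => by
    rw [← sub_add_sub_cancel y v c]; exact W.add_mem_iff_left hcW
  refine ⟨c, W, ⟨hfin, ?_, fun z hz => ?_, fun y hy hyW p => ?_⟩, hcW, (hsub w).2 hwW,
    (hsub x).2 hxW⟩
  · classical
    have := finrank_span_finset_le_card (R := ℝ) ({w - v, x - v} : Finset E)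
    simp only [Finset.coe_insert, Finset.coe_singleton] at this
    exact this.trans Finset.card_le_two
  · exact Submodule.inner_left_of_mem_orthogonal hz (Submodule.sub_starProjection_mem_orthogonal v)
  have hfW : ∀ z ∈ W, ⟪f, z⟫_ℝ = 0 := fun z hz => by
    refine Submodule.span_induction ?_ ?_ ?_ ?_ hz
    · rintro z (rfl | rfl) <;> simp [inner_sub_right, hfw, hfx]
    · simp
    · intro z z' _ _ h h'; rw [inner_add_right, h, h', add_zero]
    · intro t z _ h; rw [real_inner_smul_right, h, mul_zero]
  have hfy : ⟪f, y⟫_ℝ = ⟪f, v⟫_ℝ := by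
    rw [← sub_eq_zero, ← inner_sub_right]; exact hfW _ ((hsub y).1 hyW)
  by_contra! hcon
  -- all neighbours of `y` in the face coincide
  have hline : ∀ z ∈ V, z - c ∈ W → ∃ t : ℝ, z - y = t • (p - y) := fun z hz hzW => by
    obtain ⟨e, he, hze⟩ := S.cone y hy z hz
    have hfz : ⟪f, z⟫_ℝ = ⟪f, v⟫_ℝ := by
      rw [← sub_eq_zero, ← inner_sub_right]; exact hfW _ ((hsub z).1 hzW)
    have hsum : ∑ q ∈ N y, e q * ⟪f, q - y⟫_ℝ = 0 := by
      have := congrArg (fun z => ⟪f, z⟫_ℝ) hze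
      simp only [inner_sum, real_inner_smul_right] at this
      rw [← this, inner_sub_right, hfz, hfy, sub_self]
    have hle : ∀ q ∈ N y, e q * ⟪f, q - y⟫_ℝ ≤ 0 := fun q hq => by
      refine mul_nonpos_of_nonneg_of_nonpos (he q) ?_
      rw [inner_sub_right, hfy]
      linarith [(hf q (S.sub y hy hq)).1]
    have hz0 := (Finset.sum_eq_zero_iff_of_nonpos hle).1 hsum
    have : z - y ∈ Submodule.span ℝ {p - y} := by
      rw [hze]
      refine Submodule.sum_mem _ fun q hq => ?_
      rcases mul_eq_zero.1 (hz0 q hq) with h1 | h1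
      · rw [h1, zero_smul]; exact zero_mem _
      · have hqW : q - c ∈ W := (hsub q).2 ((hf q (S.sub y hy hq)).2 (by
          rw [← hfy, ← sub_eq_zero, ← inner_sub_right]; exact h1))
        rw [hcon q hq hqW]
        exact Submodule.smul_mem _ _ (Submodule.mem_span_singleton_self _)
    obtain ⟨t, ht⟩ := Submodule.mem_span_singleton.1 this
    exact ⟨t, ht.symm⟩
  obtain ⟨t₀, h₀⟩ := hline v hvV hcW
  obtain ⟨t₁, h₁⟩ := hline w (S.sub v hvV hw) ((hsub w).2 hwW)
  obtain ⟨t₂, h₂⟩ := hline x (S.sub v hvV hx) ((hsub x).2 hxW)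
  have h₁' : w - v = (t₁ - t₀) • (p - y) := by rw [sub_smul, ← h₀, ← h₁]; abel
  have h₂' : x - v = (t₂ - t₀) • (p - y) := by rw [sub_smul, ← h₀, ← h₂]; abel
  have k₁ := S.inner_edge_sub hv hw
  have k₂ := S.inner_edge_sub hv hx
  rw [h₁', real_inner_smul_right] at k₁
  rw [h₂', real_inner_smul_right] at k₂
  have hlt := S.lt₁
  have hne : ⟪v, p - y⟫_ℝ ≠ 0 := fun h => by rw [h] at k₁; linarith
  have ht : t₁ - t₀ = t₂ - t₀ := mul_right_cancel₀ hne (k₁.trans k₂.symm)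
  refine hwx ?_
  rw [← sub_left_inj (a := v), h₁', h₂', ht]

end BipartiteSkeleton

end TwoFaces

section TwoFaces

open scoped InnerProductSpace

variable {E : Type*} [NormedAddCommGroup E] [InnerProductSpace ℝ E]
  {V : Finset E} {N : E → Finset E} {V₁ V₂ : Set E} {a b m : ℝ} {c : E} {W : Submodule ℝ E}

lemma TwoFace.inner_sub_sub (F : TwoFace V N c W) {y z : E} (hy : y - c ∈ W) (hz : z - c ∈ W) :
    ⟪y - c, z - c⟫_ℝ = ⟪y, z⟫_ℝ - ⟪c, c⟫_ℝ := by
  have h1 := F.orth _ hy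
  have h2 := F.orth _ hz
  rw [inner_sub_right] at h1
  rw [inner_sub_left, h2, inner_sub_right, real_inner_comm c y]
  linarith

namespace BipartiteSkeleton

lemma face_pos₁ (S : BipartiteSkeleton V N V₁ V₂ a b m) (F : TwoFace V N c W) {v w : E}
    (hv : v ∈ V₁) (hw : w ∈ N v) (hvW : v - c ∈ W) (hwW : w - c ∈ W) : 0 < a - ⟪c, c⟫_ℝ := by
  have h1 := F.inner_sub_sub hvW hvW
  have h2 := F.inner_sub_sub hvW hwW
  rw [S.sq₁ v hv] at h1
  rw [S.edge v (S.mem₁ hv) w hw] at h2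
  rw [← h1]
  refine lt_of_le_of_ne real_inner_self_nonneg fun h => ?_
  rw [inner_self_eq_zero.1 h.symm, inner_zero_left] at h1 h2
  linarith [S.lt₁]

/-- The next vertex on a two-dimensional face. -/
lemma face_next (S : BipartiteSkeleton V N V₁ V₂ a b m) (F : TwoFace V N c W) {v w q : E}
    (hv : v ∈ V₁) (hw : w ∈ N v) (hq : q ∈ N v) (hwq : w ≠ q) (hvW : v - c ∈ W) (hwW : w - c ∈ W)
    (hqW : q - c ∈ W) :
    q - c = (2 * (m - ⟪c, c⟫_ℝ) / (a - ⟪c, c⟫_ℝ)) • (v - c) - (w - c) := by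
  have hA := S.face_pos₁ F hv hw hvW hwW
  have h00 := F.inner_sub_sub hvW hvW
  have h01 := F.inner_sub_sub hvW hwW
  have h02 := F.inner_sub_sub hvW hqW
  have h11 := F.inner_sub_sub hwW hwW
  have h22 := F.inner_sub_sub hqW hqW
  rw [S.sq₁ v hv] at h00
  rw [S.edge v (S.mem₁ hv) w hw] at h01
  rw [S.edge v (S.mem₁ hv) q hq] at h02
  rw [S.sq₂ w (S.adj₁ v hv w hw)] at h11
  rw [S.sq₂ q (S.adj₁ v hv q hq)] at h22
  have hfin := F.finite
  have hM : (2 * (m - ⟪c, c⟫_ℝ) / (a - ⟪c, c⟫_ℝ)) * (a - ⟪c, c⟫_ℝ) = 2 * (m - ⟪c, c⟫_ℝ) :=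
    div_mul_cancel₀ _ hA.ne'
  generalize 2 * (m - ⟪c, c⟫_ℝ) / (a - ⟪c, c⟫_ℝ) = r at hM ⊢
  generalize v - c = p₀ at *
  have hne : w - c ≠ q - c := fun h => hwq (sub_left_injective h)
  generalize w - c = p₁ at *
  generalize q - c = p₂ at *
  have h0 : p₀ ≠ 0 := by rintro rfl; rw [inner_zero_left] at h00; linarith
  have := eq_zero_of_orthogonal_of_finrank_le F.finrank_le (y := p₀) (p := p₁ - p₂)
    (z := r • p₀ - (p₁ + p₂)) hvW (W.sub_mem hwW hqW)
    (W.sub_mem (W.smul_mem _ hvW) (W.add_mem hwW hqW)) h0 (sub_ne_zero.2 hne)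
    (by rw [inner_sub_right]; linarith)
    (by rw [inner_sub_right, real_inner_smul_right, inner_add_right, h00, h01, h02]; linarith)
    (by
      rw [inner_sub_right, real_inner_smul_right, inner_sub_left, inner_sub_left, inner_add_right,
        inner_add_right, real_inner_comm p₀ p₁, real_inner_comm p₀ p₂, real_inner_comm p₁ p₂, h01,
        h02, h11, h22]
      ring)
  rw [sub_eq_zero] at this
  rw [this]; abel

lemma face_exists_next (S : BipartiteSkeleton V N V₁ V₂ a b m) (F : TwoFace V N c W) {v w : E}
    (hv : v ∈ V₁) (hw : w ∈ N v) (hvW : v - c ∈ W) (hwW : w - c ∈ W) :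
    ∃ q ∈ N v, q ≠ w ∧ q ∈ V₂ ∧ q - c ∈ W ∧
      q - c = (2 * (m - ⟪c, c⟫_ℝ) / (a - ⟪c, c⟫_ℝ)) • (v - c) - (w - c) := by
  obtain ⟨q, hq, hqW, hqw⟩ := F.exists_ne v (S.mem₁ hv) hvW w
  exact ⟨q, hq, hqw, S.adj₁ v hv q hq, hqW, S.face_next F hv hw hq hqw.symm hvW hwW hqW⟩

lemma face_cauchy (S : BipartiteSkeleton V N V₁ V₂ a b m) (F : TwoFace V N c W) {v w : E}
    (hv : v ∈ V₁) (hw : w ∈ N v) (hvW : v - c ∈ W) (hwW : w - c ∈ W) :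
    (m - ⟪c, c⟫_ℝ) ^ 2 < (a - ⟪c, c⟫_ℝ) * (b - ⟪c, c⟫_ℝ) := by
  by_contra! hle
  have hA := S.face_pos₁ F hv hw hvW hwW
  have key : ∀ q ∈ N v, q - c ∈ W →
      (a - ⟪c, c⟫_ℝ) • (q - c) = (m - ⟪c, c⟫_ℝ) • (v - c) := fun q hq hqW => by
    have h00 := F.inner_sub_sub hvW hvW
    have h01 := F.inner_sub_sub hvW hqW
    have h11 := F.inner_sub_sub hqW hqW
    rw [S.sq₁ v hv] at h00
    rw [S.edge v (S.mem₁ hv) q hq] at h01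
    rw [S.sq₂ q (S.adj₁ v hv q hq)] at h11
    rw [← sub_eq_zero]
    refine inner_self_eq_zero.1 (le_antisymm ?_ real_inner_self_nonneg)
    rw [real_inner_sub_sub_self]
    simp only [real_inner_smul_left, real_inner_smul_right, h00, h01, h11,
      real_inner_comm (v - c) (q - c)]
    nlinarith [mul_le_mul_of_nonneg_left hle hA.le]
  obtain ⟨q, hq, hqW, hqw⟩ := F.exists_ne v (S.mem₁ hv) hvW w
  have h := (key q hq hqW).trans (key w hw hwW).symm
  exact hqw (sub_left_injective (smul_right_injective E hA.ne' h))

/-- A two-dimensional face is a rhombus or has at least six vertices with an angle condition. -/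
lemma face_parameters (S : BipartiteSkeleton V N V₁ V₂ a b m) (F : TwoFace V N c W) {v w : E}
    (hv : v ∈ V₁) (hw : w ∈ N v) (hvW : v - c ∈ W) (hwW : w - c ∈ W) :
    0 ≤ m - ⟪c, c⟫_ℝ ∧ (m - ⟪c, c⟫_ℝ = 0 ∨
      (a - ⟪c, c⟫_ℝ) * (b - ⟪c, c⟫_ℝ) ≤ 4 * (m - ⟪c, c⟫_ℝ) ^ 2) := by
  have hwV := S.adj₁ v hv w hw
  have hvw := S.symm v (S.mem₁ hv) w hw
  have hA := S.face_pos₁ F hv hw hvW hwW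
  have hB := S.swap.face_pos₁ F hwV hvw hwW hvW
  have hC := S.face_cauchy F hv hw hvW hwW
  have h0 := F.inner_sub_sub hvW hvW
  have h1 := F.inner_sub_sub hvW hwW
  rw [S.sq₁ v hv] at h0
  rw [S.edge v (S.mem₁ hv) w hw] at h1
  obtain ⟨v₂, n₂, -, m₂, f₂, e₂⟩ := S.swap.face_exists_next F hwV hvw hwW hvW
  obtain ⟨v₃, n₃, -, m₃, f₃, e₃⟩ := S.face_exists_next F m₂ (S.symm w (S.mem₂ hwV) _ n₂) f₂ hwW
  have x₂ := congrArg (fun z => ⟪v - c, z⟫_ℝ) e₂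
  have x₃ := congrArg (fun z => ⟪v - c, z⟫_ℝ) e₃
  have l₃ := S.inner_le hv (S.mem₂ m₃) (S.ne_of_mem hv m₃)
  have b₃ := F.inner_sub_sub hvW f₃
  obtain ⟨v₄, n₄, -, m₄, f₄, e₄⟩ := S.swap.face_exists_next F m₃ (S.symm _ (S.mem₁ m₂) _ n₃) f₃ f₂
  obtain ⟨v₅, n₅, -, m₅, f₅, e₅⟩ := S.face_exists_next F m₄ (S.symm _ (S.mem₂ m₃) _ n₄) f₄ f₃
  have x₄ := congrArg (fun z => ⟪v - c, z⟫_ℝ) e₄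
  have x₅ := congrArg (fun z => ⟪v - c, z⟫_ℝ) e₅
  have l₅ := S.inner_le hv (S.mem₂ m₅) (S.ne_of_mem hv m₅)
  have b₅ := F.inner_sub_sub hvW f₅
  simp only [inner_sub_right (𝕜 := ℝ) _ (_ • _), real_inner_smul_right] at x₂ x₃ x₄ x₅
  rw [h0, h1] at x₂
  rw [x₂, h1] at x₃
  rw [x₃, x₂] at x₄
  rw [x₄, x₃] at x₅
  rw [b₃] at x₃
  rw [b₅] at x₅
  generalize a - ⟪c, c⟫_ℝ = A at *
  generalize b - ⟪c, c⟫_ℝ = B at *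
  have l₃' : ⟪v, v₃⟫_ℝ - ⟪c, c⟫_ℝ ≤ m - ⟪c, c⟫_ℝ := by linarith
  have l₅' : ⟪v, v₅⟫_ℝ - ⟪c, c⟫_ℝ ≤ m - ⟪c, c⟫_ℝ := by linarith
  rw [x₃] at l₃'
  rw [x₅] at l₅'
  generalize m - ⟪c, c⟫_ℝ = M at *
  obtain ⟨t, ht⟩ : ∃ t, t = M ^ 2 / (A * B) := ⟨_, rfl⟩
  have hAB := mul_pos hA hB
  have htM : M ^ 2 = t * (A * B) := by rw [ht, div_mul_cancel₀ _ hAB.ne']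
  have ht1 : t < 1 := by rw [ht, div_lt_one hAB]; exact hC
  have i₃ : 2 * M / A * (2 * M / B * M - A) - M = M * (4 * t - 3) := by
    rw [ht]; field_simp; ring
  have i₅ : 2 * M / A * (2 * M / B * (2 * M / A * (2 * M / B * M - A) - M) - (2 * M / B * M - A)) -
      (2 * M / A * (2 * M / B * M - A) - M) = M * (16 * t ^ 2 - 20 * t + 5) := by
    rw [ht]; field_simp; ring
  rw [i₃] at l₃'
  rw [i₅] at l₅'
  have hM : 0 ≤ M := by
    by_contra! h
    nlinarith [mul_pos (neg_pos.2 h) (sub_pos.2 ht1)]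
  refine ⟨hM, ?_⟩
  rcases hM.eq_or_lt with h | h
  · exact Or.inl h.symm
  right
  have : 16 * t ^ 2 - 20 * t + 5 ≤ 1 := by
    by_contra! h'
    nlinarith [mul_pos h (sub_pos.2 h')]
  have h4 : 1 ≤ 4 * t := by nlinarith
  rw [htM]
  nlinarith [mul_le_mul_of_nonneg_right h4 hAB.le]

lemma face_inner (S : BipartiteSkeleton V N V₁ V₂ a b m) (F : TwoFace V N c W) {v w x : E}
    (hv : v ∈ V₁) (hw : w ∈ N v) (hx : x ∈ N v) (hwx : w ≠ x) (hvW : v - c ∈ W) (hwW : w - c ∈ W)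
    (hxW : x - c ∈ W) :
    ⟪w - v, x - v⟫_ℝ = 2 * (m - ⟪c, c⟫_ℝ) ^ 2 / (a - ⟪c, c⟫_ℝ) - (b - ⟪c, c⟫_ℝ)
      - 2 * (m - ⟪c, c⟫_ℝ) + (a - ⟪c, c⟫_ℝ) := by
  have h1 := F.inner_sub_sub hvW hwW
  have h2 := F.inner_sub_sub hwW hxW
  have h3 := F.inner_sub_sub hwW hwW
  rw [S.edge v (S.mem₁ hv) w hw] at h1
  rw [S.sq₂ w (S.adj₁ v hv w hw)] at h3
  rw [S.face_next F hv hw hx hwx hvW hwW hxW, inner_sub_right, real_inner_smul_right,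
    real_inner_comm (v - c) (w - c), h1, h3] at h2
  rw [S.inner_sub_sub_of_mem hv hw hx, sub_eq_iff_eq_add.1 h2.symm]
  ring

end BipartiteSkeleton

end TwoFaces

section Simplicity

open scoped InnerProductSpace

variable {E : Type*} [NormedAddCommGroup E] [InnerProductSpace ℝ E]
  {V : Finset E} {N : E → Finset E} {V₁ V₂ : Set E} {a b m : ℝ} {c : E} {W : Submodule ℝ E}

/-- Vectors in an open half-space with pairwise nonpositive inner products are linearly
independent. -/
lemma linearIndepOn_of_inner_nonpos {ι : Type*} {A : Finset ι} {g : ι → E} {h : E}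
    (hneg : ∀ i ∈ A, ⟪h, g i⟫_ℝ < 0) (hg : ∀ i ∈ A, ∀ j ∈ A, i ≠ j → ⟪g i, g j⟫_ℝ ≤ 0) :
    LinearIndepOn ℝ g (A : Set ι) := by
  rw [linearIndepOn_finset_iff]
  intro f hf
  have key : ∀ e : ι → ℝ, (∀ i, 0 ≤ e i) → ∑ i ∈ A, e i • g i = 0 → ∀ i ∈ A, e i = 0 := by
    intro e he h0 i hi
    have h1 := congrArg (fun z => ⟪h, z⟫_ℝ) h0
    simp only [inner_sum, real_inner_smul_right, inner_zero_right] at h1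
    have h2 := (Finset.sum_eq_zero_iff_of_nonpos fun i hi =>
      mul_nonpos_of_nonneg_of_nonpos (he i) (hneg i hi).le).1 h1 i hi
    exact (mul_eq_zero.1 h2).resolve_right (hneg i hi).ne
  have hpq : ∑ i ∈ A, max (f i) 0 • g i = ∑ i ∈ A, max (-f i) 0 • g i := by
    rw [← sub_eq_zero, ← Finset.sum_sub_distrib, ← hf]
    refine Finset.sum_congr rfl fun i _ => ?_
    rw [← sub_smul]
    congr 1
    rcases le_total 0 (f i) with h | h
    · rw [max_eq_left h, max_eq_right (by linarith)]; ring
    · rw [max_eq_right h, max_eq_left (by linarith)]; ring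
  have hp : ∑ i ∈ A, max (f i) 0 • g i = 0 := by
    refine (inner_self_eq_zero (𝕜 := ℝ)).1 (le_antisymm ?_ real_inner_self_nonneg)
    nth_rewrite 2 [hpq]
    rw [sum_inner]
    refine Finset.sum_nonpos fun i hi => ?_
    rw [inner_sum]
    refine Finset.sum_nonpos fun j hj => ?_
    rw [real_inner_smul_left, real_inner_smul_right, ← mul_assoc]
    by_cases hij : i = j
    · subst hij
      rcases le_total 0 (f i) with h | h
      · rw [max_eq_right (a := -f i) (by linarith)]; simp
      · rw [max_eq_right h]; simp
    · exact mul_nonpos_of_nonneg_of_nonpos (by positivity) (hg i hi j hj hij)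
  intro i hi
  have h1 := key _ (fun i => le_max_right _ _) hp i hi
  have h2 := key _ (fun i => le_max_right _ _) (hpq ▸ hp) i hi
  have h3 := max_eq_right_iff.1 h1
  have h4 := max_eq_right_iff.1 h2
  linarith

namespace BipartiteSkeleton

/-- The edges at a vertex of the class of smaller radius which span a two-dimensional face. -/
lemma face_cases (S : BipartiteSkeleton V N V₁ V₂ a b m) (hab : a ≤ b) (F : TwoFace V N c W)
    {v w x : E} (hv : v ∈ V₁) (hw : w ∈ N v) (hx : x ∈ N v) (hwx : w ≠ x)
    (hvW : v - c ∈ W) (hwW : w - c ∈ W) (hxW : x - c ∈ W) :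
    (m - ⟪c, c⟫_ℝ = 0 ∧ ⟪w - v, x - v⟫_ℝ = a - b) ∨
    (0 < m - ⟪c, c⟫_ℝ ∧ ⟪w - v, x - v⟫_ℝ ≤ -(a + b - 2 * m) / 2 ∧ ⟪w - v, x - v⟫_ℝ < a - b) := by
  have hA := S.face_pos₁ F hv hw hvW hwW
  obtain ⟨h0, hM⟩ := S.face_parameters F hv hw hvW hwW
  rw [S.face_inner F hv hw hx hwx hvW hwW hxW]
  have hma := S.lt₁
  obtain ⟨A, hA'⟩ : ∃ A, A = a - ⟪c, c⟫_ℝ := ⟨_, rfl⟩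
  obtain ⟨B, hB'⟩ : ∃ B, B = b - ⟪c, c⟫_ℝ := ⟨_, rfl⟩
  obtain ⟨M, hM'⟩ : ∃ M, M = m - ⟪c, c⟫_ℝ := ⟨_, rfl⟩
  have e1 : a - b = A - B := by rw [hA', hB']; ring
  have e2 : a + b - 2 * m = A + B - 2 * M := by rw [hA', hB', hM']; ring
  have hMA : M < A := by rw [hA', hM']; linarith
  have hAB : A ≤ B := by linarith
  rw [e1, e2, ← hA', ← hB', ← hM']
  rw [← hA'] at hA
  rw [← hM'] at h0
  rw [← hA', ← hB', ← hM'] at hM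
  rcases h0.eq_or_lt with h0 | h0
  · left
    rw [← h0]; simp; ring
  · right
    replace hM := hM.resolve_left h0.ne'
    have h1 : A ≤ 2 * M := by nlinarith
    have h2 : 2 * M ^ 2 / A - 3 * M + A ≤ 0 := by
      rw [show 2 * M ^ 2 / A - 3 * M + A = (2 * M - A) * (M - A) / A by field_simp; ring]
      exact div_nonpos_of_nonpos_of_nonneg
        (mul_nonpos_of_nonneg_of_nonpos (by linarith) (by linarith)) hA.le
    have h3 : 2 * M ^ 2 / A < 2 * M := by
      rw [div_lt_iff₀ hA]; nlinarith
    exact ⟨h0, by linarith, by linarith⟩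

lemma inner_sub_nonpos (S : BipartiteSkeleton V N V₁ V₂ a b m) (hab : a ≤ b) {v w x : E}
    (hv : v ∈ V₁) (hw : w ∈ N v) (hx : x ∈ N v) (hxw : x ≠ w) : ⟪w - v, x - v⟫_ℝ ≤ 0 := by
  have h1 := S.lt₁
  have h2 := S.lt₂
  refine S.inner_sub_le_of_faces hv hw hx hxw (by linarith) fun y hy hyw h => ?_
  obtain ⟨c, W, F, hvW, hwW, hyW⟩ := S.exists_twoFace hv hw hy hyw.symm h
  rcases S.face_cases hab F hv hw hy hyw.symm hvW hwW hyW with h | h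
  · linarith [h.2]
  · linarith [h.2.2]

lemma linearIndepOn_neighbors (S : BipartiteSkeleton V N V₁ V₂ a b m) (hab : a ≤ b) {v : E}
    (hv : v ∈ V₁) : LinearIndepOn ℝ (fun x => x - v) (N v : Set E) :=
  linearIndepOn_of_inner_nonpos (h := v)
    (fun x hx => by rw [S.inner_edge_sub hv hx]; linarith [S.lt₁])
    fun w hw x hx hwx => S.inner_sub_nonpos hab hv hw hx hwx.symm

/-- Any two edges at a vertex of the class of smaller radius span a two-dimensional face. -/
lemma exists_twoFace_of_ne (S : BipartiteSkeleton V N V₁ V₂ a b m) (hab : a ≤ b) {v w x : E}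
    (hv : v ∈ V₁) (hw : w ∈ N v) (hx : x ∈ N v) (hwx : w ≠ x) :
    ∃ c W, TwoFace V N c W ∧ v - c ∈ W ∧ w - c ∈ W ∧ x - c ∈ W := by
  classical
  refine S.exists_twoFace hv hw hx hwx ?_
  obtain ⟨A, hA, hwA, hface, hgen⟩ := S.face v (S.mem₁ hv) w hw
  by_cases hxA : x ∈ A
  · exact hface x hxA
  exfalso
  obtain ⟨s, c, -, h⟩ := hgen x (S.sub v (S.mem₁ hv) hx)
  have hli := S.linearIndepOn_neighbors hab hv
  rw [linearIndepOn_finset_iff] at hli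
  have h1 := hli (fun y => (if y = x then 1 else 0) - (if y = w then s else 0) -
    if y ∈ A then c y else 0) (by
      simp only [sub_smul, ite_smul, one_smul, zero_smul, Finset.sum_sub_distrib,
        Finset.sum_ite_eq', hx, hw, if_true, ← Finset.sum_filter]
      rw [Finset.filter_mem_eq_inter, Finset.inter_eq_right.2 hA, h]
      abel) x hx
  simp [hxA, hwx.symm] at h1

lemma card_neighbors [FiniteDimensional ℝ E] (S : BipartiteSkeleton V N V₁ V₂ a b m) (hab : a ≤ b)
    {v : E} (hv : v ∈ V₁) : (N v).card = Module.finrank ℝ E := by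
  have hli : LinearIndependent ℝ (fun x : N v => (x : E) - v) := S.linearIndepOn_neighbors hab hv
  have hspan : Submodule.span ℝ (Set.range fun x : N v => (x : E) - v) = ⊤ := by
    rw [← Submodule.orthogonal_eq_bot_iff, Submodule.eq_bot_iff]
    intro z hz
    refine S.full v (S.mem₁ hv) z fun x hx => ?_
    rw [real_inner_comm]
    exact hz _ (Submodule.subset_span ⟨⟨x, hx⟩, rfl⟩)
  have := linearIndependent_iff_card_eq_finrank_span.1 hli
  rwa [Set.finrank, hspan, finrank_top, Fintype.card_coe] at this

end BipartiteSkeleton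

end Simplicity

section Inscribed

open scoped InnerProductSpace

variable {E : Type*} [NormedAddCommGroup E] [InnerProductSpace ℝ E]
  {V : Finset E} {N : E → Finset E} {V₁ V₂ : Set E} {a m : ℝ}

/-- The reflection which exchanges `v` and `w` if these have the same norm. -/
noncomputable def edgeReflection (v w : E) : E ≃ₗᵢ[ℝ] E := (ℝ ∙ (w - v))ᗮ.reflection

lemma edgeReflection_of_inner_eq_zero {v w z : E} (h : ⟪w - v, z⟫_ℝ = 0) :
    edgeReflection v w z = z :=
  Submodule.reflection_mem_subspace_eq_self (Submodule.mem_orthogonal_singleton_iff_inner_right.2 h)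

lemma edgeReflection_right {v w : E} (h : ⟪v, v⟫_ℝ = ⟪w, w⟫_ℝ) : edgeReflection v w w = v := by
  refine Submodule.reflection_sub ?_
  rw [real_inner_self_eq_norm_sq, real_inner_self_eq_norm_sq] at h
  exact ((sq_eq_sq₀ (norm_nonneg _) (norm_nonneg _)).1 h).symm

lemma edgeReflection_left {v w : E} (h : ⟪v, v⟫_ℝ = ⟪w, w⟫_ℝ) : edgeReflection v w v = w := by
  have h1 := Submodule.reflection_reflection (ℝ ∙ (w - v))ᗮ w
  rwa [show (ℝ ∙ (w - v))ᗮ.reflection w = v from edgeReflection_right h] at h1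

lemma map_edgeReflection (g : E ≃ₗᵢ[ℝ] E) (v w y : E) :
    g (edgeReflection v w y) = edgeReflection (g v) (g w) (g y) := by
  simp only [edgeReflection, Submodule.reflection_orthogonal_apply, Submodule.reflection_singleton_apply,
    ← map_sub, LinearIsometryEquiv.inner_map_map, LinearIsometryEquiv.norm_map]
  rw [map_neg, map_sub g (_ • _), map_nsmul, map_smul]

namespace BipartiteSkeleton

lemma edgeReflection_mem₁ (S : BipartiteSkeleton V N V₁ V₂ a a m) {v w x : E} (hv : v ∈ V₁)
    (hw : w ∈ N v) (hx : x ∈ N v) : edgeReflection v w x ∈ N w := by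
  have hw2 := S.adj₁ v hv w hw
  have hvw := S.symm v (S.mem₁ hv) w hw
  have hsq : ⟪v, v⟫_ℝ = ⟪w, w⟫_ℝ := by rw [S.sq₁ v hv, S.sq₂ w hw2]
  by_cases hwx : w = x
  · rw [← hwx, edgeReflection_right hsq]; exact hvw
  obtain ⟨c, W, F, hvW, hwW, hxW⟩ := S.exists_twoFace_of_ne le_rfl hv hw hx hwx
  have h1 := S.face_next F hv hw hx hwx hvW hwW hxW
  obtain ⟨q, hq, -, -, -, h2⟩ := S.swap.face_exists_next F hw2 hvw hwW hvW
  have hc : edgeReflection v w c = c := edgeReflection_of_inner_eq_zero (by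
    have := F.orth _ (W.sub_mem hwW hvW)
    rwa [sub_sub_sub_cancel_right, real_inner_comm] at this)
  have h3 := congrArg (edgeReflection v w) h1
  simp only [map_sub, map_smul, hc, edgeReflection_left hsq, edgeReflection_right hsq, ← h2] at h3
  rwa [sub_left_inj.1 h3]

lemma edgeReflection_mem (S : BipartiteSkeleton V N V₁ V₂ a a m) {v w x : E} (hv : v ∈ V)
    (hw : w ∈ N v) (hx : x ∈ N v) : edgeReflection v w x ∈ N w := by
  rcases (S.mem_iff v).1 hv with h | h
  · exact S.edgeReflection_mem₁ h hw hx
  · exact S.swap.edgeReflection_mem₁ h hw hx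

lemma card_neighbors_of_eq [FiniteDimensional ℝ E] (S : BipartiteSkeleton V N V₁ V₂ a a m) {v : E}
    (hv : v ∈ V) : (N v).card = Module.finrank ℝ E := by
  rcases (S.mem_iff v).1 hv with h | h
  · exact S.card_neighbors le_rfl h
  · exact S.swap.card_neighbors le_rfl h

lemma sq_of_eq (S : BipartiteSkeleton V N V₁ V₂ a a m) {v : E} (hv : v ∈ V) : ⟪v, v⟫_ℝ = a := by
  rcases (S.mem_iff v).1 hv with h | h
  · exact S.sq₁ v h
  · exact S.sq₂ v h

lemma mem_of_neighbors_subset (S : BipartiteSkeleton V N V₁ V₂ a a m) {U : Finset E} (hU : U ⊆ V)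
    (hne : U.Nonempty) (hN : ∀ u ∈ U, N u ⊆ U) {y : E} (hy : y ∈ V) : y ∈ U := by
  obtain ⟨u, hu, hmax⟩ := U.exists_max_image (fun x => ⟪y, x⟫_ℝ) hne
  obtain ⟨c, hc, h⟩ := S.cone u (hU hu) y hy
  have h1 : ⟪y, y - u⟫_ℝ ≤ 0 := by
    rw [h, inner_sum]
    refine Finset.sum_nonpos fun x hx => ?_
    rw [real_inner_smul_right, inner_sub_right]
    exact mul_nonpos_of_nonneg_of_nonpos (hc x) (by linarith [hmax x (hN u hu hx)])
  have h2 : ⟪y - u, y - u⟫_ℝ = 0 := by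
    refine le_antisymm ?_ real_inner_self_nonneg
    rw [inner_sub_right, S.sq_of_eq hy] at h1
    rw [inner_sub_left, inner_sub_right, inner_sub_right, S.sq_of_eq hy, S.sq_of_eq (hU hu),
      real_inner_comm y u]
    linarith
  rw [sub_eq_zero.1 ((inner_self_eq_zero (𝕜 := ℝ)).1 h2)]
  exact hu

/-- If both classes have the same radius, then some symmetry exchanges them. -/
lemma exists_isometry_of_eq [FiniteDimensional ℝ E] (S : BipartiteSkeleton V N V₁ V₂ a a m)
    {v : E} (hv : v ∈ V) {w : E} (hw : w ∈ N v) :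
    ∃ g : E ≃ₗᵢ[ℝ] E, (∀ x ∈ V, g x ∈ V) ∧ g v = w := by
  classical
  set G := Submonoid.closure {g : E ≃ₗᵢ[ℝ] E | ∃ x ∈ N v, g = edgeReflection v x} with hG
  have hgen : ∀ x ∈ N v, edgeReflection v x ∈ G := fun x hx => Submonoid.subset_closure ⟨x, hx, rfl⟩
  have href : ∀ x ∈ N v, edgeReflection v x v = x := fun x hx =>
    edgeReflection_left (by rw [S.sq_of_eq hv, S.sq_of_eq (S.sub v hv hx)])
  have key : ∀ g ∈ G, g v ∈ V ∧ ∀ x ∈ N v, g x ∈ N (g v) := fun g hg => by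
    induction hg using Submonoid.closure_induction_right with
    | one => exact ⟨hv, fun x hx => hx⟩
    | mul_right g _ s hs ih =>
      obtain ⟨x, hx, rfl⟩ := hs
      simp only [LinearIsometryEquiv.coe_mul, Function.comp_apply, href x hx]
      refine ⟨S.sub _ ih.1 (ih.2 x hx), fun y hy => ?_⟩
      rw [map_edgeReflection]
      exact S.edgeReflection_mem ih.1 (ih.2 x hx) (ih.2 y hy)
  have hmem : ∀ y ∈ V, ∃ g ∈ G, g v = y := by
    have := fun y => S.mem_of_neighbors_subset (U := V.filter fun y => ∃ g ∈ G, g v = y) (y := y)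
      (Finset.filter_subset _ _) ⟨v, Finset.mem_filter.2 ⟨hv, 1, G.one_mem, rfl⟩⟩ ?_
    · exact fun y hy => (Finset.mem_filter.1 (this y hy)).2
    intro u hu y hy
    obtain ⟨huV, g, hg, rfl⟩ := Finset.mem_filter.1 hu
    refine Finset.mem_filter.2 ⟨S.sub _ huV hy, ?_⟩
    have himg : (N v).image g = N (g v) := by
      refine Finset.eq_of_subset_of_card_le (Finset.image_subset_iff.2 (key g hg).2) ?_
      rw [Finset.card_image_of_injective _ g.injective, S.card_neighbors_of_eq hv,
        S.card_neighbors_of_eq huV]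
    rw [← himg] at hy
    obtain ⟨x, hx, rfl⟩ := Finset.mem_image.1 hy
    refine ⟨g * edgeReflection v x, G.mul_mem hg (hgen x hx), ?_⟩
    rw [LinearIsometryEquiv.coe_mul, Function.comp_apply, href x hx]
  refine ⟨edgeReflection v w, fun x hx => ?_, href w hw⟩
  obtain ⟨g, hg, rfl⟩ := hmem x hx
  exact (key _ (G.mul_mem (hgen w hw) hg)).1

end BipartiteSkeleton

end Inscribed

section Rows

open scoped InnerProductSpace

variable {E : Type*} [NormedAddCommGroup E] [InnerProductSpace ℝ E]
  {V : Finset E} {N : E → Finset E} {V₁ V₂ : Set E} {a b m : ℝ} {c : E} {W : Submodule ℝ E}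

lemma exists_le_of_sum_mul_eq {ι : Type*} {A : Finset ι} {l p q : ι → ℝ} {ω R : ℝ} (hω : ω < 0)
    (hl : ∀ i, 0 ≤ l i) (hp : ∑ i ∈ A, l i * p i = ω) (hq : ∑ i ∈ A, l i * q i = R)
    (h : ∀ i ∈ A, (p i = 0 ∧ q i = 0) ∨ p i = ω) : ∃ i ∈ A, p i = ω ∧ R ≤ q i := by
  by_contra! hcon
  have hterm : ∀ i ∈ A, 0 ≤ l i * (q i * ω - p i * R) := fun i hi => by
    refine mul_nonneg (hl i) ?_
    rcases h i hi with h | h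
    · simp [h.1, h.2]
    · rw [h]; nlinarith [hcon i hi h]
  have hsum : ∑ i ∈ A, l i * (q i * ω - p i * R) = 0 := by
    simp only [mul_sub, ← mul_assoc, Finset.sum_sub_distrib, ← Finset.sum_mul, hp, hq]
    ring
  have hzero := (Finset.sum_eq_zero_iff_of_nonneg hterm).1 hsum
  refine hω.ne (hp ▸ Finset.sum_eq_zero fun i hi => ?_)
  rcases h i hi with h | h
  · rw [h.1, mul_zero]
  · have h1 := hcon i hi h
    rcases mul_eq_zero.1 (hzero i hi) with h2 | h2
    · rw [h2, zero_mul]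
    · rw [h] at h2; nlinarith

namespace BipartiteSkeleton

lemma row_pos (S : BipartiteSkeleton V N V₁ V₂ a b m) {v w : E} (hv : v ∈ V₁) (hw : w ∈ N v) :
    0 < ∑ x ∈ N v, ⟪w - v, x - v⟫_ℝ := by
  obtain ⟨σ, hσ⟩ := S.row v (S.mem₁ hv)
  rw [← inner_sum, hσ w hw]
  have hcard : (0 : ℝ) < (N v).card := by exact_mod_cast Finset.card_pos.2 ⟨w, hw⟩
  have h1 : ⟪∑ x ∈ N v, (x - v), ∑ x ∈ N v, (x - v)⟫_ℝ = (N v).card * σ := by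
    rw [sum_inner, Finset.sum_congr rfl hσ, Finset.sum_const, nsmul_eq_mul]
  have h2 : ⟪v, ∑ x ∈ N v, (x - v)⟫_ℝ = (N v).card * (m - a) := by
    rw [inner_sum, Finset.sum_congr rfl fun x hx => S.inner_edge_sub hv hx, Finset.sum_const,
      nsmul_eq_mul]
  have h3 : 0 < ⟪∑ x ∈ N v, (x - v), ∑ x ∈ N v, (x - v)⟫_ℝ := by
    refine lt_of_le_of_ne real_inner_self_nonneg fun h => ?_
    rw [(inner_self_eq_zero (𝕜 := ℝ)).1 h.symm, inner_zero_right] at h2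
    have := S.lt₁
    nlinarith
  rw [h1] at h3
  exact (mul_pos_iff_of_pos_left hcard).1 h3

/-- Two edges at a vertex of smaller radius span either a rhombus or a face with an angle of
cosine at most `-1/2`. -/
lemma inner_cases (S : BipartiteSkeleton V N V₁ V₂ a b m) (hab : a ≤ b) {v w x : E}
    (hv : v ∈ V₁) (hw : w ∈ N v) (hx : x ∈ N v) (hwx : w ≠ x) :
    ⟪w - v, x - v⟫_ℝ = a - b ∨
      (⟪w - v, x - v⟫_ℝ ≤ -(a + b - 2 * m) / 2 ∧ ⟪w - v, x - v⟫_ℝ < a - b) := by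
  obtain ⟨c, W, F, hvW, hwW, hxW⟩ := S.exists_twoFace_of_ne hab hv hw hx hwx
  rcases S.face_cases hab F hv hw hx hwx hvW hwW hxW with h | h
  · exact Or.inl h.2
  · exact Or.inr h.2

lemma inner_le_sub (S : BipartiteSkeleton V N V₁ V₂ a b m) (hab : a ≤ b) {v w x : E}
    (hv : v ∈ V₁) (hw : w ∈ N v) (hx : x ∈ N v) (hwx : w ≠ x) : ⟪w - v, x - v⟫_ℝ ≤ a - b := by
  rcases S.inner_cases hab hv hw hx hwx with h | h
  · exact h.le
  · exact h.2.le

/-- An edge at a vertex of smaller radius lies in at most one face which is not a rhombus. -/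
lemma inner_eq_of_inner_lt (S : BipartiteSkeleton V N V₁ V₂ a b m) (hab : a ≤ b) {v w x y : E}
    (hv : v ∈ V₁) (hw : w ∈ N v) (hx : x ∈ N v) (hwx : w ≠ x) (h : ⟪w - v, x - v⟫_ℝ ≠ a - b)
    (hy : y ∈ N v) (hwy : w ≠ y) (hxy : x ≠ y) : ⟪w - v, y - v⟫_ℝ = a - b := by
  classical
  by_contra hy'
  have h1 := ((S.inner_cases hab hv hw hx hwx).resolve_left h).1
  have h2 := ((S.inner_cases hab hv hw hy hwy).resolve_left hy').1
  have h3 := S.row_pos hv hw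
  rw [← Finset.add_sum_erase _ _ hw,
    ← Finset.add_sum_erase _ _ (Finset.mem_erase.2 ⟨hwx.symm, hx⟩),
    ← Finset.add_sum_erase _ _ (Finset.mem_erase.2 ⟨hxy.symm, Finset.mem_erase.2 ⟨hwy.symm, hy⟩⟩),
    S.sq_edge hv hw] at h3
  have h4 : ∑ z ∈ (((N v).erase w).erase x).erase y, ⟪w - v, z - v⟫_ℝ ≤ 0 :=
    Finset.sum_nonpos fun z hz => by
      simp only [Finset.mem_erase] at hz
      exact S.inner_sub_nonpos hab hv hw hz.2.2.2 hz.2.2.1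
  linarith

lemma inner_face_of_rhombi (S : BipartiteSkeleton V N V₁ V₂ a b m) (F : TwoFace V N c W)
    {v w x u : E} {r A M : ℝ} (hA : A = a - ⟪c, c⟫_ℝ) (hM : M = m - ⟪c, c⟫_ℝ)
    (hv : v ∈ V₁) (hw : w ∈ N v) (hx : x ∈ N v) (hwx : w ≠ x)
    (hvW : v - c ∈ W) (hwW : w - c ∈ W) (hxW : x - c ∈ W) (hu : u ∈ N v)
    (huw : ⟪w - v, u - v⟫_ℝ = r) (hux : ⟪x - v, u - v⟫_ℝ = r) :
    ⟪v - c, u - v⟫_ℝ = r / (M - A) * A ∧ ⟪w - c, u - v⟫_ℝ = r / (M - A) * M ∧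
      ⟪c, u - v⟫_ℝ = m - a - r / (M - A) * A := by
  have hA0 := S.face_pos₁ F hv hw hvW hwW
  have h1 := S.face_next F hv hw hx hwx hvW hwW hxW
  have hMA : M - A ≠ 0 := by rw [hA, hM]; have := S.lt₁; intro h; linarith
  rw [← hA] at hA0
  rw [← hA, ← hM] at h1
  have h2 : x - v = (2 * (M - A) / A) • (v - c) - (w - v) := by
    rw [← sub_sub_sub_cancel_right x v c, h1, show 2 * (M - A) / A = 2 * M / A - 2 by field_simp]
    module
  rw [h2, inner_sub_left, real_inner_smul_left, huw] at hux
  have h3 : ⟪v - c, u - v⟫_ℝ = r / (M - A) * A := by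
    field_simp at hux ⊢
    linarith
  have h4 : ⟪w - c, u - v⟫_ℝ = r / (M - A) * M := by
    rw [← sub_add_sub_cancel w v c, inner_add_left, huw, h3]
    field_simp; ring
  refine ⟨h3, h4, ?_⟩
  rw [← h3, ← S.inner_edge_sub hv hu, ← inner_sub_left, sub_sub_cancel]

/-- Two consecutive vertices of smaller radius in a face, all of whose remaining edges span rhombi
with the edges of the face, have edges at a small angle. -/
lemma exists_inner_ge (S : BipartiteSkeleton V N V₁ V₂ a b m) (hab : a < b) (F : TwoFace V N c W)
    {v w x v' x' z : E} {A B M : ℝ} (hA : A = a - ⟪c, c⟫_ℝ) (hB : B = b - ⟪c, c⟫_ℝ)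
    (hM : M = m - ⟪c, c⟫_ℝ) (hv : v ∈ V₁) (hw : w ∈ N v) (hx : x ∈ N v) (hwx : w ≠ x)
    (hvW : v - c ∈ W) (hwW : w - c ∈ W) (hxW : x - c ∈ W)
    (hv' : v' ∈ N w) (hvv' : v ≠ v') (hvW' : v' - c ∈ W) (hx' : x' ∈ N v') (hwx' : w ≠ x')
    (hxW' : x' - c ∈ W) (hz : z ∈ N v') (hzw : ⟪w - v', z - v'⟫_ℝ = a - b)
    (hzx : ⟪x' - v', z - v'⟫_ℝ = a - b)
    (hu : ∀ u ∈ N v, u ≠ w → u ≠ x → ⟪w - v, u - v⟫_ℝ = a - b ∧ ⟪x - v, u - v⟫_ℝ = a - b) :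
    ∃ u ∈ N v, u ≠ w ∧ u ≠ x ∧ z - v' ≠ u - v ∧
      a + b - 2 * m - 2 * ((a - b) / (M - A)) ^ 2 * (A - M ^ 2 / B) ≤ ⟪z - v', u - v⟫_ℝ := by
  have hw2 := S.adj₁ v hv w hw
  have hvw := S.symm v (S.mem₁ hv) w hw
  have hv1' := S.adj₂ w hw2 v' hv'
  have hw' := S.symm w (S.mem₂ hw2) v' hv'
  have hA0 := S.face_pos₁ F hv hw hvW hwW
  have hB0 := S.swap.face_pos₁ F hw2 hvw hwW hvW
  have hC := S.face_cauchy F hv hw hvW hwW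
  rw [← hA] at hA0
  rw [← hB] at hB0
  rw [← hA, ← hB, ← hM] at hC
  have hMA : M - A < 0 := by rw [hA, hM]; linarith [S.lt₁]
  obtain ⟨k, hk⟩ : ∃ k, k = (a - b) / (M - A) := ⟨_, rfl⟩
  have hk0 : 0 < k := by rw [hk]; exact div_pos_of_neg_of_neg (by linarith) hMA
  have hnext := S.swap.face_next F hw2 hvw hv' hvv' hwW hvW hvW'
  have hxn := S.face_next F hv hw hx hwx hvW hwW hxW
  obtain ⟨hz1, hz2, hz3⟩ := S.inner_face_of_rhombi F hA hM hv1' hw' hx' hwx' hvW' hwW hxW' hz hzw hzx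
  rw [← hk] at hz1 hz2 hz3 ⊢
  have hVV := F.inner_sub_sub hvW hvW
  have hVw := F.inner_sub_sub hvW hwW
  have hV'w := F.inner_sub_sub hvW' hwW
  have hV'V' := F.inner_sub_sub hvW' hvW'
  rw [S.sq₁ v hv, ← hA] at hVV
  rw [S.sq₁ v' hv1', ← hA] at hV'V'
  rw [S.edge v (S.mem₁ hv) w hw, ← hM] at hVw
  rw [S.edge v' (S.mem₁ hv1') w hw', ← hM] at hV'w
  have hV'V : ⟪v' - c, v - c⟫_ℝ = 2 * M ^ 2 / B - A := by
    rw [hnext, inner_sub_left, real_inner_smul_left, hVV, real_inner_comm (v - c) (w - c), hVw,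
      ← hB, ← hM]
    ring
  have hzV : ⟪z - v', v - c⟫_ℝ = k * (2 * M ^ 2 / B - A) := by
    have : v - c = (2 * M / B) • (w - c) - (v' - c) := by rw [hnext, hB, hM]; abel
    rw [this, inner_sub_right, real_inner_smul_right, real_inner_comm (w - c), hz2,
      real_inner_comm (v' - c), hz1]
    ring
  have hzz := S.sq_edge hv1' hz
  have hfV : ⟪(z - v') - k • (v' - c), v - c⟫_ℝ = 0 := by
    rw [inner_sub_left, real_inner_smul_left, hzV, hV'V]; ring
  have hfw : ⟪(z - v') - k • (v' - c), w - c⟫_ℝ = 0 := by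
    rw [inner_sub_left, real_inner_smul_left, real_inner_comm (w - c) (z - v'), hz2, hV'w]; ring
  obtain ⟨l, hl, hsum⟩ := S.cone v (S.mem₁ hv) z (S.sub v' (S.mem₁ hv1') hz)
  have hzv : z - v = (z - v') + (v' - c) - (v - c) := by abel
  have hω : m - a - k * A < 0 := by have := S.lt₁; nlinarith
  have hcV := F.orth _ hvW
  have hcw := F.orth _ hwW
  have hcx := F.orth _ hxW
  obtain ⟨u, huN, hu1, hu2⟩ := exists_le_of_sum_mul_eq (A := N v) (l := l)
    (p := fun x => ⟪c, x - v⟫_ℝ) (q := fun x => ⟪(z - v') - k • (v' - c), x - v⟫_ℝ)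
    (R := a + b - 2 * m - k ^ 2 * A) hω hl
    (by
      simp only [← real_inner_smul_right, ← inner_sum]
      rw [← hsum, hzv, inner_sub_right, inner_add_right, hz3, hcV, F.orth _ hvW']
      ring)
    (by
      simp only [← real_inner_smul_right, ← inner_sum]
      rw [← hsum, hzv, inner_sub_right, inner_add_right, hfV,
        inner_sub_left (z - v'), inner_sub_left (z - v'), hzz, real_inner_smul_left,
        real_inner_smul_left, hV'V', real_inner_comm (v' - c) (z - v'), hz1]
      ring)
    (fun y hy => by
      by_cases hyw : y = w
      · subst hyw
        left
        constructor
        · rw [← sub_sub_sub_cancel_right y v c, inner_sub_right, hcV, hcw, sub_zero]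
        · rw [← sub_sub_sub_cancel_right y v c, inner_sub_right, hfV, hfw, sub_zero]
      by_cases hyx : y = x
      · subst hyx
        left
        constructor
        · rw [← sub_sub_sub_cancel_right y v c, inner_sub_right, hcV, hcx, sub_zero]
        · rw [← sub_sub_sub_cancel_right y v c, inner_sub_right, hfV, hxn, inner_sub_right,
            real_inner_smul_right, hfV, hfw]
          ring
      right
      have := hu y hy hyw hyx
      rw [hk]
      exact (S.inner_face_of_rhombi F hA hM hv hw hx hwx hvW hwW hxW hy this.1 this.2).2.2)
  have huw : u ≠ w := by
    rintro rfl
    rw [← sub_sub_sub_cancel_right u v c, inner_sub_right, hcV, hcw, sub_zero] at hu1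
    exact hω.ne hu1.symm
  have hux : u ≠ x := by
    rintro rfl
    rw [← sub_sub_sub_cancel_right u v c, inner_sub_right, hcV, hcx, sub_zero] at hu1
    exact hω.ne hu1.symm
  obtain ⟨hu3, hu4, -⟩ := S.inner_face_of_rhombi F hA hM hv hw hx hwx hvW hwW hxW huN
    (hu u huN huw hux).1 (hu u huN huw hux).2
  rw [← hk] at hu3 hu4
  refine ⟨u, huN, huw, hux, fun h => ?_, ?_⟩
  · rw [← h, real_inner_comm, hzV] at hu3
    have h1 := mul_left_cancel₀ hk0.ne' hu3
    have h2 : M ^ 2 / B = A := by rw [mul_div_assoc] at h1; linarith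
    rw [div_eq_iff hB0.ne'] at h2
    linarith
  · rw [inner_sub_left (z - v'), real_inner_smul_left, hnext, inner_sub_left (_ • _),
      real_inner_smul_left, hu3, hu4, ← hB, ← hM] at hu2
    have : k * (2 * M / B * (k * M) - k * A) = k ^ 2 * (2 * (M ^ 2 / B) - A) := by ring
    rw [this] at hu2
    linarith

/-- The fourth vertex of a rhombus. -/
lemma rhombus (S : BipartiteSkeleton V N V₁ V₂ a b m) (hab : a ≤ b) {v w x : E} (hv : v ∈ V₁)
    (hw : w ∈ N v) (hx : x ∈ N v) (hwx : w ≠ x) (h : ⟪w - v, x - v⟫_ℝ = a - b) :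
    w + (x - v) ∈ N w := by
  obtain ⟨c, W, F, hvW, hwW, hxW⟩ := S.exists_twoFace_of_ne hab hv hw hx hwx
  have h0 : m - ⟪c, c⟫_ℝ = 0 := by
    rcases S.face_cases hab F hv hw hx hwx hvW hwW hxW with h' | h'
    · exact h'.1
    · exact absurd h h'.2.2.ne
  have h1 := S.face_next F hv hw hx hwx hvW hwW hxW
  obtain ⟨q, hq, -, -, -, h2⟩ :=
    S.swap.face_exists_next F (S.adj₁ v hv w hw) (S.symm v (S.mem₁ hv) w hw) hwW hvW
  rw [h0, mul_zero, zero_div, zero_smul] at h1 h2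
  have : w + (x - v) = q := by
    rw [← sub_add_cancel q c, h2, ← sub_sub_sub_cancel_right x v c, h1]; abel
  rwa [this]

end BipartiteSkeleton

end Rows

section HighDimension

open scoped InnerProductSpace

variable {E : Type*} [NormedAddCommGroup E] [InnerProductSpace ℝ E]
  {V : Finset E} {N : E → Finset E} {V₁ V₂ : Set E} {a b m : ℝ} {c : E} {W : Submodule ℝ E}

namespace BipartiteSkeleton

lemma inner_of_rhombus (S : BipartiteSkeleton V N V₁ V₂ a b m) {v w x : E} (hv : v ∈ V₁)
    (hx : x ∈ N v) (h : ⟪w - v, x - v⟫_ℝ = a - b) : ⟪w, x - v⟫_ℝ = m - b := by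
  have h1 := S.inner_edge_sub hv hx
  rw [inner_sub_left] at h
  linarith

lemma row_pos_of_card (S : BipartiteSkeleton V N V₁ V₂ a b m) (hab : a ≤ b) {v w x : E}
    (hv : v ∈ V₁) (hw : w ∈ N v) (hx : x ∈ N v) (hwx : w ≠ x) (hcard : 4 ≤ (N v).card) :
    2 * (b - a) < a + b - 2 * m + ⟪w - v, x - v⟫_ℝ := by
  classical
  have h3 := S.row_pos hv hw
  have hxm := Finset.mem_erase.2 ⟨hwx.symm, hx⟩
  rw [← Finset.add_sum_erase _ _ hw, ← Finset.add_sum_erase _ _ hxm, S.sq_edge hv hw] at h3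
  have h4 := Finset.sum_le_card_nsmul (((N v).erase w).erase x) (fun z => ⟪w - v, z - v⟫_ℝ) (a - b)
    fun z hz => by
      simp only [Finset.mem_erase] at hz
      exact S.inner_le_sub hab hv hw hz.2.2 hz.2.1.symm
  have h5 : (2 : ℝ) ≤ (((N v).erase w).erase x).card := by
    rw [Finset.card_erase_of_mem hxm, Finset.card_erase_of_mem hw]
    exact_mod_cast (by omega : 2 ≤ (N v).card - 1 - 1)
  rw [nsmul_eq_mul] at h4
  nlinarith

/-- The configuration of two consecutive vertices of smaller radius of a face, and the two vertices
opposite to them in adjacent rhombi. -/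
lemma exists_close_neighbors [FiniteDimensional ℝ E] (S : BipartiteSkeleton V N V₁ V₂ a b m)
    (hab : a < b) (hcard : 3 ≤ Module.finrank ℝ E) (F : TwoFace V N c W) {v w x : E}
    (hv : v ∈ V₁) (hw : w ∈ N v) (hx : x ∈ N v) (hwx : w ≠ x) (hvW : v - c ∈ W) (hwW : w - c ∈ W)
    (hxW : x - c ∈ W)
    (hrhomb : ∀ p ∈ V₁, ∀ q ∈ N p, ∀ r ∈ N p, q ≠ r → ⟪q - p, r - p⟫_ℝ = ⟪w - v, x - v⟫_ℝ →
      ∀ u ∈ N p, u ≠ q → u ≠ r → ⟪q - p, u - p⟫_ℝ = a - b) :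
    ∃ y ∈ N w, ∃ z ∈ N w, y ≠ z ∧
      a + b - 2 * m - 2 * ((a - b) / (m - a)) ^ 2 *
        (a - ⟪c, c⟫_ℝ - (m - ⟪c, c⟫_ℝ) ^ 2 / (b - ⟪c, c⟫_ℝ)) ≤ ⟪y - w, z - w⟫_ℝ := by
  classical
  have hw2 := S.adj₁ v hv w hw
  have hvw := S.symm v (S.mem₁ hv) w hw
  obtain ⟨v', hv', hvv', hv1', hvW', -⟩ := S.swap.face_exists_next F hw2 hvw hwW hvW
  have hw' := S.symm w (S.mem₂ hw2) v' hv'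
  obtain ⟨x', hx', hwx', -, hxW', -⟩ := S.face_exists_next F hv1' hw' hvW' hwW
  have hg : ⟪w - v', x' - v'⟫_ℝ = ⟪w - v, x - v⟫_ℝ := by
    rw [S.face_inner F hv hw hx hwx hvW hwW hxW, S.face_inner F hv1' hw' hx' hwx'.symm hvW' hwW hxW']
  obtain ⟨z, hz, hzw, hzx⟩ : ∃ z ∈ N v', z ≠ w ∧ z ≠ x' := by
    by_contra! h
    have : N v' ⊆ {w, x'} := fun z hz => by
      by_cases hzw : z = w
      · simp [hzw]
      · simp [h z hz hzw]
    have := (Finset.card_le_card this).trans (Finset.card_le_two)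
    rw [S.card_neighbors hab.le hv1'] at this
    omega
  have hzw' := hrhomb v' hv1' w hw' x' hx' hwx'.symm hg z hz hzw hzx
  have hzx' := hrhomb v' hv1' x' hx' w hw' hwx' (by rw [real_inner_comm, hg]) z hz hzx hzw
  obtain ⟨u, hu, huw, hux, hne, hle⟩ := S.exists_inner_ge hab F rfl rfl rfl hv hw hx hwx hvW hwW hxW
    hv' hvv'.symm hvW' hx' hwx'.symm hxW' hz hzw' hzx' fun u hu huw hux =>
      ⟨hrhomb v hv w hw x hx hwx rfl u hu huw hux,
        hrhomb v hv x hx w hw hwx.symm (real_inner_comm _ _) u hu hux huw⟩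
  refine ⟨w + (z - v'), S.rhombus hab.le hv1' hw' hz hzw.symm hzw', w + (u - v),
    S.rhombus hab.le hv hw hu huw.symm (hrhomb v hv w hw x hx hwx rfl u hu huw hux),
    fun h => hne (add_left_cancel h), ?_⟩
  rwa [add_sub_cancel_left, add_sub_cancel_left, ← sub_sub_sub_cancel_right m a ⟪c, c⟫_ℝ]

/-- In dimension at least four, all faces are rhombi. -/
lemma inner_eq_of_four_le [FiniteDimensional ℝ E] (S : BipartiteSkeleton V N V₁ V₂ a b m)
    (hab : a < b) (hcard : 4 ≤ Module.finrank ℝ E) {v w x : E}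
    (hv : v ∈ V₁) (hw : w ∈ N v) (hx : x ∈ N v) (hwx : w ≠ x) : ⟪w - v, x - v⟫_ℝ = a - b := by
  by_contra hne
  obtain ⟨c, W, F, hvW, hwW, hxW⟩ := S.exists_twoFace_of_ne hab.le hv hw hx hwx
  obtain ⟨y, hy, z, hz, hyz, hle⟩ := S.exists_close_neighbors hab (by omega) F hv hw hx hwx hvW hwW hxW
    fun v' hv' w' hw' x' hx' hwx' h u hu huw hux =>
      S.inner_eq_of_inner_lt hab.le hv' hw' hx' hwx' (h ▸ hne) hu huw.symm hux.symm
  have hw2 := S.adj₁ v hv w hw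
  have hyz' := S.inner_lt_of_mem₁ (S.adj₂ w hw2 y hy) (S.adj₂ w hw2 z hz) hyz.symm
  have hyz'' : ⟪y - w, z - w⟫_ℝ < b - m := by
    rw [S.swap.inner_sub_sub_of_mem hw2 hy hz]; linarith
  have hrow := S.row_pos_of_card hab.le hv hw hx hwx (by rwa [S.card_neighbors hab.le hv])
  have hcases := ((S.inner_cases hab.le hv hw hx hwx).resolve_left hne).1
  have hpar : 0 < m - ⟪c, c⟫_ℝ := by
    rcases S.face_cases hab.le F hv hw hx hwx hvW hwW hxW with h | h
    · exact absurd h.2 hne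
    · exact h.1
  have hAB := (S.face_parameters F hv hw hvW hwW).2.resolve_left hpar.ne'
  have hA := S.face_pos₁ F hv hw hvW hwW
  have hinner := S.face_inner F hv hw hx hwx hvW hwW hxW
  rw [hinner] at hrow hcases
  have hma : m - a < 0 := by linarith [S.lt₁]
  obtain ⟨A, hA'⟩ : ∃ A, A = a - ⟪c, c⟫_ℝ := ⟨_, rfl⟩
  obtain ⟨B, hB'⟩ : ∃ B, B = b - ⟪c, c⟫_ℝ := ⟨_, rfl⟩
  obtain ⟨M, hM'⟩ : ∃ M, M = m - ⟪c, c⟫_ℝ := ⟨_, rfl⟩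
  rw [← hA', ← hB', ← hM'] at hrow hcases hAB hle
  rw [← hA'] at hA
  have hB : 0 < B := by linarith
  have h1 : (b - a) * A < (m - a) ^ 2 := by
    have e : a + b - 2 * m + (2 * M ^ 2 / A - B - 2 * M + A) = 2 * (m - a) ^ 2 / A := by
      rw [show a + b - 2 * m = A + B - 2 * M by rw [hA', hB', hM']; ring,
        show m - a = M - A by rw [hA', hM']; ring]
      field_simp; ring
    rw [e, lt_div_iff₀ hA] at hrow
    linarith
  have h2 : ((a - b) / (m - a)) ^ 2 * A < b - a := by
    rw [div_pow, div_mul_eq_mul_div, div_lt_iff₀ (by have := hma.ne; positivity)]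
    nlinarith [mul_lt_mul_of_pos_left h1 (sub_pos.2 hab)]
  have h3 : A / 4 ≤ M ^ 2 / B := by
    rw [div_le_div_iff₀ (by norm_num) hB]; linarith
  have h4 : 0 ≤ ((a - b) / (m - a)) ^ 2 := sq_nonneg _
  nlinarith [mul_le_mul_of_nonneg_left h3 h4]

lemma finrank_lt_four [FiniteDimensional ℝ E] (S : BipartiteSkeleton V N V₁ V₂ a b m)
    (hab : a < b) : Module.finrank ℝ E < 4 := by
  by_contra! hcard
  obtain ⟨v, hv⟩ := S.ne₁
  obtain ⟨w, hw, x, hx, hwx⟩ := Finset.one_lt_card.1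
    (show 1 < (N v).card by rw [S.card_neighbors hab.le hv]; omega)
  have hw2 := S.adj₁ v hv w hw
  have hall := fun {v w x : E} hv hw hx hwx =>
    S.inner_eq_of_four_le hab hcard (v := v) (w := w) (x := x) hv hw hx hwx
  obtain ⟨c, W, F, hvW, hwW, hxW⟩ := S.exists_twoFace_of_ne hab.le hv hw hx hwx
  have hzero : ∀ {c : E} {W : Submodule ℝ E}, TwoFace V N c W → ∀ {v w x : E}, v ∈ V₁ → w ∈ N v →
      x ∈ N v → w ≠ x → v - c ∈ W → w - c ∈ W → x - c ∈ W → m - ⟪c, c⟫_ℝ = 0 := by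
    intro c W F v w x hv hw hx hwx hvW hwW hxW
    rcases S.face_cases hab.le F hv hw hx hwx hvW hwW hxW with h | h
    · exact h.1
    · exact absurd (hall hv hw hx hwx) h.2.2.ne
  obtain ⟨y, hy, z, hz, hyz, hle⟩ := S.exists_close_neighbors hab (by omega) F hv hw hx hwx hvW hwW hxW
    fun v' hv' w' hw' x' hx' hwx' h u hu huw hux => hall hv' hw' hu huw.symm
  have hrow := S.row_pos_of_card hab.le hv hw hx hwx (by rwa [S.card_neighbors hab.le hv])
  have hM := hzero F hv hw hx hwx hvW hwW hxW
  have hma : m - a < 0 := by linarith [S.lt₁]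
  rw [hall hv hw hx hwx] at hrow
  rw [hM, show a - ⟪c, c⟫_ℝ = a - m by linarith] at hle
  have hle' : ⟪y - w, z - w⟫_ℝ ≤ b - a := by
    refine S.swap.inner_sub_le_of_faces hw2 hy hz hyz.symm (by linarith) fun q hq hqy hspan => ?_
    obtain ⟨c, W, F, hwW, hyW, hqW⟩ := S.swap.exists_twoFace hw2 hy hq hqy.symm hspan
    have hy1 := S.adj₂ w hw2 y hy
    have hwy := S.symm w (S.mem₂ hw2) y hy
    obtain ⟨p, hp, hpw, -, hpW, -⟩ := S.face_exists_next F hy1 hwy hyW hwW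
    have hM := hzero F hy1 hwy hp hpw.symm hyW hwW hpW
    rw [S.swap.face_inner F hw2 hy hq hqy.symm hwW hyW hqW, hM]
    simp
  have : 2 * ((a - b) / (m - a)) ^ 2 * (a - m - 0 ^ 2 / (b - ⟪c, c⟫_ℝ)) = 2 * (b - a) ^ 2 / (a - m) := by
    have : m - a ≠ 0 := hma.ne
    have : a - m ≠ 0 := by intro h; linarith
    rw [div_pow, show (m - a) ^ 2 = (a - m) ^ 2 by ring, show (a - b) ^ 2 = (b - a) ^ 2 by ring]
    field_simp; simp
  rw [this] at hle
  have h5 : a + b - 2 * m - (b - a) ≤ 2 * (b - a) ^ 2 / (a - m) := by linarith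
  rw [le_div_iff₀ (by linarith)] at h5
  nlinarith

end BipartiteSkeleton

end HighDimension

section Rhombic

open scoped InnerProductSpace

variable {E : Type*} [NormedAddCommGroup E] [InnerProductSpace ℝ E]
  {V : Finset E} {N : E → Finset E} {V₁ V₂ : Set E} {a b m x : ℝ}

/-- A skeleton all of whose faces are rhombi, with three edges at each vertex of smaller radius. -/
structure RhombicSkeleton (V : Finset E) (N : E → Finset E) (V₁ V₂ : Set E) (a b m x : ℝ) : Prop
    extends BipartiteSkeleton V N V₁ V₂ a b m where
  lt : a < b
  card : ∀ v ∈ V₁, (N v).card = 3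
  inner_sub : ∀ v ∈ V₁, ∀ p ∈ N v, ∀ q ∈ N v, p ≠ q → ⟪p - v, q - v⟫_ℝ = a - b
  sum : ∀ v ∈ V₁, ∑ p ∈ N v, p = (2 + 2 * x) • v

lemma BipartiteSkeleton.inner_eq_of_three [FiniteDimensional ℝ E]
    (S : BipartiteSkeleton V N V₁ V₂ a b m) (hab : a < b) (hcard : Module.finrank ℝ E = 3)
    {v w y : E} (hv : v ∈ V₁) (hw : w ∈ N v) (hy : y ∈ N v) (hwy : w ≠ y) :
    ⟪w - v, y - v⟫_ℝ = a - b := by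
  classical
  by_contra hne
  have h3 := S.card_neighbors hab.le hv
  have hym := Finset.mem_erase.2 ⟨hwy.symm, hy⟩
  obtain ⟨u, hu⟩ := Finset.card_eq_one.1 (show (((N v).erase w).erase y).card = 1 by
    rw [Finset.card_erase_of_mem hym, Finset.card_erase_of_mem hw]; omega)
  have hu' : u ∈ ((N v).erase w).erase y := by rw [hu]; exact Finset.mem_singleton_self u
  simp only [Finset.mem_erase] at hu'
  obtain ⟨huy, huw, huN⟩ := hu'
  obtain ⟨σ, hσ⟩ := S.row v (S.mem₁ hv)
  have hsum : ∑ p ∈ N v, (p - v) = (w - v) + ((y - v) + (u - v)) := by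
    rw [← Finset.add_sum_erase _ _ hw, ← Finset.add_sum_erase _ _ hym, hu, Finset.sum_singleton]
  have h1 := S.inner_eq_of_inner_lt hab.le hv hw hy hwy hne huN huw.symm huy.symm
  have h2 := S.inner_eq_of_inner_lt hab.le hv hy hw hwy.symm
    (by rwa [real_inner_comm]) huN huy.symm huw.symm
  have hw' := hσ w hw
  have hu' := hσ u huN
  rw [hsum, inner_add_right, inner_add_right, S.sq_edge hv hw, h1] at hw'
  rw [hsum, inner_add_right, inner_add_right, S.sq_edge hv huN, real_inner_comm (w - v),
    real_inner_comm (y - v), h1, h2] at hu'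
  exact hne (by linarith)

/-- A strictly bipartite polytope has dimension three and rhombic faces. -/
lemma BipartiteSkeleton.exists_rhombicSkeleton [FiniteDimensional ℝ E]
    (S : BipartiteSkeleton V N V₁ V₂ a b m) (hab : a < b) (hd : 3 ≤ Module.finrank ℝ E) :
    Module.finrank ℝ E = 3 ∧ ∃ x, RhombicSkeleton V N V₁ V₂ a b m x := by
  have hd3 : Module.finrank ℝ E = 3 := by have := S.finrank_lt_four hab; omega
  have hinner : ∀ v ∈ V₁, ∀ p ∈ N v, ∀ q ∈ N v, p ≠ q → ⟪p - v, q - v⟫_ℝ = a - b :=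
    fun v hv p hp q hq hpq => S.inner_eq_of_three hab hd3 hv hp hq hpq
  have hcard : ∀ v ∈ V₁, (N v).card = 3 := fun v hv => hd3 ▸ S.card_neighbors hab.le hv
  refine ⟨hd3, ((m - b) / (m - a) - 2) / 2, { S with
    lt := hab
    card := hcard
    inner_sub := hinner
    sum := fun v hv => ?_ }⟩
  have hma : m - a ≠ 0 := by linarith [S.lt₁]
  rw [show 2 + 2 * (((m - b) / (m - a) - 2) / 2) = (m - b) / (m - a) by ring, ← sub_eq_zero]
  refine S.full v (S.mem₁ hv) _ fun p hp => ?_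
  classical
  have hs : ∀ q ∈ (N v).erase p, ⟪q, p - v⟫_ℝ = m - b := fun q hq => by
    have hq := Finset.mem_erase.1 hq
    exact S.inner_of_rhombus hv hp (hinner v hv q hq.2 p hp hq.1)
  have hpp : ⟪p, p - v⟫_ℝ = b - m := by
    rw [inner_sub_right, S.sq₂ p (S.adj₁ v hv p hp), real_inner_comm v p, S.edge v (S.mem₁ hv) p hp]
  rw [inner_sub_left, sum_inner, real_inner_smul_left, S.inner_edge_sub hv hp,
    ← Finset.add_sum_erase _ _ hp, Finset.sum_congr rfl hs, Finset.sum_const,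
    Finset.card_erase_of_mem hp, hcard v hv, hpp, div_mul_cancel₀ _ hma]
  norm_num
  ring

namespace RhombicSkeleton

lemma rhombus (S : RhombicSkeleton V N V₁ V₂ a b m x) {v p q : E} (hv : v ∈ V₁) (hp : p ∈ N v)
    (hq : q ∈ N v) (hpq : p ≠ q) : p + (q - v) ∈ N p :=
  S.toBipartiteSkeleton.rhombus S.lt.le hv hp hq hpq (S.inner_sub v hv p hp q hq hpq)

lemma inner_eq (S : RhombicSkeleton V N V₁ V₂ a b m x) {v p q : E} (hv : v ∈ V₁) (hp : p ∈ N v)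
    (hq : q ∈ N v) (hpq : p ≠ q) : ⟪p, q⟫_ℝ = 2 * m - b := by
  have := S.inner_sub v hv p hp q hq hpq
  rw [S.inner_sub_sub_of_mem hv hp hq] at this
  linarith

lemma exists_eq (S : RhombicSkeleton V N V₁ V₂ a b m x) {v p q : E} (hv : v ∈ V₁) (hp : p ∈ N v)
    (hq : q ∈ N v) (hpq : p ≠ q) :
    ∃ r, p ≠ r ∧ q ≠ r ∧ (∀ y, y ∈ N v ↔ y = p ∨ y = q ∨ y = r) ∧ p + q + r = (2 + 2 * x) • v := by
  classical
  have hqm := Finset.mem_erase.2 ⟨hpq.symm, hq⟩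
  obtain ⟨r, hr⟩ := Finset.card_eq_one.1 (show (((N v).erase p).erase q).card = 1 by
    rw [Finset.card_erase_of_mem hqm, Finset.card_erase_of_mem hp, S.card v hv])
  have hr' : r ∈ ((N v).erase p).erase q := by rw [hr]; exact Finset.mem_singleton_self r
  simp only [Finset.mem_erase] at hr'
  refine ⟨r, hr'.2.1.symm, hr'.1.symm, fun y => ?_, ?_⟩
  · rw [← Finset.insert_erase hp, ← Finset.insert_erase hqm, hr]; simp
  · rw [← S.sum v hv, ← Finset.add_sum_erase _ _ hp, ← Finset.add_sum_erase _ _ hqm, hr,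
      Finset.sum_singleton, add_assoc]

lemma exists_neighbors (S : RhombicSkeleton V N V₁ V₂ a b m x) {v : E} (hv : v ∈ V₁) :
    ∃ p q r, p ≠ q ∧ p ≠ r ∧ q ≠ r ∧ (∀ y, y ∈ N v ↔ y = p ∨ y = q ∨ y = r) ∧
      p + q + r = (2 + 2 * x) • v := by
  obtain ⟨p, hp, q, hq, hpq⟩ := Finset.one_lt_card.1 (show 1 < (N v).card by rw [S.card v hv]; omega)
  obtain ⟨r, h1, h2, h3, h4⟩ := S.exists_eq hv hp hq hpq
  exact ⟨p, q, r, hpq, h1, h2, h3, h4⟩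

lemma parameters (S : RhombicSkeleton V N V₁ V₂ a b m x) :
    (2 + 2 * x) * a = 3 * m ∧ b = (2 - 2 * x) * m ∧ 0 < a ∧ 0 < m ∧ -(1 / 2) < x ∧ x < 1 / 2 := by
  obtain ⟨v, hv⟩ := S.ne₁
  obtain ⟨p, q, r, hpq, hpr, hqr, hN, hsum⟩ := S.exists_neighbors hv
  have hp : p ∈ N v := (hN p).2 (by simp)
  have hq : q ∈ N v := (hN q).2 (by simp)
  have hr : r ∈ N v := (hN r).2 (by simp)
  have h1 := congrArg (fun z => ⟪v, z⟫_ℝ) hsum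
  have h2 := congrArg (fun z => ⟪p, z⟫_ℝ) hsum
  simp only [inner_add_right, real_inner_smul_right, S.sq₁ v hv, S.edge v (S.mem₁ hv) p hp,
    S.edge v (S.mem₁ hv) q hq, S.edge v (S.mem₁ hv) r hr] at h1
  simp only [inner_add_right, real_inner_smul_right, real_inner_comm v p,
    S.sq₂ p (S.adj₁ v hv p hp), S.edge v (S.mem₁ hv) p hp,
    S.inner_eq hv hp hq hpq, S.inner_eq hv hp hr hpr] at h2
  have h3 := S.lt₁
  have h4 := S.lt₂
  have h5 := S.lt
  have h6 : 0 ≤ a := by rw [← S.sq₁ v hv]; exact real_inner_self_nonneg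
  have hb : b = (2 - 2 * x) * m := by linarith
  have ha : 0 < a := by
    refine lt_of_le_of_ne h6 fun h => ?_
    rw [← h] at h1
    have hm : m = 0 := by linarith
    rw [hm] at hb h3
    linarith
  have hx : 0 < 2 + 2 * x := by
    by_contra! h
    have h7 : m ≤ 0 := by nlinarith
    have h8 : 0 ≤ (2 + 2 * x) * (m - a) :=
      mul_nonneg_of_nonpos_of_nonpos h (by linarith)
    nlinarith
  have hm : 0 < m := by nlinarith
  have h7 : 3 * m < (2 + 2 * x) * ((2 - 2 * x) * m) := by
    rw [← hb]; nlinarith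
  have h8 : x ^ 2 < 1 / 4 := by
    by_contra! h
    nlinarith
  refine ⟨by linarith, hb, ha, hm, ?_, ?_⟩ <;> nlinarith

lemma inner_le_of_mem₂ (S : RhombicSkeleton V N V₁ V₂ a b m x) {w y z : E} (hw : w ∈ V₂)
    (hy : y ∈ N w) (hz : z ∈ N w) (hyz : y ≠ z) : ⟪y, z⟫_ℝ ≤ 2 * m - a := by
  have h1 := S.lt₁
  have h2 := S.lt
  have := S.swap.inner_sub_le_of_faces hw hy hz hyz.symm (r := b - a) (by linarith)
    fun q hq hqy hspan => by
      obtain ⟨c, W, F, hwW, hyW, hqW⟩ := S.swap.exists_twoFace hw hy hq hqy.symm hspan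
      have hy1 := S.adj₂ w hw y hy
      have hwy := S.symm w (S.mem₂ hw) y hy
      obtain ⟨p, hp, hpw, -, hpW, -⟩ := S.face_exists_next F hy1 hwy hyW hwW
      have hM : m - ⟪c, c⟫_ℝ = 0 := by
        rcases S.face_cases S.lt.le F hy1 hwy hp hpw.symm hyW hwW hpW with h | h
        · exact h.1
        · exact absurd (S.inner_sub y hy1 w hwy p hp hpw.symm) h.2.2.ne
      rw [S.swap.face_inner F hw hy hq hqy.symm hwW hyW hqW, hM]
      simp
  rw [S.swap.inner_sub_sub_of_mem hw hy hz] at this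
  linarith

/-- Going around a vertex of larger radius. -/
lemma next_mem (S : RhombicSkeleton V N V₁ V₂ a b m x) {w y q z : E} (hy : y ∈ V₁)
    (hw : w ∈ N y) (hq : q ∈ N y) (hwq : w ≠ q) (hz : z = w + (q - y)) :
    z ∈ V₁ ∧ w ∈ N z ∧ ∃ n ∈ N z, w ≠ n ∧ w + (2 * x) • z - y = w + (n - z) := by
  have hz' := S.rhombus hy hw hq hwq
  have hz'' := S.rhombus hy hq hw hwq.symm
  rw [show q + (w - y) = z by rw [hz]; abel] at hz''
  rw [← hz] at hz'
  have hz1 := S.adj₂ w (S.adj₁ y hy w hw) z hz'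
  have hwz := S.symm w (S.sub y (S.mem₁ hy) hw) z hz'
  have hqz := S.symm q (S.sub y (S.mem₁ hy) hq) z hz''
  obtain ⟨n, h1, h2, h3, h4⟩ := S.exists_eq hz1 hwz hqz hwq
  refine ⟨hz1, hwz, n, (h3 n).2 (by simp), h1, ?_⟩
  rw [show n = (2 + 2 * x) • z - w - q by rw [← h4]; abel, show q = z - w + y by rw [hz]; abel]
  module

lemma parameter_cases (S : RhombicSkeleton V N V₁ V₂ a b m x) :
    x = 0 ∨ (0 < x ∧ 4 * x ^ 2 + 2 * x - 1 = 0) := by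
  obtain ⟨ha, hb, ha0, hm0, hx1, hx2⟩ := S.parameters
  obtain ⟨v, hv⟩ := S.ne₁
  obtain ⟨w, q, r, hwq, -, -, hN, -⟩ := S.exists_neighbors hv
  have hw : w ∈ N v := (hN w).2 (by simp)
  have hq : q ∈ N v := (hN q).2 (by simp)
  have hw2 := S.adj₁ v hv w hw
  have hvw := S.symm v (S.mem₁ hv) w hw
  obtain ⟨y₁, hy₁⟩ : ∃ y, y = w + (q - v) := ⟨_, rfl⟩
  obtain ⟨h1, hw1, q₁, hq₁, hwq₁, e₁⟩ := S.next_mem hv hw hq hwq hy₁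
  obtain ⟨h2, hw2', q₂, hq₂, hwq₂, e₂⟩ := S.next_mem h1 hw1 hq₁ hwq₁ e₁
  obtain ⟨h3, hw3, q₃, hq₃, hwq₃, e₃⟩ := S.next_mem h2 hw2' hq₂ hwq₂ e₂
  obtain ⟨h4, hw4, q₄, hq₄, hwq₄, e₄⟩ := S.next_mem h3 hw3 hq₃ hwq₃ e₃
  obtain ⟨h5, hw5, -⟩ := S.next_mem h4 hw4 hq₄ hwq₄ e₄
  clear e₁ e₂ e₃ e₄
  have hvv := S.sq₁ v hv
  have hvwm := S.edge v (S.mem₁ hv) w hw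
  have hvy₁ : ⟪v, y₁⟫_ℝ = 2 * m - a := by
    rw [hy₁, inner_add_right, inner_sub_right, hvwm, S.edge v (S.mem₁ hv) q hq, hvv]; ring
  have hstep : ∀ y z, ⟪v, w + (2 * x) • z - y⟫_ℝ = m + 2 * x * ⟪v, z⟫_ℝ - ⟪v, y⟫_ℝ := fun y z => by
    rw [inner_sub_right, inner_add_right, real_inner_smul_right, hvwm]
  have key : ∀ y ∈ V₁, w ∈ N y → ⟪v, y⟫_ℝ ≤ 2 * m - a ∨ ⟪v, y⟫_ℝ = a := fun y hy hwy => by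
    by_cases hvy : v = y
    · right; rw [← hvy, hvv]
    · left; exact S.inner_le_of_mem₂ hw2 hvw (S.symm y (S.mem₁ hy) w hwy) hvy
  have k3 := key _ h3 hw3
  have k5 := key _ h5 hw5
  simp only [hstep, hvy₁, hvv] at k3 k5
  have hma : 0 < a - m := by linarith [S.lt₁]
  rcases lt_trichotomy x 0 with h | h | h
  · exfalso
    rcases k3 with k3 | k3
    · have : 8 * (a - m) * (x * (1 + x)) ≥ 0 := by
        have e : m + 2 * x * (m + 2 * x * (2 * m - a) - a) - (2 * m - a) - (2 * m - a)
          = -(8 * (a - m) * (x * (1 + x))) := by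
          linear_combination (1 + 2 * x) * ha
        linarith
      nlinarith [mul_pos hma (mul_pos (neg_pos.2 h) (by linarith : 0 < 1 + x))]
    · have e : m + 2 * x * (m + 2 * x * (2 * m - a) - a) - (2 * m - a) - a
          = -(2 * (a - m) * (2 * x + 1) ^ 2) := by
        linear_combination (1 + 2 * x) * ha
      have : 0 < (a - m) * (2 * x + 1) ^ 2 := mul_pos hma (pow_pos (by linarith) 2)
      linarith
  · exact Or.inl h
  · right
    refine ⟨h, ?_⟩
    rcases k5 with k5 | k5
    · exfalso
      have e : m + 2 * x * (m + 2 * x * (m + 2 * x * (m + 2 * x * (2 * m - a) - a) - (2 * m - a)) -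
          (m + 2 * x * (2 * m - a) - a)) - (m + 2 * x * (m + 2 * x * (2 * m - a) - a) - (2 * m - a))
          - (2 * m - a) = 8 * ((a - m) * (x * (1 + x) * (1 - 4 * x ^ 2))) := by
        linear_combination (8 * x ^ 3 + 4 * x ^ 2 - 2 * x) * ha
      have : 0 < (a - m) * (x * (1 + x) * (1 - 4 * x ^ 2)) :=
        mul_pos hma (mul_pos (by positivity) (by nlinarith))
      linarith
    · have e : m + 2 * x * (m + 2 * x * (m + 2 * x * (m + 2 * x * (2 * m - a) - a) - (2 * m - a)) -
          (m + 2 * x * (2 * m - a) - a)) - (m + 2 * x * (m + 2 * x * (2 * m - a) - a) - (2 * m - a))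
          - a = -(2 * (a - m) * (4 * x ^ 2 + 2 * x - 1) ^ 2) := by
        linear_combination (8 * x ^ 3 + 4 * x ^ 2 - 2 * x) * ha
      have h0 : (a - m) * (4 * x ^ 2 + 2 * x - 1) ^ 2 = 0 := by linarith
      exact pow_eq_zero_iff two_ne_zero |>.1 ((mul_eq_zero.1 h0).resolve_left hma.ne')

end RhombicSkeleton

end Rhombic

section Frames

open scoped InnerProductSpace

variable {E : Type*} [NormedAddCommGroup E] [InnerProductSpace ℝ E]
  {V : Finset E} {N : E → Finset E} {V₁ V₂ : Set E} {a b m x : ℝ}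

/-- `v` is a vertex of smaller radius with neighbours `p`, `q`, `r`. -/
structure IsFrame (N : E → Finset E) (V₁ : Set E) (x : ℝ) (v p q r : E) : Prop where
  mem : v ∈ V₁
  ne₁ : p ≠ q
  ne₂ : p ≠ r
  ne₃ : q ≠ r
  mem_iff : ∀ y, y ∈ N v ↔ y = p ∨ y = q ∨ y = r
  sum : p + q + r = (2 + 2 * x) • v

namespace IsFrame

variable {v p q r : E}

lemma rotate (h : IsFrame N V₁ x v p q r) : IsFrame N V₁ x v q r p :=
  ⟨h.mem, h.ne₃, h.ne₁.symm, h.ne₂.symm, fun y => by rw [h.mem_iff]; tauto, by rw [← h.sum]; abel⟩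

lemma swap (h : IsFrame N V₁ x v p q r) : IsFrame N V₁ x v q p r :=
  ⟨h.mem, h.ne₁.symm, h.ne₃, h.ne₂, fun y => by rw [h.mem_iff]; tauto, by rw [← h.sum]; abel⟩

lemma mem_left (h : IsFrame N V₁ x v p q r) : p ∈ N v := (h.mem_iff p).2 (by simp)

/-- Crossing to the opposite vertex of a rhombus. -/
lemma flip (S : RhombicSkeleton V N V₁ V₂ a b m x) (h : IsFrame N V₁ x v p q r) :
    IsFrame N V₁ x (p + q - v) p q ((2 * x) • (p + q) - r) := by
  have hp := h.mem_left
  have hq := h.rotate.mem_left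
  have hp2 := S.adj₁ v h.mem p hp
  have hq2 := S.adj₁ v h.mem q hq
  have h1 := S.rhombus h.mem hp hq h.ne₁
  have h2 := S.rhombus h.mem hq hp h.ne₁.symm
  rw [← add_sub_assoc] at h1 h2
  rw [add_comm q p] at h2
  have h3 := S.adj₂ p hp2 _ h1
  obtain ⟨s, hs1, hs2, hs3, hs4⟩ :=
    S.exists_eq h3 (S.symm p (S.mem₂ hp2) _ h1) (S.symm q (S.mem₂ hq2) _ h2) h.ne₁
  have hs : s = (2 * x) • (p + q) - r := by
    have e : r = (2 + 2 * x) • v - p - q := by rw [← h.sum]; abel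
    have e' : s = (2 + 2 * x) • (p + q - v) - p - q := by rw [← hs4]; abel
    rw [e, e']; module
  subst hs
  exact ⟨h3, h.ne₁, hs1, hs2, hs3, hs4⟩

end IsFrame

namespace RhombicSkeleton

/-- A set of vertices of smaller radius which is closed under crossing rhombi spans, together
with the adjacent vertices, the whole polytope. -/
lemma vertices_subset_convexHull (S : RhombicSkeleton V N V₁ V₂ a b m x) {K A : Set E} (hne : K.Nonempty)
    (hK : ∀ v ∈ K, v ∈ A ∧ ∃ p q r, IsFrame N V₁ x v p q r ∧ p + q - v ∈ K ∧ q + r - v ∈ K ∧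
      r + p - v ∈ K ∧ p ∈ A ∧ q ∈ A ∧ r ∈ A) :
    (V : Set E) ⊆ convexHull ℝ A := by
  classical
  intro y hy
  have hKV : ∀ v ∈ K, v ∈ V₁ := fun v hv => by
    obtain ⟨-, p, q, r, h, -⟩ := hK v hv
    exact h.mem
  have hflip : ∀ v ∈ K, ∀ p ∈ N v, ∀ q ∈ N v, p ≠ q → p + q - v ∈ K := by
    intro v hv p hp q hq hpq
    obtain ⟨-, p', q', r', h, h1, h2, h3, -⟩ := hK v hv
    rw [h.mem_iff] at hp hq
    rcases hp with rfl | rfl | rfl <;> rcases hq with rfl | rfl | rfl <;>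
      first
        | exact absurd rfl hpq
        | assumption
        | (rw [add_comm]; assumption)
  set U := V.filter fun y => y ∈ K ∨ ∃ v ∈ K, y ∈ N v with hU
  have hUA : (U : Set E) ⊆ A := by
    intro u hu
    rcases (Finset.mem_filter.1 hu).2 with h | ⟨v, hv, h⟩
    · exact (hK u h).1
    · obtain ⟨-, p, q, r, hf, -, -, -, hp, hq, hr⟩ := hK v hv
      rcases (hf.mem_iff u).1 h with rfl | rfl | rfl <;> assumption
  refine convexHull_mono hUA ?_
  by_contra hyU
  obtain ⟨f, t, hft, hfy⟩ := geometric_hahn_banach_closed_point (convex_convexHull ℝ (U : Set E))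
    (U.finite_toSet.isCompact_convexHull ℝ).isClosed hyU
  have hlt : ∀ u ∈ U, f u < f y := fun u hu => (hft u (subset_convexHull ℝ _ hu)).trans hfy
  obtain ⟨v₀, hv₀⟩ := hne
  obtain ⟨u, hu, hmax⟩ := U.exists_max_image f
    ⟨v₀, Finset.mem_filter.2 ⟨S.mem₁ (hKV v₀ hv₀), Or.inl hv₀⟩⟩
  have hcone : ∀ u ∈ U, ¬ ∀ z ∈ N u, f z ≤ f u := by
    intro u hu h
    obtain ⟨c, hc, hsum⟩ := S.cone u (Finset.mem_filter.1 hu).1 y hy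
    have h1 := congrArg f hsum
    simp only [map_sub, map_sum, map_smul, smul_eq_mul] at h1
    have h2 : ∑ z ∈ N u, c z * (f z - f u) ≤ 0 := Finset.sum_nonpos fun z hz =>
      mul_nonpos_of_nonneg_of_nonpos (hc z) (by linarith [h z hz])
    linarith [hlt u hu]
  have hNK : ∀ v ∈ K, ∀ z ∈ N v, z ∈ U := fun v hv z hz =>
    Finset.mem_filter.2 ⟨S.sub v (S.mem₁ (hKV v hv)) hz, Or.inr ⟨v, hv, hz⟩⟩
  rcases (Finset.mem_filter.1 hu).2 with huK | ⟨v₁, hv₁, hv₁u⟩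
  · exact hcone u hu fun z hz => hmax z (hNK u huK z hz)
  have hu2 := S.adj₁ v₁ (hKV v₁ hv₁) u hv₁u
  obtain ⟨v, hv, hvmax⟩ := ((N u).filter (· ∈ K)).exists_max_image f
    ⟨v₁, Finset.mem_filter.2 ⟨S.symm v₁ (S.mem₁ (hKV v₁ hv₁)) u hv₁u, hv₁⟩⟩
  obtain ⟨hvu, hvK⟩ := Finset.mem_filter.1 hv
  have hv1 := hKV v hvK
  have huv := S.symm u (S.mem₂ hu2) v hvu
  refine hcone u hu fun z hz => ?_
  have hfv : f v ≤ f u := hmax v (Finset.mem_filter.2 ⟨S.mem₁ hv1, Or.inl hvK⟩)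
  obtain ⟨c, hc, hsum⟩ := S.cone v (S.mem₁ hv1) z (S.sub u (S.mem₂ hu2) hz)
  rw [← Finset.add_sum_erase _ _ huv] at hsum
  have hmb := S.lt₂
  have hcu : c u = ∑ n ∈ (N v).erase u, c n := by
    have h1 := congrArg (fun z => ⟪u, z⟫_ℝ) hsum
    have h2 : ∀ n ∈ (N v).erase u, ⟪u, c n • (n - v)⟫_ℝ = c n * (m - b) := fun n hn => by
      have hn := Finset.mem_erase.1 hn
      rw [real_inner_smul_right, inner_sub_right, S.inner_eq hv1 huv hn.2 hn.1.symm,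
        S.edge u (S.mem₂ hu2) v hvu]
      ring
    simp only [inner_add_right, inner_sum] at h1
    rw [Finset.sum_congr rfl h2, ← Finset.sum_mul, real_inner_smul_right, inner_sub_right,
      inner_sub_right, S.sq₂ u hu2, S.edge u (S.mem₂ hu2) v hvu, S.edge u (S.mem₂ hu2) z hz] at h1
    have h3 : (c u - ∑ n ∈ (N v).erase u, c n) * (b - m) = 0 := by linarith
    linarith [(mul_eq_zero.1 h3).resolve_right (by linarith)]
  have h1 := congrArg f hsum
  simp only [map_sub, map_add, map_sum, map_smul, smul_eq_mul] at h1
  rw [hcu, Finset.sum_mul, ← Finset.sum_add_distrib] at h1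
  have h2 : ∑ n ∈ (N v).erase u, (c n * (f u - f v) + c n * (f n - f v)) ≤ 0 :=
    Finset.sum_nonpos fun n hn => by
      have hn := Finset.mem_erase.1 hn
      have h3 := S.rhombus hv1 huv hn.2 hn.1.symm
      have h4 := hvmax (u + (n - v)) (Finset.mem_filter.2 ⟨h3, by
        rw [← add_sub_assoc]; exact hflip v hvK u huv n hn.2 hn.1.symm⟩)
      rw [map_add, map_sub] at h4
      rw [← mul_add]
      exact mul_nonpos_of_nonneg_of_nonpos (hc n) (by linarith)
  linarith

end RhombicSkeleton

end Frames

section Coordinates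

open scoped InnerProductSpace

variable {E : Type*} [NormedAddCommGroup E] [InnerProductSpace ℝ E]
  {V : Finset E} {N : E → Finset E} {V₁ V₂ : Set E} {a b m x : ℝ}

/-- The given axes span the frame of a rhombic dodecahedron. -/
def IsCubicFrame (N : E → Finset E) (V₁ : Set E) (e₁ e₂ e₃ : E) : Prop :=
  IsFrame N V₁ 0 (e₁ + e₂ + e₃) ((2 : ℝ) • e₁) ((2 : ℝ) • e₂) ((2 : ℝ) • e₃)

namespace IsCubicFrame

variable {e₁ e₂ e₃ : E}

lemma rotate (h : IsCubicFrame N V₁ e₁ e₂ e₃) : IsCubicFrame N V₁ e₂ e₃ e₁ := by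
  have := IsFrame.rotate h
  rwa [show e₁ + e₂ + e₃ = e₂ + e₃ + e₁ by abel] at this

lemma neg (S : RhombicSkeleton V N V₁ V₂ a b m 0) (h : IsCubicFrame N V₁ e₁ e₂ e₃) :
    IsCubicFrame N V₁ (-e₁) e₂ e₃ := by
  have := (IsFrame.flip S (IsFrame.rotate h)).rotate.rotate
  unfold IsCubicFrame
  convert this using 1 <;> module

end IsCubicFrame

/-- The given axes span the frame of a rhombic triacontahedron, at a vertex `(1, 1, 1)`. -/
def IsGoldenFrame (N : E → Finset E) (V₁ : Set E) (x : ℝ) (e₁ e₂ e₃ : E) : Prop :=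
  IsFrame N V₁ x (e₁ + e₂ + e₃) ((1 + 2 * x) • e₂ + e₃) ((1 + 2 * x) • e₃ + e₁)
    ((1 + 2 * x) • e₁ + e₂)

namespace IsGoldenFrame

variable {e₁ e₂ e₃ : E}

lemma rotate (h : IsGoldenFrame N V₁ x e₁ e₂ e₃) : IsGoldenFrame N V₁ x e₂ e₃ e₁ := by
  have := IsFrame.rotate h
  rwa [show e₁ + e₂ + e₃ = e₂ + e₃ + e₁ by abel] at this

/-- The frame at the vertex `(0, 1 / φ, φ)`. -/
lemma adjacent (S : RhombicSkeleton V N V₁ V₂ a b m x) (hx : 4 * x ^ 2 + 2 * x - 1 = 0)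
    (h : IsGoldenFrame N V₁ x e₁ e₂ e₃) :
    IsFrame N V₁ x ((2 * x) • e₂ + (1 + 2 * x) • e₃) ((1 + 2 * x) • e₂ + e₃)
      ((1 + 2 * x) • e₃ + e₁) ((1 + 2 * x) • e₃ - e₁) := by
  convert IsFrame.flip S h using 1
  · module
  · match_scalars <;> first | ring1 | linear_combination -hx

lemma neg (S : RhombicSkeleton V N V₁ V₂ a b m x) (hx : 4 * x ^ 2 + 2 * x - 1 = 0)
    (h : IsGoldenFrame N V₁ x e₁ e₂ e₃) : IsGoldenFrame N V₁ x (-e₁) e₂ e₃ := by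
  unfold IsGoldenFrame
  convert (IsFrame.flip S (h.adjacent S hx).rotate.rotate).swap using 1
  · module
  · module
  · match_scalars <;> first | ring1 | linear_combination -hx

end IsGoldenFrame

end Coordinates

section Axes

open scoped InnerProductSpace

lemma exists_isometry_smul_pt3 {e₁ e₂ e₃ : Euc 3} {c : ℝ} (hc : 0 < c)
    (h₁₁ : ⟪e₁, e₁⟫_ℝ = c) (h₂₂ : ⟪e₂, e₂⟫_ℝ = c) (h₃₃ : ⟪e₃, e₃⟫_ℝ = c)
    (h₁₂ : ⟪e₁, e₂⟫_ℝ = 0) (h₁₃ : ⟪e₁, e₃⟫_ℝ = 0) (h₂₃ : ⟪e₂, e₃⟫_ℝ = 0) :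
    ∃ (T : Euc 3 ≃ₗᵢ[ℝ] Euc 3) (lam : ℝ), 0 < lam ∧
      ∀ s t u : ℝ, lam • T (pt3 s t u) = s • e₁ + t • e₂ + u • e₃ := by
  have hs : 0 < √c := Real.sqrt_pos.2 hc
  have hcs : (√c)⁻¹ * ((√c)⁻¹ * c) = 1 := by
    rw [← mul_assoc, ← mul_inv, Real.mul_self_sqrt hc.le, inv_mul_cancel₀ hc.ne']
  have ho : Orthonormal ℝ (fun i => (√c)⁻¹ • ![e₁, e₂, e₃] i) := by
    rw [orthonormal_iff_ite]
    intro i j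
    rw [real_inner_smul_left, real_inner_smul_right]
    fin_cases i <;> fin_cases j <;>
      simp [-inner_self_eq_norm_sq_to_K, h₁₁, h₂₂, h₃₃, h₁₂, h₁₃,
        h₂₃, real_inner_comm e₁ e₂, real_inner_comm e₁ e₃, real_inner_comm e₂ e₃, hcs]
  let B := (basisOfOrthonormalOfCardEqFinrank ho (by simp)).toOrthonormalBasis (by simpa using ho)
  refine ⟨B.repr.symm, √c, hs, fun s t u => ?_⟩
  have hB : ∀ i, B i = (√c)⁻¹ • ![e₁, e₂, e₃] i := fun i => by simp [B]
  rw [← B.sum_repr_symm, Fin.sum_univ_three, hB, hB, hB]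
  simp only [pt3, smul_add, smul_smul]
  simp
  field_simp

lemma RhombicSkeleton.exists_isometry_isCubicFrame {V : Finset (Euc 3)}
    {N : Euc 3 → Finset (Euc 3)} {V₁ V₂ : Set (Euc 3)} {a b m : ℝ}
    (S : RhombicSkeleton V N V₁ V₂ a b m 0) :
    ∃ (T : Euc 3 ≃ₗᵢ[ℝ] Euc 3) (lam : ℝ) (e₁ e₂ e₃ : Euc 3), 0 < lam ∧
      (∀ s t u : ℝ, lam • T (pt3 s t u) = s • e₁ + t • e₂ + u • e₃) ∧
      IsCubicFrame N V₁ e₁ e₂ e₃ := by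
  obtain ⟨v, hv⟩ := S.ne₁
  obtain ⟨p, q, r, hpq, hpr, hqr, hN, hsum⟩ := S.exists_neighbors hv
  obtain ⟨-, hb, -, hm, -⟩ := S.parameters
  have hp := (hN p).2 (by simp)
  have hq := (hN q).2 (by simp)
  have hr := (hN r).2 (by simp)
  have hpp := S.sq₂ p (S.adj₁ v hv p hp)
  have hqq := S.sq₂ q (S.adj₁ v hv q hq)
  have hrr := S.sq₂ r (S.adj₁ v hv r hr)
  have hpq' := S.inner_eq hv hp hq hpq
  have hpr' := S.inner_eq hv hp hr hpr
  have hqr' := S.inner_eq hv hq hr hqr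
  obtain ⟨T, lam, hlam, hT⟩ := exists_isometry_smul_pt3 (e₁ := (1 / 2 : ℝ) • p)
    (e₂ := (1 / 2 : ℝ) • q) (e₃ := (1 / 2 : ℝ) • r) (c := m / 2) (by linarith)
    (by rw [real_inner_smul_left, real_inner_smul_right]; linarith)
    (by rw [real_inner_smul_left, real_inner_smul_right]; linarith)
    (by rw [real_inner_smul_left, real_inner_smul_right]; linarith)
    (by rw [real_inner_smul_left, real_inner_smul_right]; linarith)
    (by rw [real_inner_smul_left, real_inner_smul_right]; linarith)
    (by rw [real_inner_smul_left, real_inner_smul_right]; linarith)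
  refine ⟨T, lam, _, _, _, hlam, hT, ?_⟩
  unfold IsCubicFrame
  rw [← smul_add, ← smul_add, hsum]
  simp only [smul_smul]
  norm_num
  exact ⟨hv, hpq, hpr, hqr, hN, by simpa using hsum⟩

lemma RhombicSkeleton.exists_isometry_isGoldenFrame {V : Finset (Euc 3)}
    {N : Euc 3 → Finset (Euc 3)} {V₁ V₂ : Set (Euc 3)} {a b m x : ℝ}
    (S : RhombicSkeleton V N V₁ V₂ a b m x) (hx : 4 * x ^ 2 + 2 * x - 1 = 0) :
    ∃ (T : Euc 3 ≃ₗᵢ[ℝ] Euc 3) (lam : ℝ) (e₁ e₂ e₃ : Euc 3), 0 < lam ∧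
      (∀ s t u : ℝ, lam • T (pt3 s t u) = s • e₁ + t • e₂ + u • e₃) ∧
      IsGoldenFrame N V₁ x e₁ e₂ e₃ := by
  obtain ⟨v, hv⟩ := S.ne₁
  obtain ⟨p, q, r, hpq, hpr, hqr, hN, hsum⟩ := S.exists_neighbors hv
  obtain ⟨-, hb, -, hm, -, hx'⟩ := S.parameters
  have hp := (hN p).2 (by simp)
  have hq := (hN q).2 (by simp)
  have hr := (hN r).2 (by simp)
  have hpp := S.sq₂ p (S.adj₁ v hv p hp)
  have hqq := S.sq₂ q (S.adj₁ v hv q hq)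
  have hrr := S.sq₂ r (S.adj₁ v hv r hr)
  have hpq' := S.inner_eq hv hp hq hpq
  have hpr' := S.inner_eq hv hp hr hpr
  have hqr' := S.inner_eq hv hq hr hqr
  subst hb
  obtain ⟨T, lam, hlam, hT⟩ := exists_isometry_smul_pt3
    (e₁ := (-x) • p + (2 * x ^ 2) • q + (1 / 2 : ℝ) • r)
    (e₂ := (1 / 2 : ℝ) • p + (-x) • q + (2 * x ^ 2) • r)
    (e₃ := (2 * x ^ 2) • p + (1 / 2 : ℝ) • q + (-x) • r)
    (c := m * (1 - 2 * x)) (mul_pos hm (by linarith))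
    (by
      simp only [inner_add_left, inner_add_right, real_inner_smul_left, real_inner_smul_right,
        real_inner_comm p q, real_inner_comm p r, real_inner_comm q r, hpp, hqq, hrr, hpq', hpr',
        hqr']
      linear_combination m * (-2 * x ^ 3 + x ^ 2 - x / 2 + 1 / 2) * hx)
    (by
      simp only [inner_add_left, inner_add_right, real_inner_smul_left, real_inner_smul_right,
        real_inner_comm p q, real_inner_comm p r, real_inner_comm q r, hpp, hqq, hrr, hpq', hpr',
        hqr']
      linear_combination m * (-2 * x ^ 3 + x ^ 2 - x / 2 + 1 / 2) * hx)
    (by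
      simp only [inner_add_left, inner_add_right, real_inner_smul_left, real_inner_smul_right,
        real_inner_comm p q, real_inner_comm p r, real_inner_comm q r, hpp, hqq, hrr, hpq', hpr',
        hqr']
      linear_combination m * (-2 * x ^ 3 + x ^ 2 - x / 2 + 1 / 2) * hx)
    (by
      simp only [inner_add_left, inner_add_right, real_inner_smul_left, real_inner_smul_right,
        real_inner_comm p q, real_inner_comm p r, real_inner_comm q r, hpp, hqq, hrr, hpq', hpr',
        hqr']
      linear_combination m * (2 * x ^ 3 - x ^ 2 + x / 2) * hx)
    (by
      simp only [inner_add_left, inner_add_right, real_inner_smul_left, real_inner_smul_right,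
        real_inner_comm p q, real_inner_comm p r, real_inner_comm q r, hpp, hqq, hrr, hpq', hpr',
        hqr']
      linear_combination m * (2 * x ^ 3 - x ^ 2 + x / 2) * hx)
    (by
      simp only [inner_add_left, inner_add_right, real_inner_smul_left, real_inner_smul_right,
        real_inner_comm p q, real_inner_comm p r, real_inner_comm q r, hpp, hqq, hrr, hpq', hpr',
        hqr']
      linear_combination m * (2 * x ^ 3 - x ^ 2 + x / 2) * hx)
  refine ⟨T, lam, _, _, _, hlam, hT, ?_⟩
  have hframe : IsFrame N V₁ x v p q r := ⟨hv, hpq, hpr, hqr, hN, hsum⟩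
  unfold IsGoldenFrame
  convert hframe using 1
  · have hv' : v = (1 / 2 - x + 2 * x ^ 2) • (p + q + r) := by
      rw [hsum, smul_smul]
      match_scalars
      linear_combination -x * hx
    rw [hv']
    module
  all_goals
    match_scalars <;>
      first | linear_combination hx / 2 | linear_combination -hx / 2 | linear_combination x * hx

end Axes

section SignedRotations

variable {E : Type*} [NormedAddCommGroup E] [InnerProductSpace ℝ E]
  {V : Finset E} {N : E → Finset E} {V₁ V₂ : Set E} {a b m x : ℝ}

/-- The triples obtained from three given axes by cyclic permutations and sign changes. -/
inductive SignedRotation (e₁ e₂ e₃ : E) : E → E → E → Prop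
  | refl : SignedRotation e₁ e₂ e₃ e₁ e₂ e₃
  | rotate {f₁ f₂ f₃ : E} : SignedRotation e₁ e₂ e₃ f₁ f₂ f₃ → SignedRotation e₁ e₂ e₃ f₂ f₃ f₁
  | neg {f₁ f₂ f₃ : E} : SignedRotation e₁ e₂ e₃ f₁ f₂ f₃ → SignedRotation e₁ e₂ e₃ (-f₁) f₂ f₃

namespace SignedRotation

variable {e₁ e₂ e₃ f₁ f₂ f₃ : E} {s t u : ℝ}

lemma smul (hs : s = 1 ∨ s = -1) (ht : t = 1 ∨ t = -1) (hu : u = 1 ∨ u = -1) :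
    SignedRotation e₁ e₂ e₃ (s • e₁) (t • e₂) (u • e₃) := by
  have key : ∀ {f₁ f₂ f₃ : E} {s : ℝ}, s = 1 ∨ s = -1 → SignedRotation e₁ e₂ e₃ f₁ f₂ f₃ →
      SignedRotation e₁ e₂ e₃ f₂ f₃ (s • f₁) := by
    rintro f₁ f₂ f₃ s (rfl | rfl) h
    · simpa using h.rotate
    · simpa using h.neg.rotate
  exact key hu (key ht (key hs refl))

lemma exists_eq (h : SignedRotation e₁ e₂ e₃ f₁ f₂ f₃) :
    ∃ s t u : ℝ, (s = 1 ∨ s = -1) ∧ (t = 1 ∨ t = -1) ∧ (u = 1 ∨ u = -1) ∧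
      ((f₁ = s • e₁ ∧ f₂ = t • e₂ ∧ f₃ = u • e₃) ∨ (f₁ = s • e₂ ∧ f₂ = t • e₃ ∧ f₃ = u • e₁) ∨
        (f₁ = s • e₃ ∧ f₂ = t • e₁ ∧ f₃ = u • e₂)) := by
  induction h with
  | refl => exact ⟨1, 1, 1, by simp⟩
  | rotate _ ih =>
    obtain ⟨s, t, u, hs, ht, hu, h⟩ := ih
    exact ⟨t, u, s, ht, hu, hs, by tauto⟩
  | neg _ ih =>
    obtain ⟨s, t, u, hs, ht, hu, h⟩ := ih
    refine ⟨-s, t, u, ?_, ht, hu, ?_⟩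
    · rcases hs with rfl | rfl <;> simp
    · rcases h with ⟨rfl, h⟩ | ⟨rfl, h⟩ | ⟨rfl, h⟩ <;> simp [h]

lemma isCubicFrame (S : RhombicSkeleton V N V₁ V₂ a b m 0) (he : IsCubicFrame N V₁ e₁ e₂ e₃)
    (h : SignedRotation e₁ e₂ e₃ f₁ f₂ f₃) : IsCubicFrame N V₁ f₁ f₂ f₃ := by
  induction h with
  | refl => exact he
  | rotate _ ih => exact ih.rotate
  | neg _ ih => exact ih.neg S

lemma isGoldenFrame (S : RhombicSkeleton V N V₁ V₂ a b m x) (hx : 4 * x ^ 2 + 2 * x - 1 = 0)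
    (he : IsGoldenFrame N V₁ x e₁ e₂ e₃) (h : SignedRotation e₁ e₂ e₃ f₁ f₂ f₃) :
    IsGoldenFrame N V₁ x f₁ f₂ f₃ := by
  induction h with
  | refl => exact he
  | rotate _ ih => exact ih.rotate
  | neg _ ih => exact ih.neg S hx

end SignedRotation

/-- The sums of the axes, up to cyclic permutations and sign changes. -/
def signedSums (e₁ e₂ e₃ : E) : Set E :=
  {y | ∃ f₁ f₂ f₃, SignedRotation e₁ e₂ e₃ f₁ f₂ f₃ ∧ y = f₁ + f₂ + f₃}

/-- The combinations `a e₂ + b e₃`, up to cyclic permutations and sign changes of the axes. -/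
def signedCombos (e₁ e₂ e₃ : E) (a b : ℝ) : Set E :=
  {y | ∃ f₁ f₂ f₃, SignedRotation e₁ e₂ e₃ f₁ f₂ f₃ ∧ y = a • f₂ + b • f₃}

lemma smul_image_cubeVerts {e₁ e₂ e₃ : Euc 3} {T : Euc 3 ≃ₗᵢ[ℝ] Euc 3} {lam : ℝ}
    (hT : ∀ s t u : ℝ, lam • T (pt3 s t u) = s • e₁ + t • e₂ + u • e₃) :
    lam • (T '' cubeVerts) = signedSums e₁ e₂ e₃ := by
  apply Subset.antisymm
  · rintro _ ⟨_, ⟨_, ⟨s, t, u, hs, ht, hu, rfl⟩, rfl⟩, rfl⟩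
    exact ⟨_, _, _, .smul hs ht hu, hT s t u⟩
  · rintro _ ⟨f₁, f₂, f₃, h, rfl⟩
    obtain ⟨s, t, u, hs, ht, hu, ⟨rfl, rfl, rfl⟩ | ⟨rfl, rfl, rfl⟩ | ⟨rfl, rfl, rfl⟩⟩ := h.exists_eq
    · exact ⟨_, ⟨_, ⟨s, t, u, hs, ht, hu, rfl⟩, rfl⟩, hT s t u⟩
    · refine ⟨_, ⟨_, ⟨u, s, t, hu, hs, ht, rfl⟩, rfl⟩, (hT u s t).trans ?_⟩
      abel
    · refine ⟨_, ⟨_, ⟨t, u, s, ht, hu, hs, rfl⟩, rfl⟩, (hT t u s).trans ?_⟩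
      abel

lemma smul_image_cycSigns {e₁ e₂ e₃ : Euc 3} {T : Euc 3 ≃ₗᵢ[ℝ] Euc 3} {lam : ℝ}
    (hT : ∀ s t u : ℝ, lam • T (pt3 s t u) = s • e₁ + t • e₂ + u • e₃) (a b : ℝ) :
    lam • (T '' cycSigns a b) = signedCombos e₁ e₂ e₃ a b := by
  have hone : (1 : ℝ) = 1 ∨ (1 : ℝ) = -1 := Or.inl rfl
  apply Subset.antisymm
  · rintro _ ⟨_, ⟨_, ⟨s, t, hs, ht, rfl | rfl | rfl⟩, rfl⟩, rfl⟩
    · refine ⟨_, _, _, .smul hone hs ht, (hT _ _ _).trans ?_⟩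
      module
    · refine ⟨_, _, _, (SignedRotation.smul ht hone hs).rotate, (hT _ _ _).trans ?_⟩
      module
    · refine ⟨_, _, _, (SignedRotation.smul hs ht hone).rotate.rotate, (hT _ _ _).trans ?_⟩
      module
  · rintro _ ⟨f₁, f₂, f₃, h, rfl⟩
    obtain ⟨-, t, u, -, ht, hu, ⟨-, rfl, rfl⟩ | ⟨-, rfl, rfl⟩ | ⟨-, rfl, rfl⟩⟩ := h.exists_eq
    · refine ⟨_, ⟨_, ⟨t, u, ht, hu, Or.inl rfl⟩, rfl⟩, (hT _ _ _).trans ?_⟩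
      module
    · refine ⟨_, ⟨_, ⟨t, u, ht, hu, Or.inr (Or.inl rfl)⟩, rfl⟩, (hT _ _ _).trans ?_⟩
      module
    · refine ⟨_, ⟨_, ⟨t, u, ht, hu, Or.inr (Or.inr rfl)⟩, rfl⟩, (hT _ _ _).trans ?_⟩
      module

namespace RhombicSkeleton

variable {e₁ e₂ e₃ : E}

lemma convexHull_eq_of_isCubicFrame (S : RhombicSkeleton V N V₁ V₂ a b m 0)
    (he : IsCubicFrame N V₁ e₁ e₂ e₃) :
    convexHull ℝ (V : Set E) = convexHull ℝ (signedSums e₁ e₂ e₃ ∪ signedCombos e₁ e₂ e₃ 0 2) := by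
  apply Subset.antisymm
  · refine convexHull_min (S.vertices_subset_convexHull (K := signedSums e₁ e₂ e₃)
      ⟨_, _, _, _, .refl, rfl⟩ ?_)
      (convex_convexHull ℝ _)
    rintro _ ⟨f₁, f₂, f₃, h, rfl⟩
    refine ⟨Or.inl ⟨_, _, _, h, rfl⟩, _, _, _, h.isCubicFrame S he,
      ⟨_, _, _, h.rotate.rotate.neg, ?_⟩, ⟨_, _, _, h.neg, ?_⟩, ⟨_, _, _, h.rotate.neg, ?_⟩,
      Or.inr ⟨_, _, _, h.rotate, ?_⟩, Or.inr ⟨_, _, _, h.rotate.rotate, ?_⟩,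
      Or.inr ⟨_, _, _, h, ?_⟩⟩
    all_goals module
  · refine convexHull_mono (union_subset ?_ ?_)
    · rintro _ ⟨f₁, f₂, f₃, h, rfl⟩
      exact S.mem₁ (h.isCubicFrame S he).mem
    · rintro _ ⟨f₁, f₂, f₃, h, rfl⟩
      have hf := h.rotate.rotate.isCubicFrame S he
      rw [zero_smul, zero_add]
      exact S.sub _ (S.mem₁ hf.mem) (IsFrame.mem_left hf)

lemma convexHull_eq_of_isGoldenFrame (S : RhombicSkeleton V N V₁ V₂ a b m x)
    (hx : 4 * x ^ 2 + 2 * x - 1 = 0) (he : IsGoldenFrame N V₁ x e₁ e₂ e₃) :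
    convexHull ℝ (V : Set E) = convexHull ℝ (signedSums e₁ e₂ e₃ ∪
      signedCombos e₁ e₂ e₃ (2 * x) (1 + 2 * x) ∪ signedCombos e₁ e₂ e₃ (1 + 2 * x) 1) := by
  apply Subset.antisymm
  · refine convexHull_min (S.vertices_subset_convexHull
      (K := signedSums e₁ e₂ e₃ ∪ signedCombos e₁ e₂ e₃ (2 * x) (1 + 2 * x))
      ⟨_, Or.inl ⟨_, _, _, .refl, rfl⟩⟩ ?_) (convex_convexHull ℝ _)
    rintro _ (⟨f₁, f₂, f₃, h, rfl⟩ | ⟨f₁, f₂, f₃, h, rfl⟩)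
    · refine ⟨Or.inl (Or.inl ⟨_, _, _, h, rfl⟩), _, _, _, h.isGoldenFrame S hx he,
        Or.inr ⟨_, _, _, h, ?_⟩, Or.inr ⟨_, _, _, h.rotate, ?_⟩,
        Or.inr ⟨_, _, _, h.rotate.rotate, ?_⟩,
        Or.inr ⟨_, _, _, h, ?_⟩, Or.inr ⟨_, _, _, h.rotate, ?_⟩,
        Or.inr ⟨_, _, _, h.rotate.rotate, ?_⟩⟩
      all_goals module
    · refine ⟨Or.inl (Or.inr ⟨_, _, _, h, rfl⟩), _, _, _, (h.isGoldenFrame S hx he).adjacent S hx,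
        Or.inl ⟨_, _, _, h, ?_⟩, Or.inr ⟨_, _, _, h.rotate.neg.rotate.rotate, ?_⟩,
        Or.inl ⟨_, _, _, h.neg, ?_⟩,
        Or.inr ⟨_, _, _, h, ?_⟩, Or.inr ⟨_, _, _, h.rotate, ?_⟩,
        Or.inr ⟨_, _, _, h.neg.rotate, ?_⟩⟩
      all_goals module
  · refine convexHull_mono (union_subset (union_subset ?_ ?_) ?_)
    · rintro _ ⟨f₁, f₂, f₃, h, rfl⟩
      exact S.mem₁ (h.isGoldenFrame S hx he).mem
    · rintro _ ⟨f₁, f₂, f₃, h, rfl⟩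
      exact S.mem₁ ((h.isGoldenFrame S hx he).adjacent S hx).mem
    · rintro _ ⟨f₁, f₂, f₃, h, rfl⟩
      have hf := h.isGoldenFrame S hx he
      rw [one_smul]
      exact S.sub _ (S.mem₁ hf.mem) (IsFrame.mem_left hf)

end RhombicSkeleton

lemma smul_image_convexHull (T : Euc 3 ≃ₗᵢ[ℝ] Euc 3) (lam : ℝ) (W : Set (Euc 3)) :
    lam • (T '' convexHull ℝ W) = convexHull ℝ (lam • (T '' W)) := by
  rw [convexHull_smul]
  congr 1
  exact T.toLinearEquiv.toLinearMap.image_convexHull W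

lemma rhombicDodecahedron_eq : rhombicDodecahedron = convexHull ℝ (cubeVerts ∪ cycSigns 0 2) := by
  rw [rhombicDodecahedron]
  congr 1
  apply Subset.antisymm
  · intro y hy
    rcases hy with rfl | rfl | rfl | rfl | rfl | rfl | rfl | rfl | rfl | rfl | rfl | rfl | rfl | rfl
    iterate 8 exact Or.inl ⟨_, _, _, by simp, by simp, by simp, rfl⟩
    · exact Or.inr ⟨1, 1, by simp, by simp, by simp⟩
    · exact Or.inr ⟨1, -1, by simp, by simp, by simp⟩
    · exact Or.inr ⟨1, 1, by simp, by simp, by simp⟩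
    · exact Or.inr ⟨1, -1, by simp, by simp, by simp⟩
    · exact Or.inr ⟨1, 1, by simp, by simp, by simp⟩
    · exact Or.inr ⟨1, -1, by simp, by simp, by simp⟩
  · rintro _ (⟨s, t, u, rfl | rfl, rfl | rfl, rfl | rfl, rfl⟩ |
      ⟨s, t, rfl | rfl, rfl | rfl, rfl | rfl | rfl⟩) <;> simp

end SignedRotations

section Classification

lemma goldenR_eq {x : ℝ} (h0 : 0 < x) (hx : 4 * x ^ 2 + 2 * x - 1 = 0) :
    goldenR = 1 + 2 * x ∧ 1 / goldenR = 2 * x := by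
  have h : goldenR = 1 + 2 * x := by
    have h5 : √5 = 1 + 4 * x := by
      rw [show (5 : ℝ) = (1 + 4 * x) ^ 2 by linarith, Real.sqrt_sq (by linarith)]
    rw [goldenR, h5]
    ring
  refine ⟨h, ?_⟩
  rw [h, div_eq_iff (by linarith)]
  linarith

lemma RhombicSkeleton.convexHull_eq {V : Finset (Euc 3)} {N : Euc 3 → Finset (Euc 3)}
    {V₁ V₂ : Set (Euc 3)} {a b m x : ℝ} (S : RhombicSkeleton V N V₁ V₂ a b m x) :
    ∃ (T : Euc 3 ≃ₗᵢ[ℝ] Euc 3) (lam : ℝ), 0 < lam ∧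
      (convexHull ℝ (V : Set (Euc 3)) = lam • (T '' rhombicDodecahedron) ∨
        convexHull ℝ (V : Set (Euc 3)) = lam • (T '' rhombicTriacontahedron)) := by
  rcases S.parameter_cases with rfl | ⟨h0, hx⟩
  · obtain ⟨T, lam, e₁, e₂, e₃, hlam, hT, he⟩ := S.exists_isometry_isCubicFrame
    refine ⟨T, lam, hlam, Or.inl ?_⟩
    rw [rhombicDodecahedron_eq, smul_image_convexHull, image_union, smul_set_union,
      smul_image_cubeVerts hT, smul_image_cycSigns hT, S.convexHull_eq_of_isCubicFrame he]
  · obtain ⟨T, lam, e₁, e₂, e₃, hlam, hT, he⟩ := S.exists_isometry_isGoldenFrame hx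
    refine ⟨T, lam, hlam, Or.inr ?_⟩
    rw [rhombicTriacontahedron, smul_image_convexHull, image_union, image_union, smul_set_union,
      smul_set_union, smul_image_cubeVerts hT, smul_image_cycSigns hT, smul_image_cycSigns hT,
      (goldenR_eq h0 hx).2, (goldenR_eq h0 hx).1, S.convexHull_eq_of_isGoldenFrame hx he]

end Classification

/-- For `d ≥ 3`, a full-dimensional convex polytope that is edge- but not
vertex-transitive satisfies `d = 3` and is, up to a linear isometry and positive scaling,
the rhombic dodecahedron or the rhombic triacontahedron. -/
theorem edge_not_vertex_transitive_classification {d : ℕ} (hd : 3 ≤ d)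
    (P : Set (Euc d)) (hP : IsPolytope P) (hfull : FullDim P)
    (hET : EdgeTransitive P) (hVT : ¬ VertexTransitive P) :
    ∃ h : d = 3, ∃ (T : Euc 3 ≃ₗᵢ[ℝ] Euc 3) (lam : ℝ), 0 < lam ∧
      (((LinearIsometryEquiv.piLpCongrLeft 2 ℝ ℝ (finCongr h)) '' P
          = lam • (T '' rhombicDodecahedron)) ∨
       ((LinearIsometryEquiv.piLpCongrLeft 2 ℝ ℝ (finCongr h)) '' P
          = lam • (T '' rhombicTriacontahedron))) := by
  obtain ⟨V, hV, hVP⟩ := hP.exists_vertices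
  obtain ⟨V₁, V₂, a, b, m, S, hS⟩ := hET.exists_bipartiteSkeleton hd hfull hVT hV hVP
  have hfin : Module.finrank ℝ (Euc d) = d := by simp
  have key : d = 3 ∧ ∃ (W₁ W₂ : Set (Euc d)) (a b m x : ℝ),
      RhombicSkeleton V (edgeNeighbors P V) W₁ W₂ a b m x := by
    rcases lt_trichotomy a b with hab | rfl | hab
    · obtain ⟨h, x, R⟩ := S.exists_rhombicSkeleton hab (by rwa [hfin])
      exact ⟨hfin.symm.trans h, _, _, _, _, _, _, R⟩
    · obtain ⟨v, hv⟩ := S.ne₁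
      have hcard := S.card_neighbors le_rfl hv
      obtain ⟨w, hw⟩ := Finset.card_pos.1 (by omega : 0 < (edgeNeighbors P V v).card)
      obtain ⟨g, hg, hgv⟩ := S.exists_isometry_of_eq (S.mem₁ hv) hw
      exact absurd (hgv ▸ S.adj₁ v hv w hw) (hS g hg v hv)
    · obtain ⟨h, x, R⟩ := S.swap.exists_rhombicSkeleton hab (by rwa [hfin])
      exact ⟨hfin.symm.trans h, _, _, _, _, _, _, R⟩
  obtain ⟨rfl, W₁, W₂, a, b, m, x, R⟩ := key
  refine ⟨rfl, ?_⟩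
  have hid : (LinearIsometryEquiv.piLpCongrLeft 2 ℝ ℝ (finCongr (rfl : 3 = 3))) '' P = P := by
    convert image_id P
    ext
    simp
  rw [hid, ← hVP]
  exact R.convexHull_eq
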